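/- Fix an algebraically closed field K (of arbitrary characteristic) and positive integers n and m. The ring of matrix invariants S(n,m) = K[Mat_{n,n}^m]^{GL_n} is generated by its homogeneous elements of degree at most (m+1)·n^4. -/

import Mathlib

open MvPolynomial Matrix

/-- Coordinate functions of an `m`-tuple of `n × n` matrices. -/
def matCoords {K : Type} [Field K] {n m : ℕ} (X : Fin m → Matrix (Fin n) (Fin n) K) :
    Fin m × Fin n × Fin n → K :=
  fun p => X p.1 p.2.1 p.2.2

/-- The ring of matrix semi-invariants `R(n,m) = K[Mat_{n,n}^m]^{SL_n × SL_n}`, where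
`(A,B)` acts by `(X_1, …, X_m) ↦ (A X_1 B⁻¹, …, A X_m B⁻¹)`. -/
noncomputable def matrixSemiInvariants (K : Type) [Field K] (n m : ℕ) :
    Subalgebra K (MvPolynomial (Fin m × Fin n × Fin n) K) :=
  ⨅ (A : SpecialLinearGroup (Fin n) K) (B : SpecialLinearGroup (Fin n) K)
    (X : Fin m → Matrix (Fin n) (Fin n) K),
      AlgHom.equalizer
        (aeval (matCoords fun i => A.val * X i * (B⁻¹).val))
        (aeval (matCoords X))

/-- The ring of matrix invariants `S(n,m) = K[Mat_{n,n}^m]^{GL_n}`, where `A` acts by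
simultaneous conjugation. -/
noncomputable def matrixInvariants (K : Type) [Field K] (n m : ℕ) :
    Subalgebra K (MvPolynomial (Fin m × Fin n × Fin n) K) :=
  ⨅ (A : GeneralLinearGroup (Fin n) K) (X : Fin m → Matrix (Fin n) (Fin n) K),
      AlgHom.equalizer
        (aeval (matCoords fun i => A.val * X i * (A⁻¹).val))
        (aeval (matCoords X))

set_option linter.all false

namespace MI
abbrev Sig (M n : ℕ) := Fin M × Fin n × Fin n
noncomputable def ev {K L : Type} [CommSemiring K] [CommSemiring L] [Algebra K L] {M n : ℕ}
    (X : Fin M → Matrix (Fin n) (Fin n) L) : MvPolynomial (Sig M n) K →ₐ[K] L :=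
  aeval fun p => X p.1 p.2.1 p.2.2
noncomputable def gm (K : Type) [CommSemiring K] (M n : ℕ) (l : Fin M) :
    Matrix (Fin n) (Fin n) (MvPolynomial (Sig M n) K) :=
  Matrix.of fun i j => MvPolynomial.X (l, i, j)
lemma ev_X {K L : Type} [CommSemiring K] [CommSemiring L] [Algebra K L] {M n : ℕ}
    (X : Fin M → Matrix (Fin n) (Fin n) L) (p : Sig M n) :
    ev (K := K) X (MvPolynomial.X p) = X p.1 p.2.1 p.2.2 := by simp [ev]
lemma ev_gm {K : Type} [CommSemiring K] {M n : ℕ} (f : MvPolynomial (Sig M n) K) :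
    ev (gm K M n) f = f := by
  have : (ev (gm K M n)) = AlgHom.id K (MvPolynomial (Sig M n) K) := by
    apply MvPolynomial.algHom_ext; intro p; simp [ev, gm]
  rw [this]; rfl
lemma map_ev {K L L' : Type} [CommSemiring K] [CommSemiring L] [Algebra K L]
    [CommSemiring L'] [Algebra K L'] {M n : ℕ} (φ : L →ₐ[K] L')
    (X : Fin M → Matrix (Fin n) (Fin n) L) (f : MvPolynomial (Sig M n) K) :
    φ (ev X f) = ev (fun l => (X l).map φ) f := by
  have : φ.comp (ev X) = ev (K := K) (fun l => (X l).map φ) := by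
    apply MvPolynomial.algHom_ext; intro p; simp [ev]
  rw [← this]; rfl
section
variable {K : Type} [Field K] {M n : ℕ}
def IsSI (e : ℕ) (f : MvPolynomial (Sig M n) K) : Prop :=
  ∀ (P Q : Matrix (Fin n) (Fin n) K), P.det ≠ 0 → Q.det ≠ 0 →
    ∀ X : Fin M → Matrix (Fin n) (Fin n) K,
      ev (fun l => P * X l * Q) f = (P.det * Q.det) ^ e * ev X f
noncomputable def SI (K : Type) [Field K] (M n e : ℕ) :
    Submodule K (MvPolynomial (Sig M n) K) where
  carrier := {f | IsSI e f}
  add_mem' := by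
    intro a b ha hb P Q hP hQ X
    rw [map_add, map_add, ha P Q hP hQ, hb P Q hP hQ]; ring
  zero_mem' := by intro P Q hP hQ X; simp
  smul_mem' := by
    intro c f hf P Q hP hQ X
    rw [map_smul, map_smul, hf P Q hP hQ, smul_eq_mul, smul_eq_mul]; ring
lemma SI_mul {e e' : ℕ} {f g : MvPolynomial (Sig M n) K} (hf : f ∈ SI K M n e)
    (hg : g ∈ SI K M n e') : f * g ∈ SI K M n (e + e') := by
  intro P Q hP hQ X
  rw [map_mul, map_mul, hf P Q hP hQ, hg P Q hP hQ]; ring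
lemma SI_one : (1 : MvPolynomial (Sig M n) K) ∈ SI K M n 0 := by
  intro P Q hP hQ X; simp
lemma SI_pow {e : ℕ} {f : MvPolynomial (Sig M n) K} (hf : f ∈ SI K M n e) (k : ℕ) :
    f ^ k ∈ SI K M n (k * e) := by
  induction k with
  | zero => simpa using SI_one
  | succ k ih => rw [pow_succ, Nat.succ_mul]; exact SI_mul ih hf
lemma SI_ext [Infinite K] {e : ℕ} {f : MvPolynomial (Sig M n) K} (hf : f ∈ SI K M n e)
    {L : Type} [CommRing L] [Algebra K L] (P Q : Matrix (Fin n) (Fin n) L)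
    (X : Fin M → Matrix (Fin n) (Fin n) L) :
    ev (fun l => P * X l * Q) f = (P.det * Q.det) ^ e * ev X f := by
  classical
  let τ : Type := (Fin n × Fin n) ⊕ (Fin n × Fin n) ⊕ Sig M n
  let R : Type := MvPolynomial τ K
  let P₀ : Matrix (Fin n) (Fin n) R := Matrix.of fun i j => MvPolynomial.X (Sum.inl (i, j))
  let Q₀ : Matrix (Fin n) (Fin n) R := Matrix.of fun i j => MvPolynomial.X (Sum.inr (Sum.inl (i, j)))
  let X₀ : Fin M → Matrix (Fin n) (Fin n) R := fun l =>
    Matrix.of fun i j => MvPolynomial.X (Sum.inr (Sum.inr (l, i, j)))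
  have key : ∀ {L : Type} [CommRing L] [Algebra K L] (P Q : Matrix (Fin n) (Fin n) L)
    (X : Fin M → Matrix (Fin n) (Fin n) L), ∃ φ : R →ₐ[K] L, P₀.map φ = P ∧ Q₀.map φ = Q ∧
      ∀ l, (X₀ l).map φ = X l := by
    intro L _ _ P Q X
    refine ⟨aeval (Sum.elim (fun p => P p.1 p.2) (Sum.elim (fun p => Q p.1 p.2)
      (fun p => X p.1 p.2.1 p.2.2))), ?_, ?_, ?_⟩
    · ext i j; exact aeval_X _ _
    · ext i j; exact aeval_X _ _
    · intro l; ext i j; exact aeval_X _ _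
  have key2 : ∀ {L : Type} [CommRing L] [Algebra K L] (P Q : Matrix (Fin n) (Fin n) L)
    (X : Fin M → Matrix (Fin n) (Fin n) L) (φ : R →ₐ[K] L), P₀.map φ = P → Q₀.map φ = Q →
      (∀ l, (X₀ l).map φ = X l) →
      φ (ev (fun l => P₀ * X₀ l * Q₀) f - (P₀.det * Q₀.det) ^ e * ev X₀ f) =
        ev (fun l => P * X l * Q) f - (P.det * Q.det) ^ e * ev X f := by
    intro L _ _ P Q X φ hP hQ hX
    rw [map_sub, map_mul, map_pow, map_mul, map_ev, map_ev, AlgHom.map_det, AlgHom.map_det]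
    congr 2
    · congr 1
      funext l
      rw [Matrix.map_mul, Matrix.map_mul, hP, hQ, hX]
    · rw [← hP, ← hQ]; rfl
    · congr 1
      congr 1; funext l; exact hX l
  have h0 : (ev (fun l => P₀ * X₀ l * Q₀) f - (P₀.det * Q₀.det) ^ e * ev X₀ f) *
      (P₀.det * Q₀.det) = 0 := by
    apply MvPolynomial.funext
    intro x
    rw [map_zero, map_mul]
    have hx : ∀ g : R, eval x g = (aeval x : R →ₐ[K] K) g := fun g => by rw [← MvPolynomial.coe_aeval_eq_eval]; rfl
    by_cases hd : eval x (P₀.det * Q₀.det) = 0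
    · rw [hd, mul_zero]
    · rw [hx, hx, key2 _ _ _ (aeval x) rfl rfl (fun l => rfl)]
      rw [hx, map_mul, AlgHom.map_det, AlgHom.map_det] at hd
      change (P₀.map (aeval x)).det * (Q₀.map (aeval x)).det ≠ 0 at hd
      rw [hf _ _ (left_ne_zero_of_mul hd) (right_ne_zero_of_mul hd)]
      rw [sub_self, zero_mul]
  have hP : P₀.det ≠ 0 := by
    intro h
    obtain ⟨φ, h1, -, -⟩ := key (1 : Matrix (Fin n) (Fin n) K) 1 (fun _ => 0)
    have := congrArg φ h
    rw [AlgHom.map_det] at this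
    change (P₀.map φ).det = _ at this
    rw [h1] at this; simp at this
  have hQ : Q₀.det ≠ 0 := by
    intro h
    obtain ⟨φ, -, h1, -⟩ := key (1 : Matrix (Fin n) (Fin n) K) 1 (fun _ => 0)
    have := congrArg φ h
    rw [AlgHom.map_det] at this
    change (Q₀.map φ).det = _ at this
    rw [h1] at this; simp at this
  have h1 := (mul_eq_zero.mp h0).resolve_right (mul_ne_zero hP hQ)
  obtain ⟨φ, hφ⟩ := key P Q X
  have := key2 P Q X φ hφ.1 hφ.2.1 hφ.2.2
  rw [h1, map_zero] at this
  exact (sub_eq_zero.mp this.symm)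
lemma coeff_scale {σ R : Type} [CommRing R] (w : σ → ℕ) (f : MvPolynomial σ R) (k : ℕ) :
    (aeval (fun i => Polynomial.C (MvPolynomial.X i) * Polynomial.X ^ (w i)) f :
      Polynomial (MvPolynomial σ R)).coeff k = weightedHomogeneousComponent w k f := by
  classical
  induction f using MvPolynomial.induction_on' with
  | monomial u a =>
    rw [aeval_monomial]
    have : (u.prod fun i e => (Polynomial.C (MvPolynomial.X i : MvPolynomial σ R) *
        Polynomial.X ^ (w i)) ^ e) =
        Polynomial.C (monomial u 1) * Polynomial.X ^ (Finsupp.weight w u) := by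
      rw [monomial_eq, map_one, one_mul, Finsupp.prod, Finsupp.prod, map_prod, Finsupp.weight_apply,
        Finsupp.sum, ← Finset.prod_pow_eq_pow_sum, ← Finset.prod_mul_distrib]
      refine Finset.prod_congr rfl fun i _ => ?_
      rw [mul_pow, ← pow_mul, map_pow, smul_eq_mul, mul_comm (w i)]
    rw [this]
    have h2 : algebraMap R (Polynomial (MvPolynomial σ R)) a = Polynomial.C (MvPolynomial.C a) := rfl
    rw [h2, ← mul_assoc, ← map_mul, C_mul_monomial, mul_one, Polynomial.coeff_C_mul_X_pow]
    have hw := isWeightedHomogeneous_monomial w u a rfl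
    split_ifs with hk
    · rw [hk, hw.weightedHomogeneousComponent_same]
    · rw [hw.weightedHomogeneousComponent_ne k hk]
  | add p q hp hq => rw [map_add, Polynomial.coeff_add, hp, hq, map_add]
lemma isWeighted_of_scale {σ R : Type} [CommRing R] (w : σ → ℕ) (f : MvPolynomial σ R) (k : ℕ)
    (h : (aeval (fun i => Polynomial.C (MvPolynomial.X i) * Polynomial.X ^ (w i)) f :
      Polynomial (MvPolynomial σ R)) = Polynomial.C f * Polynomial.X ^ k) :
    f.IsWeightedHomogeneous w k := by
  have := coeff_scale w f k
  rw [h, Polynomial.coeff_C_mul_X_pow, if_pos rfl] at this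
  rw [this]
  exact weightedHomogeneousComponent_isWeightedHomogeneous k f
lemma SI_homog [Infinite K] {e : ℕ} {f : MvPolynomial (Sig M n) K} (hf : f ∈ SI K M n e) :
    f.IsHomogeneous (n * e) := by
  apply isWeighted_of_scale
  have := SI_ext hf (Matrix.scalar (Fin n) (Polynomial.X : Polynomial (MvPolynomial (Sig M n) K))) 1
    (fun l => (gm K M n l).map (Polynomial.C : _ →+* Polynomial (MvPolynomial (Sig M n) K)))
  simp only [mul_one, det_one, Matrix.scalar_apply, det_diagonal, Finset.prod_const, Finset.card_univ,
    Fintype.card_fin, ← pow_mul] at this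
  have h2 : ev (fun l => (gm K M n l).map (Polynomial.C : _ →+* Polynomial (MvPolynomial (Sig M n) K))) f
      = Polynomial.C f := by
    have := map_ev (Algebra.ofId (MvPolynomial (Sig M n) K) (Polynomial (MvPolynomial (Sig M n) K))
      |>.restrictScalars K) (gm K M n) f
    rw [ev_gm] at this
    exact this.symm
  rw [h2] at this
  rw [mul_comm, ← this, ev]
  congr 2
  funext p
  rw [Matrix.diagonal_mul, Matrix.map_apply, gm, Matrix.of_apply, Pi.one_apply, pow_one, mul_comm]
end
section
variable {K : Type} [Field K] {M n : ℕ}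
def LInv (e : ℕ) (f : MvPolynomial (Sig M n) K) (P : Matrix (Fin n) (Fin n) K) : Prop :=
  ∀ X : Fin M → Matrix (Fin n) (Fin n) K, ev (fun l => P * X l) f = P.det ^ e * ev X f
lemma LInv.mul {e : ℕ} {f : MvPolynomial (Sig M n) K} {P Q : Matrix (Fin n) (Fin n) K}
    (hP : LInv e f P) (hQ : LInv e f Q) : LInv e f (P * Q) := by
  intro X
  have := hP (fun l => Q * X l)
  simp only [Matrix.mul_assoc]
  rw [this, hQ, det_mul]; ring
lemma LInv.comm {e : ℕ} {f : MvPolynomial (Sig M n) K} {i j k : Fin n} (hij : i ≠ j) (hik : i ≠ k)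
    (hkj : k ≠ j)
    (h1 : ∀ a, LInv e f (transvection i k a)) (h2 : ∀ a, LInv e f (transvection k j a)) (a : K) :
    LInv e f (transvection i j a) := by
  have : transvection i j a = transvection i k a * transvection k j 1 * transvection i k (-a) *
      transvection k j (-1) := by
    have hA : (single i k (-a) : Matrix (Fin n) (Fin n) K) = - single i k a := by
      ext x y; simp only [single, of_apply, Matrix.neg_apply]; split_ifs <;> simp
    have hB : (single k j (-1) : Matrix (Fin n) (Fin n) K) = - single k j 1 := by
      ext x y; simp only [single, of_apply, Matrix.neg_apply]; split_ifs <;> simp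
    have hAB : (single i k a * single k j 1 : Matrix (Fin n) (Fin n) K) = single i j a := by
      simp
    have hBA : (single k j 1 * single i k a : Matrix (Fin n) (Fin n) K) = 0 := by
      simp [hij.symm]
    have hAA : (single i k a * single i k a : Matrix (Fin n) (Fin n) K) = 0 := by
      simp [hik.symm]
    have hBB : (single k j 1 * single k j 1 : Matrix (Fin n) (Fin n) K) = 0 := by
      simp [hkj.symm]
    simp only [transvection, hA, hB]
    rw [← hAB]
    generalize (single i k a : Matrix (Fin n) (Fin n) K) = A at *
    generalize (single k j 1 : Matrix (Fin n) (Fin n) K) = B at *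
    simp only [mul_add, add_mul, mul_one, one_mul, mul_neg, neg_mul, Matrix.mul_assoc, hBA, hAA, hBB,
      mul_zero]
    simp only [← Matrix.mul_assoc, hAA, hBB, hBA, zero_mul]
    abel
  rw [this]
  exact (((h1 a).mul (h2 1)).mul (h1 (-a))).mul (h2 (-1))
lemma alg_identity {R : Type} [Ring R] [Algebra K R] (p q e g : R) (b : K) (hb : b ≠ 0)
    (epp : p * p = p) (eqq : q * q = q) (epq : p * q = 0) (eqp : q * p = 0) (eee : e * e = 0)
    (egg : g * g = 0) (eeg : e * g = p) (ege : g * e = q) (epe : p * e = e) (eep : e * p = 0)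
    (eqe : q * e = 0) (eeq : e * q = e) (epg : p * g = 0) (egp : g * p = g) (eqg : q * g = g)
    (egq : g * q = 0) :
    1 + b • g = (1 + b⁻¹ • e) * ((1 + (b⁻¹ - 1) • p + (b - 1) • q) *
      ((1 - p - q - e + g) * (1 + b⁻¹ • e))) := by
  have h1 : (1 - p - q - e + g) * (1 + b⁻¹ • e) = 1 - p - q - e + g + b⁻¹ • q := by
    simp only [add_mul, sub_mul, mul_add, mul_one, one_mul, mul_smul_comm, epe, eqe, eee, ege]
    simp
  have h2 : (1 + (b⁻¹ - 1) • p + (b - 1) • q) * (1 - p - q - e + g + b⁻¹ • q) =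
      1 - p - b⁻¹ • e + b • g := by
    simp only [add_mul, sub_mul, mul_add, mul_sub, mul_one, one_mul, mul_smul_comm, smul_mul_assoc, epp, epq,
      epe, epg, eqp, eqq, eqe, eqg, smul_add, smul_sub, sub_smul, smul_smul, smul_zero, one_smul,
      mul_inv_cancel₀ hb, inv_mul_cancel₀ hb]
    abel
  rw [h1, h2]
  simp only [add_mul, sub_mul, mul_add, mul_sub, mul_one, one_mul, mul_smul_comm, smul_mul_assoc, eep, eee,
    eeg, smul_smul, smul_add, smul_sub, smul_zero, inv_mul_cancel₀ hb, mul_inv_cancel₀ hb, one_smul]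
  abel
lemma const_of_inv [Infinite K] (p q : Polynomial K) (h : ∀ b : K, b ≠ 0 → p.eval b = q.eval b⁻¹)
    (b : K) : p.eval b = p.eval 0 := by
  classical
  have h1 : p * Polynomial.X ^ q.natDegree = q.reverse := by
    have : (p * Polynomial.X ^ q.natDegree - q.reverse) * Polynomial.X = 0 := by
      apply Polynomial.funext
      intro x
      by_cases hx : x = 0
      · simp [hx]
      · letI : Invertible x⁻¹ := invertibleOfNonzero (inv_ne_zero hx)
        have h4 := Polynomial.eval₂_reverse_mul_pow (RingHom.id K) x⁻¹ q
        simp only [invOf_eq_inv, inv_inv, Polynomial.eval₂_id] at h4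
        have : (p * Polynomial.X ^ q.natDegree - q.reverse).eval x = 0 := by
          simp only [Polynomial.eval_sub, Polynomial.eval_mul, Polynomial.eval_pow, Polynomial.eval_X,
            h x hx, ← h4]
          rw [mul_assoc, ← mul_pow, inv_mul_cancel₀ hx, one_pow, mul_one, sub_self]
        rw [Polynomial.eval_mul, this]; simp
    exact sub_eq_zero.mp ((mul_eq_zero.mp this).resolve_right Polynomial.X_ne_zero)
  have h2 : p.natDegree = 0 := by
    by_cases hp : p = 0
    · simp [hp]
    have := Polynomial.natDegree_mul_X_pow q.natDegree hp
    rw [h1] at this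
    have h5 := q.reverse_natDegree_le
    omega
  rw [Polynomial.eq_C_of_natDegree_eq_zero h2]; simp
lemma LInv.diag {e : ℕ} {f : MvPolynomial (Sig M n) K}
    (hrow : ∀ i, f.IsWeightedHomogeneous (fun p : Sig M n => if p.2.1 = i then 1 else 0) e)
    (D : Fin n → K) : LInv e f (diagonal D) := by
  intro X
  rw [det_diagonal]
  simp only [ev, aeval_eq_eval, eval_eq, Finset.mul_sum]
  refine Finset.sum_congr rfl fun d hd => ?_
  have h1 : ∀ p : Sig M n, (diagonal D * X p.1) p.2.1 p.2.2 = D p.2.1 * X p.1 p.2.1 p.2.2 := fun p => by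
    rw [diagonal_mul]
  simp only [h1, mul_pow, Finset.prod_mul_distrib]
  have h2 : ∏ p ∈ d.support, D p.2.1 ^ d p = (∏ i, D i) ^ e := by
    have h3 : ∀ p : Sig M n, D p.2.1 ^ d p = ∏ i, D i ^ ((if p.2.1 = i then 1 else 0) * d p) := by
      intro p
      rw [Finset.prod_eq_single p.2.1] <;> simp +contextual [eq_comm]
    simp only [h3]
    rw [Finset.prod_comm, ← Finset.prod_pow]
    refine Finset.prod_congr rfl fun i _ => ?_
    rw [Finset.prod_pow_eq_pow_sum]
    congr 1
    have := hrow i (mem_support_iff.mp hd)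
    rw [← this, Finsupp.weight_apply, Finsupp.sum]
    simp [mul_comm]
  rw [h2]; ring
lemma LInv.opp [Infinite K] {e : ℕ} {f : MvPolynomial (Sig M n) K}
    (hrow : ∀ i, f.IsWeightedHomogeneous (fun p : Sig M n => if p.2.1 = i then 1 else 0) e)
    {i j : Fin n} (hij : i ≠ j) (h1 : ∀ a, LInv e f (transvection i j a)) (a : K) :
    LInv e f (transvection j i a) := by
  intro X
  rw [det_transvection_of_ne _ _ hij.symm, one_pow, one_mul]
  have pol : ∀ (W W' : Matrix (Fin n) (Fin n) K), ∃ p : Polynomial K, ∀ c, p.eval c =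
      ev (fun l => (W + c • W') * X l) f := by
    intro W W'
    refine ⟨ev (fun l => (W.map Polynomial.C + Polynomial.X (R := K) • W'.map Polynomial.C) *
      (X l).map Polynomial.C) f, fun c => ?_⟩
    have := map_ev (Polynomial.aeval c : Polynomial K →ₐ[K] K)
      (fun l => (W.map Polynomial.C + Polynomial.X (R := K) • W'.map Polynomial.C) *
      (X l).map Polynomial.C) f
    rw [Polynomial.coe_aeval_eq_eval] at this
    rw [this]
    congr 2
    funext l
    ext x y
    simp [Matrix.mul_apply, Polynomial.eval_finsetSum, mul_comm c]
  let p' : Matrix (Fin n) (Fin n) K := single i i 1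
  let q' : Matrix (Fin n) (Fin n) K := single j j 1
  let e' : Matrix (Fin n) (Fin n) K := single i j 1
  let g' : Matrix (Fin n) (Fin n) K := single j i 1
  let W := 1 - p' - q' - e' + g'
  obtain ⟨p, hp⟩ := pol 1 g'
  obtain ⟨q, hq⟩ := pol W (W * e')
  have tr : ∀ (i j : Fin n) (c : K), (transvection i j c) = 1 + c • (single i j 1 : Matrix (Fin n) (Fin n) K) := by
    intro i j c; rw [transvection, smul_single, smul_eq_mul, mul_one]
  have key : ∀ b : K, b ≠ 0 → p.eval b = q.eval b⁻¹ := by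
    intro b hb
    have hid := alg_identity p' q' e' g' b hb (by simp [p']) (by simp [q']) (by simp [p', q', hij])
      (by simp [p', q', hij.symm]) (by simp [e', hij.symm]) (by simp [g', hij]) (by simp [e', g', p'])
      (by simp [e', g', q']) (by simp [e', p']) (by simp [e', p', hij.symm]) (by simp [e', q', hij.symm])
      (by simp [e', q']) (by simp [p', g', hij]) (by simp [p', g']) (by simp [q', g']) (by simp [q', g', hij])
    rw [hp, hq, hid]
    have hd : (1 + (b⁻¹ - 1) • p' + (b - 1) • q') =
        diagonal (fun k => if k = i then b⁻¹ else if k = j then b else 1) := by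
      ext x y
      by_cases hxy : x = y
      · subst hxy
        simp only [p', q', Matrix.add_apply, Matrix.smul_apply, single, of_apply, one_apply_eq,
          diagonal_apply_eq, smul_eq_mul, and_self]
        by_cases hx : x = i
        · subst hx; simp [hij.symm]
        · by_cases hx' : x = j
          · subst hx'; simp [hx, Ne.symm hx]
          · simp [hx, hx', Ne.symm hx, Ne.symm hx']
      · have a1 : ¬ (i = x ∧ i = y) := fun h => hxy (h.1.symm.trans h.2)
        have a2 : ¬ (j = x ∧ j = y) := fun h => hxy (h.1.symm.trans h.2)
        simp [p', q', single, hxy, a1, a2]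
    have e1 := h1 b⁻¹ (fun l => (1 + (b⁻¹ - 1) • p' + (b - 1) • q') * ((W * (1 + b⁻¹ • e')) * X l))
    rw [det_transvection_of_ne _ _ hij, one_pow, one_mul, tr] at e1
    have e2 := LInv.diag hrow (fun k => if k = i then b⁻¹ else if k = j then b else 1)
      (fun l => ((W * (1 + b⁻¹ • e')) * X l))
    rw [← hd] at e2
    rw [e2] at e1
    have e3 : (1 + (b⁻¹ - 1) • p' + (b - 1) • q').det = 1 := by
      rw [hd, det_diagonal, ← Finset.mul_prod_erase _ _ (Finset.mem_univ i),
        ← Finset.mul_prod_erase _ _ (Finset.mem_erase.mpr ⟨hij.symm, Finset.mem_univ j⟩),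
        Finset.prod_eq_one]
      · simp [hij.symm, hb]
      · intro x hx
        simp only [Finset.mem_erase] at hx
        simp [hx.1, hx.2.1]
    rw [e3, one_pow, one_mul] at e1
    convert e1 using 4
    · simp only [Matrix.mul_assoc]; rfl
    · simp [mul_add]
  have := const_of_inv p q key a
  rw [hp, hp] at this
  rw [tr, this]
  simp
lemma lemC [Infinite K] {e : ℕ} {f : MvPolynomial (Sig M n) K}
    (hrow : ∀ i, f.IsWeightedHomogeneous (fun p : Sig M n => if p.2.1 = i then 1 else 0) e)
    (hu : ∀ (i j : Fin n), i.val + 1 = j.val → ∀ (a : K) (X : Fin M → Matrix (Fin n) (Fin n) K),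
      ev (fun l => transvection i j a * X l) f = ev X f)
    (P : Matrix (Fin n) (Fin n) K) (hP : P.det ≠ 0) (X : Fin M → Matrix (Fin n) (Fin n) K) :
    ev (fun l => P * X l) f = P.det ^ e * ev X f := by
  have up : ∀ (d : ℕ) (i j : Fin n), i.val + (d + 1) = j.val → ∀ a, LInv e f (transvection i j a) := by
    intro d
    induction d with
    | zero =>
      intro i j h a X
      rw [det_transvection_of_ne _ _ (by rintro rfl; omega), one_pow, one_mul]
      exact hu i j h a X
    | succ d ih =>
      intro i j h a
      let k : Fin n := ⟨i.val + (d + 1), by omega⟩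
      refine LInv.comm (k := k) (by rintro rfl; omega) ?_ ?_ (ih i k rfl) ?_ a
      · intro h; have := congrArg Fin.val h; simp [k] at this
      · intro h; have := congrArg Fin.val h; simp [k] at this; omega
      · intro a X
        rw [det_transvection_of_ne, one_pow, one_mul]
        · apply hu; simp [k]; omega
        · intro h; have := congrArg Fin.val h; simp [k] at this; omega
  have all : ∀ (i j : Fin n), i ≠ j → ∀ a, LInv e f (transvection i j a) := by
    intro i j hij a
    rcases lt_or_gt_of_ne hij with h | h
    · exact up (j.val - i.val - 1) i j (by have : i.val < j.val := h; omega) a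
    · exact LInv.opp hrow hij.symm (up (i.val - j.val - 1) j i (by have : j.val < i.val := h; omega)) a
  have : LInv e f P := by
    apply diagonal_transvection_induction_of_det_ne_zero (LInv e f) P hP
    · intro D _; exact LInv.diag hrow D
    · intro t; exact all t.i t.j t.hij t.c
    · intro A B _ _ hA hB; exact hA.mul hB
  exact this X
end
section
variable {σ K : Type} [Fintype σ] [DecidableEq σ] [Field K] (p : ℕ)
noncomputable def cart : MvPolynomial σ K →ₗ[K] MvPolynomial σ K :=
  (basisMonomials σ K).constr K fun d =>
    if ∀ i, d i % p = p - 1 then monomial (d.mapRange (· / p) (Nat.zero_div p)) 1 else 0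
lemma cart_monomial (d : σ →₀ ℕ) (a : K) : cart p (monomial d a) =
    if ∀ i, d i % p = p - 1 then monomial (d.mapRange (· / p) (Nat.zero_div p)) a else 0 := by
  have h : (monomial d a : MvPolynomial σ K) = a • basisMonomials σ K d := by
    rw [coe_basisMonomials, smul_monomial, smul_eq_mul, mul_one]
  rw [h, map_smul, cart, Module.Basis.constr_basis]
  split_ifs
  · rw [smul_monomial, smul_eq_mul, mul_one]
  · rw [smul_zero]
variable [hp : Fact p.Prime]
lemma coeff_cart (f : MvPolynomial σ K) (b : σ →₀ ℕ) :
    coeff b (cart p f) = coeff (p • b + Finsupp.equivFunOnFinite.symm fun _ => p - 1) f := by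
  have hp0 := hp.out.pos
  induction f using MvPolynomial.induction_on' with
  | monomial d a =>
    rw [cart_monomial, coeff_monomial]
    by_cases h : d = p • b + Finsupp.equivFunOnFinite.symm fun _ => p - 1
    · subst h
      rw [if_pos rfl, if_pos, coeff_monomial, if_pos]
      · ext i
        simp only [Finsupp.mapRange_apply, Finsupp.add_apply, Finsupp.smul_apply,
          Finsupp.equivFunOnFinite_symm_apply_apply, smul_eq_mul]
        rw [Nat.mul_add_div hp0, Nat.div_eq_of_lt (by omega), add_zero]
      · intro i
        simp only [Finsupp.mapRange_apply, Finsupp.add_apply, Finsupp.smul_apply,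
          Finsupp.equivFunOnFinite_symm_apply_apply, smul_eq_mul]
        rw [Nat.mul_add_mod, Nat.mod_eq_of_lt (by omega)]
    · rw [if_neg h]
      split_ifs with h2
      · rw [coeff_monomial, if_neg]
        rintro rfl
        apply h
        ext i
        simp only [Finsupp.mapRange_apply, Finsupp.add_apply, Finsupp.smul_apply,
          Finsupp.equivFunOnFinite_symm_apply_apply, smul_eq_mul]
        rw [← h2 i, Nat.div_add_mod]
      · simp
  | add f g hf hg => rw [map_add, coeff_add, hf, hg, coeff_add]
lemma cart_expand (g f : MvPolynomial σ K) : cart p (expand p g * f) = g * cart p f := by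
  have hp0 := hp.out.pos
  induction g using MvPolynomial.induction_on' with
  | monomial d a =>
    induction f using MvPolynomial.induction_on' with
    | monomial d' a' =>
      rw [expand_monomial, monomial_mul, cart_monomial, cart_monomial]
      have h1 : ∀ i, (p • d + d') i % p = d' i % p := fun i => by
        simp [Nat.mul_add_mod]
      simp only [h1]
      split_ifs
      · rw [monomial_mul]
        congr 2
        ext i
        simp [Nat.mul_add_div hp0]
      · rw [mul_zero]
    | add f f' hf hf' => rw [mul_add, map_add, hf, hf', map_add, mul_add]
  | add g g' hg hg' => rw [map_add, add_mul, map_add, hg, hg', add_mul]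
lemma cart_pow [CharP K p] (s f : MvPolynomial σ K) :
    cart p (s ^ p * f) = MvPolynomial.map (frobenius K p) s * cart p f := by
  rw [← map_frobenius_expand, map_expand, cart_expand]
noncomputable def ush (T : Finset σ) (τ : σ → σ) (a : K) : MvPolynomial σ K →ₐ[K] MvPolynomial σ K :=
  aeval fun v => if v ∈ T then X v + C a * X (τ v) else X v
lemma cart_ush_single [CharP K p] (c d : σ) (τ : σ → σ) (hτ : τ c = d) (hcd : c ≠ d) (a : K)
    (s : MvPolynomial σ K) :
    cart p (ush {c} τ a s) = ush {c} τ (a ^ p) (cart p s) := by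
  have hp0 := hp.out.pos
  have uc : ∀ a : K, ush {c} τ a (X c) = X c + C a * X d := fun a => by simp [ush, hτ]
  have fixm : ∀ (a b : K) (m : σ →₀ ℕ), m c = 0 → ush {c} τ a (monomial m b) = monomial m b := by
    intro a b m hm
    rw [ush, aeval_monomial, monomial_eq, Finsupp.prod, Finsupp.prod]
    congr 1
    refine Finset.prod_congr rfl fun i hi => ?_
    have : i ≠ c := by rintro rfl; exact (Finsupp.mem_support_iff.mp hi) hm
    simp [this]
  have small : ∀ (ε : σ →₀ ℕ), ε c < p → ∀ b : K,
      cart p (ush {c} τ a (monomial ε b)) = cart p (monomial ε b) := by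
    intro ε hε b
    have h1 : (monomial ε b : MvPolynomial σ K) = monomial (ε.erase c) b * X c ^ ε c := by
      rw [X_pow_eq_monomial, monomial_mul, mul_one, Finsupp.erase_add_single]
    rw [h1, map_mul, map_pow, uc, fixm _ _ _ (Finsupp.erase_same), add_pow, Finset.mul_sum, map_sum,
      Finset.sum_eq_single (ε c)]
    · simp
    · intro j hj hne
      have hj' : j < ε c := by
        have := Finset.mem_range.mp hj
        omega
      have : (monomial (ε.erase c) b : MvPolynomial σ K) * (X c ^ j * (C a * X d) ^ (ε c - j) *
          ((ε c).choose j : MvPolynomial σ K)) =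
          monomial (ε.erase c + Finsupp.single c j + Finsupp.single d (ε c - j))
            (b * (a ^ (ε c - j) * ((ε c).choose j : K))) := by
        rw [mul_pow, X_pow_eq_monomial, X_pow_eq_monomial, ← map_pow, ← map_natCast (C : K →+* MvPolynomial σ K),
          C_mul_monomial, monomial_mul, mul_comm _ (C _), C_mul_monomial, monomial_mul]
        congr 1
        · rw [add_assoc]
        · ring
      rw [this, cart_monomial, if_neg]
      intro h
      have := h c
      simp [hcd.symm] at this
      rw [Nat.mod_eq_of_lt (by omega)] at this
      omega
    · intro h; simp at h
  induction s using MvPolynomial.induction_on' with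
  | monomial D b =>
    let ε : σ →₀ ℕ := D.erase c + Finsupp.single c (D c % p)
    have hε : ε c < p := by simp [ε, Nat.mod_lt _ hp0]
    have h1 : (monomial D b : MvPolynomial σ K) = expand p (X c ^ (D c / p)) * monomial ε b := by
      rw [map_pow, expand_X, ← pow_mul, X_pow_eq_monomial, monomial_mul, one_mul]
      congr 2
      ext i
      by_cases hi : i = c
      · subst hi; simp [ε, Nat.div_add_mod]
      · simp [ε, hi, Ne.symm hi]
    have h2 : ush {c} τ a (expand p (X c ^ (D c / p))) =
        expand p (ush {c} τ (a ^ p) (X c ^ (D c / p))) := by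
      rw [map_pow, map_pow, map_pow, map_pow, expand_X, uc, map_pow, uc, map_add, map_mul, expand_X, expand_X,
        expand_C, add_pow_char, mul_pow, map_pow]
    rw [h1, map_mul, h2, cart_expand, cart_expand, small ε hε, map_mul]
    congr 1
    rw [cart_monomial]
    split_ifs
    · rw [fixm]
      simp [Nat.div_eq_of_lt hε]
    · rw [map_zero]
  | add f g hf hg => rw [map_add, map_add, hf, hg, map_add, map_add]
lemma ush_insert (T : Finset σ) (τ : σ → σ) (c : σ) (hc : c ∉ T)
    (hτ : ∀ v ∈ insert c T, τ v ∉ insert c T) (a : K) (s : MvPolynomial σ K) :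
    ush (insert c T) τ a s = ush {c} τ a (ush T τ a s) := by
  have : ush (insert c T) τ a = (ush {c} τ a).comp (ush T τ a) := by
    apply MvPolynomial.algHom_ext
    intro v
    have hc' := hτ c (Finset.mem_insert_self _ _)
    by_cases hv : v ∈ T
    · have hvc : v ≠ c := by rintro rfl; exact hc hv
      have h2 := hτ v (Finset.mem_insert_of_mem hv)
      rw [Finset.mem_insert, not_or] at h2
      simp [ush, hv, hvc, h2.1]
    · by_cases hvc : v = c
      · subst hvc; simp [ush, hv]
      · simp [ush, hv, hvc]
  rw [this]; rfl
lemma cart_ush [CharP K p] (T : Finset σ) (τ : σ → σ) (hτ : ∀ v ∈ T, τ v ∉ T) (a : K)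
    (s : MvPolynomial σ K) :
    cart p (ush T τ a s) = ush T τ (a ^ p) (cart p s) := by
  induction T using Finset.induction_on generalizing s with
  | empty =>
    have : ∀ a : K, ush (∅ : Finset σ) τ a = AlgHom.id K (MvPolynomial σ K) := by
      intro a; apply MvPolynomial.algHom_ext; intro v; simp [ush]
    rw [this, this]; rfl
  | insert c T hc ih =>
    rw [ush_insert T τ c hc hτ, ush_insert T τ c hc hτ, cart_ush_single p c (τ c) τ rfl, ih]
    · intro v hv h
      exact hτ v (Finset.mem_insert_of_mem hv) (Finset.mem_insert_of_mem h)
    · intro h; exact hτ c (Finset.mem_insert_self _ _) (h ▸ Finset.mem_insert_self _ _)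
lemma ush_poly (T : Finset σ) (τ : σ → σ) (s : MvPolynomial σ K) :
    ∃ G : Polynomial (MvPolynomial σ K), ∀ a : K, ush T τ a s = G.eval (C a) := by
  refine ⟨aeval (fun v => if v ∈ T then Polynomial.C (X v) + Polynomial.X * Polynomial.C (X (τ v))
    else Polynomial.C (X v) : σ → Polynomial (MvPolynomial σ K)) s, fun a => ?_⟩
  have : ush T τ a = ((Polynomial.aeval (C a : MvPolynomial σ K)).restrictScalars K).comp
      (aeval (fun v => if v ∈ T then Polynomial.C (X v) + Polynomial.X * Polynomial.C (X (τ v))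
    else Polynomial.C (X v) : σ → Polynomial (MvPolynomial σ K))) := by
    apply MvPolynomial.algHom_ext
    intro v
    by_cases hv : v ∈ T <;> simp [ush, hv, mul_comm (C a) (X (τ v))]
  rw [this]
  simp
lemma ush_zero (T : Finset σ) (τ : σ → σ) (s : MvPolynomial σ K) : ush T τ 0 s = s := by
  have : ush T τ 0 = AlgHom.id K (MvPolynomial σ K) := by
    apply MvPolynomial.algHom_ext; intro v; simp [ush]
  rw [this]; rfl
lemma cart_inv [CharP K p] [Infinite K] (T : Finset σ) (τ : σ → σ) (hτ : ∀ v ∈ T, τ v ∉ T)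
    (t r t0 t1 : MvPolynomial σ K) (hr : ∀ a, ush T τ a r = r)
    (ht : ∀ a, ush T τ a t = t0 + C a * t1) (b : K) :
    ush T τ b (cart p (t ^ (p - 1) * r)) = cart p (t ^ (p - 1) * r) := by
  have hp0 := hp.out.pos
  obtain ⟨G, hG⟩ := ush_poly T τ (cart p (t ^ (p - 1) * r))
  let B₀ : Polynomial (MvPolynomial σ K) :=
    (Polynomial.C t0 + Polynomial.X * Polynomial.C t1) ^ (p - 1) * Polynomial.C r
  have hB₀ : B₀.natDegree ≤ p - 1 := by
    refine (Polynomial.natDegree_mul_C_le _ _).trans ?_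
    refine Polynomial.natDegree_pow_le.trans ?_
    have : (Polynomial.C t0 + Polynomial.X * Polynomial.C t1).natDegree ≤ 1 := by
      compute_degree
    nlinarith
  let B : Polynomial (MvPolynomial σ K) :=
    ∑ i ∈ Finset.range p, Polynomial.C (cart p (B₀.coeff i)) * Polynomial.X ^ i
  have hB : B.natDegree ≤ p - 1 := by
    apply Polynomial.natDegree_sum_le_of_forall_le
    intro i hi
    refine (Polynomial.natDegree_C_mul_X_pow_le _ _).trans ?_
    have := Finset.mem_range.mp hi
    omega
  have hval : ∀ a : K, (Polynomial.expand _ p G).eval (C a) = B.eval (C a) := by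
    intro a
    rw [Polynomial.expand_eval, ← map_pow, ← hG, ← cart_ush p T τ hτ, map_mul, map_pow, ht, hr]
    have h1 : (t0 + C a * t1) ^ (p - 1) * r = B₀.eval (C a) := by
      simp [B₀, mul_comm t1]
    rw [h1, Polynomial.eval_eq_sum_range' (lt_of_le_of_lt hB₀ (by omega : p - 1 < p)), map_sum]
    simp only [B, Polynomial.eval_finsetSum, Polynomial.eval_mul, Polynomial.eval_C, Polynomial.eval_pow,
      Polynomial.eval_X]
    refine Finset.sum_congr rfl fun i _ => ?_
    rw [← map_pow, mul_comm _ (C _), mul_comm _ (C _), ← smul_eq_C_mul, ← smul_eq_C_mul, map_smul]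
  have heq : Polynomial.expand _ p G = B := by
    apply Polynomial.eq_of_infinite_eval_eq
    refine Set.Infinite.mono (s := Set.range (C : K → MvPolynomial σ K)) ?_ ?_
    · rintro _ ⟨a, rfl⟩; exact hval a
    · exact Set.infinite_range_of_injective (C_injective σ K)
  have hdeg : G.natDegree = 0 := by
    have := Polynomial.natDegree_expand p G
    rw [heq] at this
    by_contra h
    have h2 : 1 ≤ G.natDegree := Nat.one_le_iff_ne_zero.mpr h
    nlinarith [Nat.sub_lt hp0 one_pos]
  rw [hG b]
  conv_rhs => rw [← ush_zero T τ (cart p _), hG 0]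
  rw [Polynomial.eq_C_of_natDegree_eq_zero hdeg]; simp
lemma cart_weighted (w : σ → ℕ) (s : MvPolynomial σ K) (e : ℕ)
    (hs : s.IsWeightedHomogeneous w ((p - 1) * (∑ i, w i) + p * e)) :
    (cart p s).IsWeightedHomogeneous w e := by
  intro b hb
  rw [coeff_cart] at hb
  have := hs hb
  rw [map_add, map_nsmul, Finsupp.weight_apply, Finsupp.weight_apply, smul_eq_mul] at this
  rw [Finsupp.weight_apply]
  rw [Finsupp.sum_fintype (Finsupp.equivFunOnFinite.symm fun _ => p - 1) _ (by simp)] at this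
  simp only [Finsupp.equivFunOnFinite_symm_apply_apply, smul_eq_mul, ← Finset.mul_sum] at this ⊢
  have hp0 := hp.out.pos
  have h3 : p * (b.sum fun i c => c * w i) = p * e := by omega
  exact Nat.eq_of_mul_eq_mul_left hp0 h3
end
section det
variable {R : Type} [CommRing R]
noncomputable def dt (m : ℕ) (B : ℕ → ℕ → R) : R := Matrix.det (Matrix.of fun k k' : Fin m => B k k')
lemma dt_transpose (m : ℕ) (B : ℕ → ℕ → R) : dt m B = dt m (fun k k' => B k' k) := by
  rw [dt, ← det_transpose]; rfl
lemma dt_congr (m : ℕ) (B B' : ℕ → ℕ → R) (h : ∀ k < m, ∀ k' < m, B k k' = B' k k') :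
    dt m B = dt m B' := by
  unfold dt; congr 1; ext k k'; exact h _ k.2 _ k'.2
lemma dt_inv (m : ℕ) (B : ℕ → ℕ → R) (q : ℕ → Prop) [DecidablePred q] (a : R)
    (hq : ∀ k < m, q k → k + 1 < m) :
    dt m (fun k k' => B k k' + if q k then a * B (k + 1) k' else 0) = dt m B := by
  unfold dt
  let V : Matrix (Fin m) (Fin m) R := Matrix.of fun s t => if t.val = s.val + 1 ∧ q s then a else 0
  have h1 : (Matrix.of fun k k' : Fin m => B k k' + if q k then a * B (k + 1) k' else 0) =
      (1 + V) * Matrix.of fun k k' : Fin m => B k k' := by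
    ext k k'
    rw [add_mul, one_mul, Matrix.add_apply, Matrix.of_apply, Matrix.of_apply, Matrix.mul_apply]
    congr 1
    split_ifs with hk
    · rw [Finset.sum_eq_single ⟨k + 1, hq k k.2 hk⟩]
      · simp [V, hk]
      · intro b _ hb
        have : b.val ≠ k.val + 1 := fun h => hb (Fin.ext h)
        simp [V, this]
      · simp
    · simp [V, hk]
  rw [h1, det_mul, det_of_upperTriangular, Finset.prod_eq_one, one_mul]
  · intro i _; simp [V]
  · intro i j hij
    have hij' : j < i := hij
    have : j.val < i.val := hij'
    simp only [V, Matrix.add_apply, Matrix.of_apply]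
    rw [Matrix.one_apply_ne (by rintro rfl; omega), if_neg (by omega), add_zero]
lemma dt_lin (m : ℕ) (B : ℕ → ℕ → R) (q : ℕ → Prop) [DecidablePred q]
    (hq : ∀ k, q k → ¬ q (k + 1)) :
    ∃ d0 d1 : R, ∀ a, dt m (fun k k' => B k k' + if q k then a * B (k + 1) k' else 0) = d0 + a * d1 := by
  classical
  rcases m with _ | m
  · exact ⟨1, 0, fun a => by simp [dt]⟩
  by_cases hm : q m
  · let B₀ : Matrix (Fin (m+1)) (Fin (m+1)) R := Matrix.of fun k k' => B k k'
    refine ⟨det B₀, det (B₀.updateRow (Fin.last m) (fun k' => B (m + 1) k')), fun a => ?_⟩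
    let B2 : ℕ → ℕ → R := fun k k' => B k k' + if k = m then a * B (m + 1) k' else 0
    have h1 := dt_inv (m + 1) B2 (fun k => q k ∧ k + 1 < m + 1) a (fun k _ h => h.2)
    have h2 : dt (m + 1) (fun k k' => B k k' + if q k then a * B (k + 1) k' else 0) =
        dt (m + 1) (fun k k' => B2 k k' + if q k ∧ k + 1 < m + 1 then a * B2 (k + 1) k' else 0) := by
      apply dt_congr
      intro k hk k' _
      by_cases hkm : k = m
      · subst hkm; simp [B2, hm]
      · by_cases hqk : q k
        · have h3 : k + 1 ≠ m := by rintro rfl; exact hq k hqk hm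
          have : k < m := by omega
          simp [B2, hkm, hqk, this, h3]
        · simp [B2, hkm, hqk]
    rw [h2, h1]
    have h3 : (Matrix.of fun k k' : Fin (m+1) => B2 k k') =
        B₀.updateRow (Fin.last m) (B₀ (Fin.last m) + a • (fun k' : Fin (m+1) => B (m + 1) k')) := by
      ext k k'
      by_cases hk : k = Fin.last m
      · subst hk; simp [B2, B₀]
      · have : k.val ≠ m := fun h => hk (Fin.ext h)
        simp [B2, B₀, hk, this]
    rw [dt, h3, det_updateRow_add, det_updateRow_smul, updateRow_eq_self]
  · refine ⟨dt (m + 1) B, 0, fun a => ?_⟩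
    rw [mul_zero, add_zero, dt_inv]
    intro k hk hqk
    rcases Nat.lt_or_ge (k + 1) (m + 1) with h | h
    · exact h
    · have : k = m := by omega
      exact absurd (this ▸ hqk) hm
lemma map_dt {R' : Type} [CommRing R'] (φ : R →+* R') (m : ℕ) (B : ℕ → ℕ → R) :
    φ (dt m B) = dt m (fun k k' => φ (B k k')) := by
  rw [dt, RingHom.map_det]; rfl
end det
section lead
variable {R : Type} [CommRing R] [IsDomain R]
lemma dt_lead (m : ℕ) (B : ℕ → ℕ → Polynomial R) (α β : ℕ → ℕ) (x : ℕ → R)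
    (hB : ∀ k < m, ∀ k' < m, (B k k').natDegree ≤ α k + β k' + 2 * k * k')
    (hx : ∀ k < m, x k ≠ 0)
    (hd : ∀ k < m, B k k = Polynomial.C (x k) * Polynomial.X ^ (α k + β k + 2 * k * k)) :
    (dt m B).leadingCoeff = ∏ k ∈ Finset.range m, x k := by
  classical
  let D : Polynomial R := ∏ k : Fin m, B k k
  have hD : D = Polynomial.C (∏ k ∈ Finset.range m, x k) * Polynomial.X ^ (∑ k : Fin m, (α k + β k + 2 * k * k)) := by
    simp only [D]
    rw [Finset.prod_congr rfl fun (k : Fin m) _ => hd k k.2, Finset.prod_mul_distrib,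
      Finset.prod_pow_eq_pow_sum, ← map_prod, Finset.prod_range]
  have hx0 : ∏ k ∈ Finset.range m, x k ≠ 0 :=
    Finset.prod_ne_zero_iff.mpr fun k hk => hx k (Finset.mem_range.mp hk)
  have hdeg : D.degree = ((∑ k : Fin m, (α k + β k + 2 * k * k) : ℕ) : WithBot ℕ) := by
    rw [hD, Polynomial.degree_C_mul_X_pow _ hx0]
  have hdet : dt m B = D + ∑ π ∈ (Finset.univ : Finset (Equiv.Perm (Fin m))).erase 1,
      Equiv.Perm.sign π • ∏ k : Fin m, B (π k) k := by
    rw [dt, det_apply, ← Finset.add_sum_erase _ _ (Finset.mem_univ (1 : Equiv.Perm (Fin m)))]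
    simp [D]
  have hlt : (∑ π ∈ (Finset.univ : Finset (Equiv.Perm (Fin m))).erase 1,
      Equiv.Perm.sign π • ∏ k : Fin m, B (π k) k).degree < D.degree := by
    rw [hdeg]
    apply lt_of_le_of_lt (Polynomial.degree_sum_le _ _)
    rw [Finset.sup_lt_iff (WithBot.bot_lt_coe _)]
    intro π hπ
    have hπ1 : π ≠ 1 := (Finset.mem_erase.mp hπ).1
    refine lt_of_le_of_lt (b := (((∏ k : Fin m, B (π k) k).natDegree : ℕ) : WithBot ℕ)) ?_ ?_
    · rcases Int.units_eq_one_or (Equiv.Perm.sign π) with h | h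
      · rw [h, one_smul]; exact Polynomial.degree_le_natDegree
      · rw [h, Units.neg_smul, one_smul, Polynomial.degree_neg]; exact Polynomial.degree_le_natDegree
    · rw [Nat.cast_lt]
      refine lt_of_le_of_lt (Polynomial.natDegree_prod_le _ _) ?_
      refine lt_of_le_of_lt (Finset.sum_le_sum fun k _ => hB (π k) (π k).2 k k.2) ?_
      simp only [Finset.sum_add_distrib]
      have e1 : ∑ k : Fin m, α (π k) = ∑ k : Fin m, α k := Equiv.sum_comp π (fun k : Fin m => α k)
      have e2 : ∑ k : Fin m, ((π k : ℕ) : ℤ) ^ 2 = ∑ k : Fin m, ((k : ℕ) : ℤ) ^ 2 :=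
        Equiv.sum_comp π (fun k : Fin m => ((k : ℕ) : ℤ) ^ 2)
      rw [e1]
      apply Nat.add_lt_add_left
      obtain ⟨j, hj⟩ : ∃ j, π j ≠ j := by
        by_contra h
        push Not at h
        exact hπ1 (Equiv.ext h)
      have hj' : ((π j : ℕ) : ℤ) ≠ ((j : ℕ) : ℤ) := by
        intro h; exact hj (Fin.ext (by exact_mod_cast h))
      have pos : 0 < ∑ k : Fin m, (((π k : ℕ) : ℤ) - ((k : ℕ) : ℤ)) ^ 2 := by
        apply Finset.sum_pos' (fun k _ => sq_nonneg _)
        exact ⟨j, Finset.mem_univ _, by have := sub_ne_zero.mpr hj'; positivity⟩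
      have e3 : ∑ k : Fin m, (((π k : ℕ) : ℤ) - ((k : ℕ) : ℤ)) ^ 2 =
          ∑ k : Fin m, ((π k : ℕ) : ℤ) ^ 2 + ∑ k : Fin m, ((k : ℕ) : ℤ) ^ 2 -
            ∑ k : Fin m, 2 * ((π k : ℕ) : ℤ) * ((k : ℕ) : ℤ) := by
        rw [← Finset.sum_add_distrib, ← Finset.sum_sub_distrib]
        exact Finset.sum_congr rfl fun k _ => by ring
      have e4 : ∑ k : Fin m, 2 * ((k : ℕ) : ℤ) * ((k : ℕ) : ℤ) = ∑ k : Fin m, ((k : ℕ) : ℤ) ^ 2 +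
          ∑ k : Fin m, ((k : ℕ) : ℤ) ^ 2 := by
        rw [← Finset.sum_add_distrib]
        exact Finset.sum_congr rfl fun k _ => by ring
      zify
      rw [e4]
      rw [e3, e2] at pos
      linarith
  rw [hdet, Polynomial.leadingCoeff_add_of_degree_lt' hlt, hD, Polynomial.leadingCoeff_mul, Polynomial.leadingCoeff_C, Polynomial.leadingCoeff_X_pow,
    mul_one]
end lead
section defs
variable {R : Type} [CommRing R]
def EE (n : ℕ) (x : ℕ → ℕ → ℕ → R) (r c : ℕ) : R :=
  if r / n = c / n ∨ r / n = c / n + 1 then x (r / n + c / n) (r % n) (c % n) else 0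
noncomputable def AA (n N : ℕ) (x : ℕ → ℕ → ℕ → R) (i : ℕ) : R :=
  dt (N * n - i) (fun k k' => EE n x (i + k) k')
def swp (x : ℕ → ℕ → ℕ → R) : ℕ → ℕ → ℕ → R := fun l a b => x l b a
noncomputable def TT (n M N : ℕ) (x : ℕ → ℕ → ℕ → R) : R :=
  (∏ l ∈ Finset.range M, dt n (x l)) *
    ∏ j ∈ Finset.range (n - 1), (AA n N x (j + 1) * AA n N (swp x) (j + 1))
lemma map_AA {R' : Type} [CommRing R'] (φ : R →+* R') (n N : ℕ) (x : ℕ → ℕ → ℕ → R) (i : ℕ) :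
    φ (AA n N x i) = AA n N (fun l a b => φ (x l a b)) i := by
  rw [AA, map_dt, AA]; congr 1; funext k k'; unfold EE; split_ifs <;> simp
lemma map_TT {R' : Type} [CommRing R'] (φ : R →+* R') (n M N : ℕ) (x : ℕ → ℕ → ℕ → R) :
    φ (TT n M N x) = TT n M N (fun l a b => φ (x l a b)) := by
  rw [TT, TT, map_mul, map_prod, map_prod]
  congr 1
  · exact Finset.prod_congr rfl fun l _ => map_dt φ n (x l)
  · refine Finset.prod_congr rfl fun j _ => ?_
    rw [map_mul, map_AA, map_AA]; rfl
lemma TT_swp (n M N : ℕ) (x : ℕ → ℕ → ℕ → R) : TT n M N (swp x) = TT n M N x := by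
  rw [TT, TT]
  congr 1
  · exact Finset.prod_congr rfl fun l _ => (dt_transpose n (x l)).symm
  · refine Finset.prod_congr rfl fun j _ => ?_
    rw [mul_comm]; rfl
def rop (k : ℕ) (c : R) (x : ℕ → ℕ → ℕ → R) : ℕ → ℕ → ℕ → R :=
  fun l a b => x l a b + if a = k then c * x l (k + 1) b else 0
lemma div_succ {n r k : ℕ} (hk : k + 1 < n) (h : r % n = k) :
    (r + 1) / n = r / n ∧ (r + 1) % n = k + 1 := by
  have h0 := Nat.div_add_mod r n
  have : r + 1 = n * (r / n) + (k + 1) := by omega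
  constructor
  · rw [this, Nat.mul_add_div (by omega), Nat.div_eq_of_lt hk, add_zero]
  · rw [this, Nat.mul_add_mod, Nat.mod_eq_of_lt hk]
lemma AA_rop (n N k i : ℕ) (hk : k + 1 < n) (c : R) (x : ℕ → ℕ → ℕ → R) :
    AA n N (rop k c x) i = AA n N x i := by
  unfold AA
  rw [← dt_inv (N * n - i) (fun s t => EE n x (i + s) t) (fun s => (i + s) % n = k) c]
  · congr 1; funext s t
    by_cases h : (i + s) % n = k
    · obtain ⟨h1, h2⟩ := div_succ hk h
      simp only [EE, rop, ← add_assoc, h1, h2, h, if_true]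
      split_ifs <;> simp
    · simp only [EE, rop, h, if_false]
      split_ifs <;> simp
  · intro s hs h
    by_contra hc
    have h3 : i + s + 1 = N * n := by omega
    have h4 := (div_succ hk h).2
    rw [h3, Nat.mul_mod_left] at h4
    omega
lemma AA_swp_aux (n N k i : ℕ) (hk : k + 1 < n) (c : R) (x : ℕ → ℕ → ℕ → R) :
    AA n N (swp (rop k c x)) i = dt (N * n - i) (fun s t => EE n (swp x) (i + t) s +
      if s % n = k then c * EE n (swp x) (i + t) (s + 1) else 0) := by
  rw [AA, dt_transpose]
  congr 1; funext s t
  by_cases h : s % n = k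
  · obtain ⟨h1, h2⟩ := div_succ hk h
    simp only [EE, rop, swp, h1, h2, h, if_true]
    split_ifs <;> simp
  · simp only [EE, rop, swp, h, if_false]
    split_ifs <;> simp
lemma AA_swp_inv (n N k i : ℕ) (hk : k + 1 < n) (hi : i < n) (hi' : i + k + 1 ≠ n) (c : R)
    (x : ℕ → ℕ → ℕ → R) :
    AA n N (swp (rop k c x)) i = AA n N (swp x) i := by
  rw [AA_swp_aux n N k i hk, AA, dt_transpose _ (fun k k' => EE n (swp x) (i + k) k')]
  apply dt_inv (N * n - i) (fun s t => EE n (swp x) (i + t) s) (fun s => s % n = k) c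
  intro s hs h
  by_contra hc
  have h3 : s + 1 + i = N * n := by omega
  have h4 := Nat.div_add_mod s n
  rw [h] at h4
  have h5 : n * (s / n) + (k + 1 + i) = N * n := by omega
  have h6 : (k + 1 + i) % n = 0 := by
    have := congrArg (· % n) h5
    simpa [Nat.mul_add_mod] using this
  obtain ⟨z, hz⟩ := Nat.dvd_of_mod_eq_zero h6
  have : z < 2 := by
    by_contra hz2
    have : n * 2 ≤ n * z := Nat.mul_le_mul_left n (by omega)
    omega
  interval_cases z <;> omega
lemma AA_swp_lin (n N k i : ℕ) (hk : k + 1 < n) (x : ℕ → ℕ → ℕ → R) :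
    ∃ d0 d1 : R, ∀ c, AA n N (swp (rop k c x)) i = d0 + c * d1 := by
  obtain ⟨d0, d1, h⟩ := dt_lin (N * n - i) (fun s t => EE n (swp x) (i + t) s) (fun s => s % n = k)
    (by intro s hs hs'; rw [(div_succ hk hs).2] at hs'; omega)
  exact ⟨d0, d1, fun c => by rw [AA_swp_aux n N k i hk]; exact h c⟩
lemma TT_rop (n M N k : ℕ) (hk : k + 1 < n) (x : ℕ → ℕ → ℕ → R) :
    ∃ t0 t1 : R, ∀ c, TT n M N (rop k c x) = t0 + c * t1 := by
  obtain ⟨d0, d1, h⟩ := AA_swp_lin n N k (n - 1 - k) hk x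
  let j0 := n - 2 - k
  have hj0 : j0 ∈ Finset.range (n - 1) := by simp [j0]; omega
  have e1 : ∀ c l, dt n (rop k c x l) = dt n (x l) := by
    intro c l
    rw [← dt_inv n (x l) (fun s => s = k) c (by intro s _ h; omega)]
    · congr 1; funext a b; simp only [rop]; split_ifs with h
      · rw [h]
      · rfl
  have key : ∀ c, TT n M N (rop k c x) = ((∏ l ∈ Finset.range M, dt n (x l)) *
    ∏ j ∈ Finset.range (n - 1), AA n N x (j + 1)) *
     ((∏ j ∈ (Finset.range (n - 1)).erase j0, AA n N (swp x) (j + 1)) * (d0 + c * d1)) := by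
    intro c
    rw [TT, Finset.prod_mul_distrib, mul_assoc, ← h c]
    congr 1
    · exact Finset.prod_congr rfl fun l _ => e1 c l
    congr 1
    · exact Finset.prod_congr rfl fun l _ => AA_rop n N k _ hk c x
    · rw [← Finset.prod_erase_mul _ _ hj0]
      congr 1
      · refine Finset.prod_congr rfl fun j hj => AA_swp_inv n N k _ hk ?_ ?_ c x
        · have := Finset.mem_range.mp (Finset.mem_of_mem_erase hj); omega
        · have := Finset.ne_of_mem_erase hj
          have := Finset.mem_range.mp (Finset.mem_of_mem_erase hj)
          simp only [j0] at *; omega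
      · congr 1; simp only [j0]; omega
  generalize (∏ l ∈ Finset.range M, dt n (x l)) * ∏ j ∈ Finset.range (n - 1), AA n N x (j + 1) = u at key
  generalize (∏ j ∈ (Finset.range (n - 1)).erase j0, AA n N (swp x) (j + 1)) = u' at key
  exact ⟨u * (u' * d0), u * (u' * d1), fun c => (key c).trans (by ring)⟩
lemma dt_scale (m : ℕ) (B : ℕ → ℕ → R) (r s : ℕ → R) :
    dt m (fun k k' => r k * s k' * B k k') = (∏ k ∈ Finset.range m, r k) * (∏ k ∈ Finset.range m, s k) * dt m B := by
  rw [dt, Finset.prod_range, Finset.prod_range, ← det_diagonal, ← det_diagonal, dt, mul_right_comm, ← det_mul, ← det_mul]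
  congr 1; ext i j; simp [Matrix.mul_apply, Matrix.diagonal_apply]; ring
lemma TT_scale (n M N : ℕ) (w : ℕ → ℕ) : ∃ D : ℕ, ∀ (c : R) (x : ℕ → ℕ → ℕ → R),
    TT n M N (fun l a b => x l a b * c ^ w a) = TT n M N x * c ^ D := by
  have h1 : ∀ l, ∃ D : ℕ, ∀ (c : R) (x : ℕ → ℕ → ℕ → R),
      dt n (fun a b => x l a b * c ^ w a) = dt n (x l) * c ^ D := by
    intro l
    refine ⟨∑ k ∈ Finset.range n, w k, fun c x => ?_⟩
    have := dt_scale n (x l) (fun a => c ^ w a) (fun _ => 1)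
    simp only [mul_one, Finset.prod_const_one, Finset.prod_pow_eq_pow_sum] at this
    rw [mul_comm, ← this]; congr 1; funext a b; ring
  have h2 : ∀ i, ∃ D : ℕ, ∀ (c : R) (x : ℕ → ℕ → ℕ → R),
      AA n N (fun l a b => x l a b * c ^ w a) i = AA n N x i * c ^ D := by
    intro i
    refine ⟨∑ k ∈ Finset.range (N * n - i), w ((i + k) % n), fun c x => ?_⟩
    have := dt_scale (N * n - i) (fun k k' => EE n x (i + k) k') (fun k => c ^ w ((i + k) % n)) (fun _ => 1)
    simp only [mul_one, Finset.prod_const_one, Finset.prod_pow_eq_pow_sum] at this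
    rw [AA, AA, mul_comm _ (c ^ _), ← this]; congr 1; funext a b; simp only [EE]; split_ifs <;> ring
  have h3 : ∀ i, ∃ D : ℕ, ∀ (c : R) (x : ℕ → ℕ → ℕ → R),
      AA n N (swp (fun l a b => x l a b * c ^ w a)) i = AA n N (swp x) i * c ^ D := by
    intro i
    refine ⟨∑ k ∈ Finset.range (N * n - i), w (k % n), fun c x => ?_⟩
    have := dt_scale (N * n - i) (fun k k' => EE n (swp x) (i + k) k') (fun _ => 1) (fun k => c ^ w (k % n))
    simp only [one_mul, Finset.prod_const_one, Finset.prod_pow_eq_pow_sum] at this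
    rw [AA, AA, mul_comm _ (c ^ _), ← this]; congr 1; funext a b; simp only [EE, swp]; split_ifs <;> ring
  choose D1 hD1 using h1
  choose D2 hD2 using h2
  choose D3 hD3 using h3
  refine ⟨∑ l ∈ Finset.range M, D1 l + ∑ j ∈ Finset.range (n - 1), (D2 (j + 1) + D3 (j + 1)), fun c x => ?_⟩
  rw [TT, Finset.prod_congr rfl fun l _ => hD1 l c x,
    Finset.prod_congr rfl fun j _ => congrArg₂ (· * ·) (hD2 (j + 1) c x) (hD3 (j + 1) c x), TT]
  simp only [Finset.prod_mul_distrib, Finset.prod_pow_eq_pow_sum, pow_add, Finset.sum_add_distrib]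
  ring
end defs
def om (n l a b : ℕ) : ℕ := n ^ 2 * l ^ 2 + 2 * n * l * (a + b) + 2 * a * b
section
variable {R : Type} [CommRing R] [IsDomain R]
lemma om_eq (n i k k' : ℕ) (α β : ℕ → ℕ) (hα : ∀ k, α k + ((i + k) % n) ^ 2 = (i + k) ^ 2)
    (hβ : ∀ k, β k + (k % n) ^ 2 = k ^ 2 + 2 * i * k) :
    om n ((i + k) / n + k' / n) ((i + k) % n) (k' % n) = α k + β k' + 2 * k * k' := by
  have h1 := hα k
  have h2 := hβ k'
  have h3 := Nat.div_add_mod (i + k) n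
  have h4 := Nat.div_add_mod k' n
  unfold om
  generalize (i + k) / n = v at *
  generalize k' / n = w at *
  generalize (i + k) % n = a at *
  generalize k' % n = b at *
  zify at *
  have h5 : (α k : ℤ) = (i + k) ^ 2 - a ^ 2 := by linarith
  have h6 : (β k' : ℤ) = k' ^ 2 + 2 * i * k' - b ^ 2 := by linarith
  rw [h5, h6, ← h4]
  have h7 : (k : ℤ) = n * v + a - i := by linarith
  rw [h7]; ring
lemma AA_lead (n M N : ℕ) (hn : 0 < n) (hM : M + 1 = 2 * N) (y : ℕ → ℕ → ℕ → R)
    (hy : ∀ l < M, ∀ a < n, ∀ b < n, y l a b ≠ 0) (i : ℕ) (hi : i < n) :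
    (AA n N (fun l a b => Polynomial.C (y l a b) * Polynomial.X ^ om n l a b) i).leadingCoeff =
      ∏ c ∈ Finset.range (N * n - i), y ((i + c) / n + c / n) ((i + c) % n) (c % n) := by
  have hα : ∀ k, ((i + k) ^ 2 - ((i + k) % n) ^ 2) + ((i + k) % n) ^ 2 = (i + k) ^ 2 := by
    intro k; apply Nat.sub_add_cancel; gcongr; exact Nat.mod_le _ _
  have hβ : ∀ k, (k ^ 2 + 2 * i * k - (k % n) ^ 2) + (k % n) ^ 2 = k ^ 2 + 2 * i * k := by
    intro k; apply Nat.sub_add_cancel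
    have : (k % n) ^ 2 ≤ k ^ 2 := by gcongr; exact Nat.mod_le _ _
    omega
  have hdiv : ∀ k, (i + k) / n = k / n ∨ (i + k) / n = k / n + 1 := by
    intro k
    have h1 : k / n ≤ (i + k) / n := Nat.div_le_div_right (by omega)
    have h2 : (i + k) / n ≤ (k + n) / n := Nat.div_le_div_right (by omega)
    rw [Nat.add_div_right _ hn] at h2
    omega
  apply dt_lead (N * n - i) _ (fun k => (i + k) ^ 2 - ((i + k) % n) ^ 2)
    (fun k => k ^ 2 + 2 * i * k - (k % n) ^ 2) (fun c => y ((i + c) / n + c / n) ((i + c) % n) (c % n))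
  · intro k hk k' hk'
    rw [EE]
    split_ifs
    · refine (Polynomial.natDegree_C_mul_X_pow_le _ _).trans ?_
      rw [om_eq n i k k' _ _ hα hβ]
    · simp
  · intro k hk
    apply hy
    · have h1 : (i + k) / n < N := by
        rw [Nat.div_lt_iff_lt_mul hn]; omega
      have h2 : k / n < N := by
        rw [Nat.div_lt_iff_lt_mul hn]; omega
      omega
    · exact Nat.mod_lt _ hn
    · exact Nat.mod_lt _ hn
  · intro k hk
    rw [EE, if_pos (hdiv k), om_eq n i k k _ _ hα hβ]
lemma det_lead (n M : ℕ) (y : ℕ → ℕ → ℕ → R)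
    (hy : ∀ l < M, ∀ a < n, ∀ b < n, y l a b ≠ 0) (l : ℕ) (hl : l < M) :
    (dt n (fun a b => Polynomial.C (y l a b) * Polynomial.X ^ om n l a b)).leadingCoeff =
      ∏ c ∈ Finset.range n, y l c c := by
  apply dt_lead n _ (fun a => n ^ 2 * l ^ 2 + 2 * n * l * a) (fun b => 2 * n * l * b) (fun c => y l c c)
  · intro k hk k' hk'
    refine (Polynomial.natDegree_C_mul_X_pow_le _ _).trans ?_
    unfold om; apply le_of_eq; ring
  · intro k hk; exact hy l hl k hk k hk
  · intro k hk; simp only [om]; congr 2; ring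
lemma prod_diag (n M N : ℕ) (hn : 0 < n) (hM : M + 1 = 2 * N) (y : ℕ → ℕ → ℕ → R) :
    ∏ j ∈ Finset.range (n - 1), ∏ c ∈ Finset.range (N * n - (j + 1)),
      y ((j + 1 + c) / n + c / n) ((j + 1 + c) % n) (c % n) =
    ∏ v ∈ (Finset.range M ×ˢ Finset.range n ×ˢ Finset.range n).filter (fun v =>
      (v.1 % 2 = 0 ∧ v.2.2 < v.2.1) ∨ (v.1 % 2 = 1 ∧ v.2.1 < v.2.2)), y v.1 v.2.1 v.2.2 := by
  rw [Finset.prod_sigma']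
  refine Finset.prod_nbij' (fun p => ((p.1 + 1 + p.2) / n + p.2 / n, (p.1 + 1 + p.2) % n, p.2 % n))
    (fun v => ⟨(if v.1 % 2 = 0 then v.2.1 - v.2.2 else n + v.2.1 - v.2.2) - 1, (v.1 / 2) * n + v.2.2⟩)
    ?_ ?_ ?_ ?_ ?_
  · rintro ⟨j, c⟩ hp
    simp only [Finset.mem_sigma, Finset.mem_range] at hp
    obtain ⟨hj, hc⟩ := hp
    have hb := Nat.mod_lt c hn
    have ha := Nat.mod_lt (j + 1 + c) hn
    have h3 := Nat.div_add_mod (j + 1 + c) n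
    have h4 := Nat.div_add_mod c n
    have h1 : (j + 1 + c) / n < N := by rw [Nat.div_lt_iff_lt_mul hn]; omega
    have h1' : c / n ≤ (j + 1 + c) / n := Nat.div_le_div_right (by omega)
    have h2 : (j + 1 + c) / n ≤ (c + n) / n := Nat.div_le_div_right (by omega)
    rw [Nat.add_div_right _ hn] at h2
    simp only [Finset.mem_filter, Finset.mem_product, Finset.mem_range]
    have h5 : (j + 1 + c) / n = c / n ∨ (j + 1 + c) / n = c / n + 1 := by omega
    rcases h5 with h5 | h5 <;> rw [h5] at h1 h3 ⊢
    · refine ⟨⟨by omega, ha, hb⟩, Or.inl ⟨by omega, by omega⟩⟩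
    · rw [mul_add] at h3
      refine ⟨⟨by omega, ha, hb⟩, Or.inr ⟨by omega, by omega⟩⟩
  · rintro ⟨l, a, b⟩ hv
    simp only [Finset.mem_filter, Finset.mem_product, Finset.mem_range, Finset.mem_sigma] at hv ⊢
    obtain ⟨⟨hl, ha, hb⟩, hv⟩ := hv
    have e1 : l / 2 + 1 ≤ N := by omega
    have e2 : (l / 2 + 1) * n ≤ N * n := Nat.mul_le_mul_right n e1
    rw [Nat.add_mul, one_mul] at e2
    rcases hv with ⟨h1, h2⟩ | ⟨h1, h2⟩
    · rw [if_pos h1]; omega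
    · rw [if_neg (by omega)]
      have e1 : l / 2 + 2 ≤ N := by omega
      have e2 : (l / 2 + 2) * n ≤ N * n := Nat.mul_le_mul_right n e1
      rw [Nat.add_mul] at e2
      omega
  · rintro ⟨j, c⟩ hp
    simp only [Finset.mem_sigma, Finset.mem_range] at hp
    obtain ⟨hj, hc⟩ := hp
    have hb := Nat.mod_lt c hn
    have ha := Nat.mod_lt (j + 1 + c) hn
    have h3 := Nat.div_add_mod (j + 1 + c) n
    have h4 := Nat.div_add_mod c n
    have h1' : c / n ≤ (j + 1 + c) / n := Nat.div_le_div_right (by omega)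
    have h2 : (j + 1 + c) / n ≤ (c + n) / n := Nat.div_le_div_right (by omega)
    rw [Nat.add_div_right _ hn] at h2
    have h5 : (j + 1 + c) / n = c / n ∨ (j + 1 + c) / n = c / n + 1 := by omega
    have h6 : ((j + 1 + c) / n + c / n) / 2 = c / n := by omega
    simp only [h6]
    have h7 : c / n * n + c % n = c := by rw [mul_comm]; exact h4
    rw [h7]
    congr 1
    rcases h5 with h5 | h5 <;> rw [h5] at h3 ⊢
    · rw [if_pos (by omega)]; omega
    · rw [if_neg (by omega)]; rw [mul_add] at h3; omega
  · rintro ⟨l, a, b⟩ hv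
    simp only [Finset.mem_filter, Finset.mem_product, Finset.mem_range, Finset.mem_sigma] at hv ⊢
    obtain ⟨⟨hl, ha, hb⟩, hv⟩ := hv
    have d1 : (l / 2 * n + b) / n = l / 2 := by
      rw [mul_comm, Nat.mul_add_div hn, Nat.div_eq_of_lt hb, add_zero]
    have d2 : (l / 2 * n + b) % n = b := by
      rw [mul_comm, Nat.mul_add_mod, Nat.mod_eq_of_lt hb]
    rw [d1, d2]
    rcases hv with ⟨h1, h2⟩ | ⟨h1, h2⟩
    · rw [if_pos h1]
      have : a - b - 1 + 1 + (l / 2 * n + b) = n * (l / 2) + a := by rw [mul_comm n]; omega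
      rw [this, Nat.mul_add_div hn, Nat.mul_add_mod, Nat.div_eq_of_lt ha, Nat.mod_eq_of_lt ha]
      congr 1; omega
    · rw [if_neg (by omega)]
      have : n + a - b - 1 + 1 + (l / 2 * n + b) = n * (l / 2 + 1) + a := by
        rw [mul_add, mul_comm n]; omega
      rw [this, Nat.mul_add_div hn, Nat.mul_add_mod, Nat.div_eq_of_lt ha, Nat.mod_eq_of_lt ha]
      congr 1; omega
  · rintro ⟨j, c⟩ hp; rfl
lemma TT_lead (n M N : ℕ) (hn : 0 < n) (hM : M + 1 = 2 * N) (y : ℕ → ℕ → ℕ → R)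
    (hy : ∀ l < M, ∀ a < n, ∀ b < n, y l a b ≠ 0) :
    (TT n M N (fun l a b => Polynomial.C (y l a b) * Polynomial.X ^ om n l a b)).leadingCoeff =
      ∏ v ∈ (Finset.range M ×ˢ Finset.range n ×ˢ Finset.range n), y v.1 v.2.1 v.2.2 := by
  classical
  have hs : swp (fun l a b => Polynomial.C (y l a b) * Polynomial.X ^ om n l a b) =
      fun l a b => Polynomial.C (swp y l a b) * Polynomial.X ^ om n l a b := by
    funext l a b; simp only [swp, om]; congr 2; ring
  rw [TT, Polynomial.leadingCoeff_mul, Polynomial.leadingCoeff_prod, Polynomial.leadingCoeff_prod, hs]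
  rw [Finset.prod_congr rfl fun l hl => det_lead n M y hy l (Finset.mem_range.mp hl)]
  have h1 : ∀ j ∈ Finset.range (n - 1),
      (AA n N (fun l a b => Polynomial.C (y l a b) * Polynomial.X ^ om n l a b) (j + 1) *
      AA n N (fun l a b => Polynomial.C (swp y l a b) * Polynomial.X ^ om n l a b) (j + 1)).leadingCoeff =
      (∏ c ∈ Finset.range (N * n - (j + 1)), y ((j + 1 + c) / n + c / n) ((j + 1 + c) % n) (c % n)) *
      (∏ c ∈ Finset.range (N * n - (j + 1)), swp y ((j + 1 + c) / n + c / n) ((j + 1 + c) % n) (c % n)) := by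
    intro j hj
    have := Finset.mem_range.mp hj
    rw [Polynomial.leadingCoeff_mul, AA_lead n M N hn hM y hy _ (by omega),
      AA_lead n M N hn hM (swp y) (fun l hl a ha b hb => hy l hl b hb a ha) _ (by omega)]
  rw [Finset.prod_congr rfl h1, Finset.prod_mul_distrib, prod_diag n M N hn hM, prod_diag n M N hn hM]
  have h2 : ∏ v ∈ (Finset.range M ×ˢ Finset.range n ×ˢ Finset.range n).filter (fun v =>
      (v.1 % 2 = 0 ∧ v.2.2 < v.2.1) ∨ (v.1 % 2 = 1 ∧ v.2.1 < v.2.2)), swp y v.1 v.2.1 v.2.2 =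
      ∏ v ∈ (Finset.range M ×ˢ Finset.range n ×ˢ Finset.range n).filter (fun v =>
      (v.1 % 2 = 0 ∧ v.2.1 < v.2.2) ∨ (v.1 % 2 = 1 ∧ v.2.2 < v.2.1)), y v.1 v.2.1 v.2.2 := by
    refine Finset.prod_nbij' (fun v => (v.1, v.2.2, v.2.1)) (fun v => (v.1, v.2.2, v.2.1)) ?_ ?_ ?_ ?_ ?_
    · rintro ⟨l, a, b⟩ h; simp only [Finset.mem_filter, Finset.mem_product, Finset.mem_range] at h ⊢; tauto
    · rintro ⟨l, a, b⟩ h; simp only [Finset.mem_filter, Finset.mem_product, Finset.mem_range] at h ⊢; tauto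
    · rintro ⟨l, a, b⟩ h; rfl
    · rintro ⟨l, a, b⟩ h; rfl
    · rintro ⟨l, a, b⟩ h; rfl
  have h3 : ∏ l ∈ Finset.range M, ∏ c ∈ Finset.range n, y l c c =
      ∏ v ∈ (Finset.range M ×ˢ Finset.range n ×ˢ Finset.range n).filter (fun v => v.2.1 = v.2.2),
        y v.1 v.2.1 v.2.2 := by
    rw [← Finset.prod_product']
    refine Finset.prod_nbij' (fun v => (v.1, v.2, v.2)) (fun v => (v.1, v.2.1)) ?_ ?_ ?_ ?_ ?_
    · rintro ⟨l, a⟩ h; simp only [Finset.mem_filter, Finset.mem_product, Finset.mem_range] at h ⊢; tauto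
    · rintro ⟨l, a, b⟩ h; simp only [Finset.mem_filter, Finset.mem_product, Finset.mem_range] at h ⊢; tauto
    · rintro ⟨l, a⟩ h; rfl
    · rintro ⟨l, a, b⟩ h
      simp only [Finset.mem_filter] at h
      simp [h.2]
    · rintro ⟨l, a⟩ h; rfl
  rw [h2, h3, ← Finset.prod_union, ← Finset.prod_union]
  · apply Finset.prod_congr _ (fun _ _ => rfl)
    ext ⟨l, a, b⟩
    simp only [Finset.mem_union, Finset.mem_filter, ← and_or_left]
    refine and_iff_left ?_
    omega
  · rw [Finset.disjoint_left]
    rintro ⟨l, a, b⟩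
    simp only [Finset.mem_union, Finset.mem_filter]
    omega
  · rw [Finset.disjoint_left]
    rintro ⟨l, a, b⟩
    simp only [Finset.mem_filter]
    omega
end
section
variable (K : Type) [Field K] (M n N : ℕ)
noncomputable def xg : ℕ → ℕ → ℕ → MvPolynomial (Sig M n) K := fun l a b =>
  if h : l < M ∧ a < n ∧ b < n then X (⟨l, h.1⟩, ⟨a, h.2.1⟩, ⟨b, h.2.2⟩) else 0
noncomputable def tt : MvPolynomial (Sig M n) K := TT n M N (xg K M n)
variable {K M n N}
def roww (i : Fin n) : Sig M n → ℕ := fun p => if p.2.1 = i then 1 else 0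
lemma tt_row0 (i : Fin n) : ∃ D, (tt K M n N).IsWeightedHomogeneous (roww i) D := by
  obtain ⟨D, hD⟩ := TT_scale (R := Polynomial (MvPolynomial (Sig M n) K)) n M N
    (fun a => if a = i.val then 1 else 0)
  refine ⟨D, ?_⟩
  apply isWeighted_of_scale
  rw [tt]
  have h1 := map_TT (aeval (fun v : Sig M n => Polynomial.C (MvPolynomial.X v) * Polynomial.X ^ (roww i v)) :
      MvPolynomial (Sig M n) K →ₐ[K] Polynomial (MvPolynomial (Sig M n) K)).toRingHom n M N (xg K M n)
  have h2 := map_TT (Polynomial.C : MvPolynomial (Sig M n) K →+* _) n M N (xg K M n)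
  rw [h2, ← hD]
  refine h1.trans ?_
  congr 1
  funext l a b
  simp only [xg]
  split_ifs with h
  · simp [roww, Fin.ext_iff, *]
  · simp [roww, Fin.ext_iff, *]
  · simp
  · simp
lemma tt_coeff (hn : 0 < n) (hM : M + 1 = 2 * N) (k : ℕ) :
    coeff (Finsupp.equivFunOnFinite.symm fun _ => k) (tt K M n N ^ k) = 1 := by
  classical
  let w : Sig M n → ℕ := fun v => om n v.1 v.2.1 v.2.2
  let φ : MvPolynomial (Sig M n) K →ₐ[K] Polynomial (MvPolynomial (Sig M n) K) :=
    aeval (fun v : Sig M n => Polynomial.C (MvPolynomial.X v) * Polynomial.X ^ (w v))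
  have h1 : φ (tt K M n N) = TT n M N (fun l a b => Polynomial.C (xg K M n l a b) * Polynomial.X ^ om n l a b) := by
    refine (map_TT φ.toRingHom n M N (xg K M n)).trans ?_
    congr 1; funext l a b
    simp only [xg]
    split_ifs with h
    · simp [φ, w]
    · simp
  have h2 : (φ (tt K M n N)).leadingCoeff = ∏ v : Sig M n, X v := by
    rw [h1, TT_lead n M N hn hM]
    · symm
      refine Finset.prod_bij' (i := fun v _ => (v.1.val, v.2.1.val, v.2.2.val))
        (j := fun v hv => (⟨v.1, Finset.mem_range.mp (Finset.mem_product.mp hv).1⟩,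
          ⟨v.2.1, Finset.mem_range.mp (Finset.mem_product.mp (Finset.mem_product.mp hv).2).1⟩,
          ⟨v.2.2, Finset.mem_range.mp (Finset.mem_product.mp (Finset.mem_product.mp hv).2).2⟩))
        ?_ ?_ ?_ ?_ ?_
      · intro v _; simp
      · intro v _; simp
      · intro v _; rfl
      · intro v _; rfl
      · rintro ⟨l, a, b⟩ _; simp [xg]
    · intro l hl a ha b hb
      rw [xg, dif_pos ⟨hl, ha, hb⟩]; exact X_ne_zero _
  have h3 : (φ (tt K M n N ^ k)).leadingCoeff = monomial (Finsupp.equivFunOnFinite.symm fun _ => k) 1 := by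
    rw [map_pow, Polynomial.leadingCoeff_pow, h2, ← Finset.prod_pow, monomial_eq, map_one, one_mul,
      Finsupp.prod_fintype _ _ (by simp)]
    rfl
  rw [Polynomial.leadingCoeff, coeff_scale] at h3
  have h4 := congrArg (coeff (Finsupp.equivFunOnFinite.symm fun _ => k)) h3
  rw [coeff_weightedHomogeneousComponent, coeff_monomial, if_pos rfl] at h4
  split_ifs at h4 with h
  · exact h4
  · simp at h4
lemma tt_row (hn : 0 < n) (hM : M + 1 = 2 * N) (i : Fin n) :
    (tt K M n N).IsWeightedHomogeneous (roww i) (∑ v : Sig M n, roww i v) := by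
  obtain ⟨D, hD⟩ := tt_row0 (K := K) (M := M) (N := N) i
  have h1 := tt_coeff (K := K) hn hM 1
  rw [pow_one] at h1
  have h2 := hD (by rw [h1]; exact one_ne_zero)
  rw [Finsupp.weight_apply, Finsupp.sum_fintype _ _ (by simp)] at h2
  simp at h2
  rw [h2]; exact hD
def TS (M : ℕ) (i : Fin n) : Finset (Sig M n) := Finset.univ.filter fun v => v.2.1 = i
def TW (M : ℕ) (j : Fin n) : Sig M n → Sig M n := fun v => (v.1, j, v.2.2)
lemma TSTW (i j : Fin n) (h : i.val + 1 = j.val) : ∀ v ∈ TS M i, TW M j v ∉ TS M i := by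
  intro v _
  simp only [TS, TW, Finset.mem_filter, Finset.mem_univ, true_and]
  rintro rfl; omega
lemma tt_ush (i j : Fin n) (hij : i.val + 1 = j.val) : ∃ t0 t1, ∀ a,
    ush (TS M i) (TW M j) a (tt K M n N) = t0 + C a * t1 := by
  obtain ⟨t0, t1, h⟩ := TT_rop n M N i.val (by omega) (xg K M n)
  refine ⟨t0, t1, fun a => ?_⟩
  rw [← h]
  refine (map_TT (ush (TS M i) (TW M j) a).toRingHom n M N (xg K M n)).trans ?_
  congr 1; funext l s t
  simp only [xg, rop]
  by_cases h1 : l < M ∧ s < n ∧ t < n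
  · rw [dif_pos h1]
    by_cases h2 : s = i.val
    · subst h2
      have hj : i.val + 1 < n := by omega
      have : (⟨i.val + 1, hj⟩ : Fin n) = j := Fin.ext hij
      simp [ush, TS, TW, h1, hj, this]
    · have : (⟨s, h1.2.1⟩ : Fin n) ≠ i := fun h => h2 (by rw [← h])
      simp [ush, TS, h2, this]
  · rw [dif_neg h1]
    split_ifs with h2 h3
    · omega
    · simp
    · simp
lemma ev_trans (i j : Fin n) (hij : i.val + 1 = j.val) (a : K) (f : MvPolynomial (Sig M n) K)
    {L : Type} [CommRing L] [Algebra K L] (Y : Fin M → Matrix (Fin n) (Fin n) L) :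
    ev (fun l => transvection i j (algebraMap K L a) * Y l) f = ev Y (ush (TS M i) (TW M j) a f) := by
  have : ev (K := K) (fun l => transvection i j (algebraMap K L a) * Y l) = (ev Y).comp (ush (TS M i) (TW M j) a) := by
    apply MvPolynomial.algHom_ext
    rintro ⟨l, s, t⟩
    rw [ev_X]
    simp only [AlgHom.comp_apply]
    by_cases h : s = i
    · subst h
      simp [ush, TS, TW, ev]
    · simp [ush, TS, ev, h]
  rw [this]; rfl
lemma SI_ush [Infinite K] {e : ℕ} {f : MvPolynomial (Sig M n) K} (hf : f ∈ SI K M n e)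
    (i j : Fin n) (hij : i.val + 1 = j.val) (a : K) : ush (TS M i) (TW M j) a f = f := by
  have h1 := ev_trans i j hij a f (gm K M n)
  rw [ev_gm] at h1
  have h2 := SI_ext hf (transvection i j (algebraMap K (MvPolynomial (Sig M n) K) a)) 1 (gm K M n)
  rw [ev_gm, det_transvection_of_ne _ _ (by rintro rfl; omega)] at h2
  simp only [mul_one, det_one, one_pow, one_mul] at h2
  rw [← h1, h2]
lemma ev_C_gm (f : MvPolynomial (Sig M n) K) :
    ev (fun l => (gm K M n l).map (Polynomial.C : _ →+* Polynomial (MvPolynomial (Sig M n) K))) f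
      = Polynomial.C f := by
  have := map_ev (Algebra.ofId (MvPolynomial (Sig M n) K) (Polynomial (MvPolynomial (Sig M n) K))
      |>.restrictScalars K) (gm K M n) f
  rw [ev_gm] at this
  exact this.symm
lemma SI_row [Infinite K] {e : ℕ} {f : MvPolynomial (Sig M n) K} (hf : f ∈ SI K M n e) (i : Fin n) :
    f.IsWeightedHomogeneous (roww i) e := by
  apply isWeighted_of_scale
  have := SI_ext hf (Matrix.diagonal fun s => if s = i then (Polynomial.X : Polynomial (MvPolynomial (Sig M n) K)) else 1) 1
    (fun l => (gm K M n l).map (Polynomial.C : _ →+* Polynomial (MvPolynomial (Sig M n) K)))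
  simp only [mul_one, det_one, det_diagonal, Finset.prod_ite_eq', Finset.mem_univ, if_true] at this
  rw [ev_C_gm] at this
  rw [mul_comm, ← this, ev]
  congr 2
  funext p
  rw [Matrix.diagonal_mul, Matrix.map_apply, gm, Matrix.of_apply, mul_comm, roww]
  split_ifs <;> simp
noncomputable def trp : MvPolynomial (Sig M n) K →ₐ[K] MvPolynomial (Sig M n) K :=
  rename fun v => (v.1, v.2.2, v.2.1)
lemma ev_trp (f : MvPolynomial (Sig M n) K) (Y : Fin M → Matrix (Fin n) (Fin n) K) :
    ev Y (trp f) = ev (fun l => (Y l)ᵀ) f := by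
  rw [trp, ev, aeval_rename]; rfl
lemma SI_trp {e : ℕ} {f : MvPolynomial (Sig M n) K} (hf : f ∈ SI K M n e) : trp f ∈ SI K M n e := by
  intro P Q hP hQ Y
  rw [ev_trp, ev_trp]
  have := hf Qᵀ Pᵀ (by rwa [det_transpose]) (by rwa [det_transpose]) (fun l => (Y l)ᵀ)
  rw [det_transpose, det_transpose, mul_comm Q.det] at this
  rw [← this]
  congr 2; funext l
  rw [transpose_mul, transpose_mul, mul_assoc]
lemma tt_trp : trp (tt K M n N) = tt K M n N := by
  rw [tt]
  refine (map_TT (trp (K := K) (M := M) (n := n)).toRingHom n M N (xg K M n)).trans ?_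
  rw [← TT_swp]
  congr 1; funext l s t
  simp only [xg, swp]
  by_cases h : l < M ∧ s < n ∧ t < n
  · rw [dif_pos h, dif_pos ⟨h.1, h.2.2, h.2.1⟩]
    simp [trp]
  · rw [dif_neg h, dif_neg (by tauto)]; simp
variable (p : ℕ) [hp : Fact p.Prime]
lemma cart_trp (f : MvPolynomial (Sig M n) K) : trp (cart p f) = cart p (trp f) := by
  let s : Equiv.Perm (Sig M n) := ⟨fun v => (v.1, v.2.2, v.2.1), fun v => (v.1, v.2.2, v.2.1),
    fun v => rfl, fun v => rfl⟩
  induction f using MvPolynomial.induction_on' with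
  | monomial d a =>
    have h1 : ∀ (d : Sig M n →₀ ℕ) (a : K), trp (monomial d a) = monomial (d.mapDomain s) a := by
      intro d a; rw [trp, rename_monomial]; rfl
    have h3 : ∀ (d : Sig M n →₀ ℕ) v, d.mapDomain s v = d (s.symm v) := fun d v => by
      conv_lhs => rw [← s.apply_symm_apply v]
      rw [Finsupp.mapDomain_apply s.injective]
    rw [h1, cart_monomial, cart_monomial]
    have h2 : (∀ i, (d.mapDomain s) i % p = p - 1) ↔ (∀ i, d i % p = p - 1) := by
      constructor
      · intro h i; have := h (s i); rwa [h3, s.symm_apply_apply] at this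
      · intro h i; rw [h3]; exact h _
    rw [if_congr h2 rfl rfl]
    split_ifs
    · rw [h1]
      refine congrArg (fun z => monomial z a) ?_
      ext v
      rw [h3]; simp [h3]
    · simp
  | add f g hf hg => simp only [map_add, hf, hg]
lemma cart_left [CharP K p] [Infinite K] (hn : 0 < n) (hM : M + 1 = 2 * N) {e : ℕ}
    {s : MvPolynomial (Sig M n) K} (hs : s ∈ SI K M n (p * e)) (P : Matrix (Fin n) (Fin n) K)
    (hP : P.det ≠ 0) (Y : Fin M → Matrix (Fin n) (Fin n) K) :
    ev (fun l => P * Y l) (cart p (tt K M n N ^ (p - 1) * s)) =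
      P.det ^ e * ev Y (cart p (tt K M n N ^ (p - 1) * s)) := by
  apply lemC _ _ P hP Y
  · intro i
    apply cart_weighted p (roww i)
    exact ((tt_row hn hM i).pow (p - 1)).mul (SI_row hs i)
  · intro i j hij a Y
    have h1 := ev_trans i j hij a (cart p (tt K M n N ^ (p - 1) * s)) Y
    rw [Algebra.algebraMap_self, RingHom.id_apply] at h1
    obtain ⟨t0, t1, ht⟩ := tt_ush (K := K) (M := M) (N := N) i j hij
    rw [h1, cart_inv p _ _ (TSTW i j hij) _ _ t0 t1 (SI_ush hs i j hij) ht]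
lemma cart_SI [CharP K p] [Infinite K] (hn : 0 < n) (hM : M + 1 = 2 * N) {e : ℕ}
    {s : MvPolynomial (Sig M n) K} (hs : s ∈ SI K M n (p * e)) :
    cart p (tt K M n N ^ (p - 1) * s) ∈ SI K M n e := by
  intro P Q hP hQ Y
  have h1 := cart_left p hn hM hs P hP (fun l => Y l * Q)
  have h2 := cart_left p hn hM (SI_trp hs) Qᵀ (by rwa [det_transpose]) (fun l => (Y l)ᵀ)
  have h3 : cart p (tt K M n N ^ (p - 1) * trp s) = trp (cart p (tt K M n N ^ (p - 1) * s)) := by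
    rw [cart_trp, map_mul trp, map_pow trp, tt_trp]
  rw [h3, ev_trp, ev_trp, det_transpose] at h2
  simp only [transpose_mul, transpose_transpose] at h2
  simp only [mul_assoc]
  rw [h1, h2, mul_pow]; ring
lemma cart_tt [CharP K p] [Infinite K] (hn : 0 < n) (hM : M + 1 = 2 * N) :
    cart p (tt K M n N ^ (p - 1)) = 1 := by
  ext b
  by_cases hb : b = 0
  · subst hb
    rw [coeff_cart, smul_zero, zero_add, tt_coeff hn hM]; simp
  · have h1 : coeff b (cart p (tt K M n N ^ (p - 1))) = 0 := by
      by_contra h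
      apply hb
      ext ⟨l, i, j⟩
      have h2 : (cart p (tt K M n N ^ (p - 1))).IsWeightedHomogeneous (roww i) 0 := by
        apply cart_weighted
        simpa using (tt_row (K := K) hn hM i).pow (p - 1)
      have h3 := h2 h
      rw [Finsupp.weight_apply, Finsupp.sum_fintype _ _ (by simp)] at h3
      have := (Finset.sum_eq_zero_iff.mp h3) (l, i, j) (Finset.mem_univ _)
      simpa [roww] using this
    rw [h1, coeff_one, if_neg (Ne.symm hb)]
lemma SI_map {e : ℕ} {f : MvPolynomial (Sig M n) K} (hf : f ∈ SI K M n e) (φ : K ≃+* K) :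
    MvPolynomial.map φ.toRingHom f ∈ SI K M n e := by
  have key : ∀ Y : Fin M → Matrix (Fin n) (Fin n) K, ev Y (MvPolynomial.map φ.toRingHom f) =
      φ (ev (fun l => (Y l).map φ.symm) f) := by
    intro Y
    rw [ev, ev]
    simp only [aeval_def, Algebra.algebraMap_self]
    rw [eval₂_map]
    have h := eval₂_comp_left φ.toRingHom (RingHom.id K) (fun p : Sig M n => φ.symm (Y p.1 p.2.1 p.2.2)) f
    refine Eq.trans ?_ h.symm
    congr 1
    funext v; simp
  intro P Q hP hQ Y
  have hd : ∀ P : Matrix (Fin n) (Fin n) K, (P.map φ.symm).det = φ.symm P.det := fun P =>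
    ((φ.symm : K →+* K).map_det P).symm
  have := hf (P.map φ.symm) (Q.map φ.symm) (by rw [hd]; simpa using hP) (by rw [hd]; simpa using hQ)
    (fun l => (Y l).map φ.symm)
  rw [key, key]
  have h2 : (fun l => (P * Y l * Q).map φ.symm) = fun l => P.map φ.symm * (Y l).map φ.symm * Q.map φ.symm := by
    funext l; rw [Matrix.map_mul, Matrix.map_mul]
  rw [h2, this, hd, hd]
  simp
lemma fsplit [CharP K p] [IsAlgClosed K] (hn : 0 < n) (hM : M + 1 = 2 * N) {e : ℕ} {ι : Type}
    (I : Finset ι) (g : MvPolynomial (Sig M n) K) (f s : ι → MvPolynomial (Sig M n) K)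
    (hs : ∀ i ∈ I, s i ∈ SI K M n (p * e)) (h : g ^ p = ∑ i ∈ I, f i ^ p * s i) :
    ∃ s' : ι → MvPolynomial (Sig M n) K, (∀ i ∈ I, s' i ∈ SI K M n e) ∧ g = ∑ i ∈ I, f i * s' i := by
  haveI : Infinite K := IsAlgClosed.instInfinite
  haveI : ExpChar K p := ExpChar.prime hp.out
  let φ := frobeniusEquiv K p
  let T := tt K M n N ^ (p - 1)
  have h1 : cart p (g ^ p * T) = ∑ i ∈ I, cart p (f i ^ p * (T * s i)) := by
    rw [h, Finset.sum_mul, map_sum]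
    exact Finset.sum_congr rfl fun i _ => by rw [mul_assoc, mul_comm (s i)]
  simp only [cart_pow] at h1
  rw [cart_tt p hn hM, mul_one] at h1
  have h3 : ∀ G : MvPolynomial (Sig M n) K, MvPolynomial.map φ.symm.toRingHom (MvPolynomial.map (frobenius K p) G) = G := by
    intro G
    rw [MvPolynomial.map_map]
    have : φ.symm.toRingHom.comp (frobenius K p) = RingHom.id K := by
      ext x; exact φ.symm_apply_apply x
    rw [this, MvPolynomial.map_id]
  refine ⟨fun i => MvPolynomial.map φ.symm.toRingHom (cart p (T * s i)), fun i hi => SI_map (cart_SI p hn hM (hs i hi)) _, ?_⟩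
  have h4 := congrArg (MvPolynomial.map φ.symm.toRingHom) h1
  rw [h3, map_sum] at h4
  rw [h4]
  exact Finset.sum_congr rfl fun i _ => by rw [map_mul, h3]
end
def IntEq (K : Type) [CommRing K] {σ : Type} {r : ℕ} (f : Fin r → MvPolynomial σ K) (h : MvPolynomial σ K) : Prop :=
  ∃ (e : ℕ) (P : ℕ → MvPolynomial (Fin r) K), h ^ e = ∑ j ∈ Finset.range e, aeval f (P j) * h ^ j
section
variable {K : Type} [Field K] {M n : ℕ} {r : ℕ}
noncomputable def JJ (f : Fin r → MvPolynomial (Sig M n) K) (q c : ℕ) : Submodule K (MvPolynomial (Sig M n) K) where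
  carrier := {x | ∃ s : Fin r → MvPolynomial (Sig M n) K, (∀ i, s i ∈ SI K M n c) ∧ x = ∑ i, f i ^ q * s i}
  add_mem' := by
    rintro _ _ ⟨s, hs, rfl⟩ ⟨s', hs', rfl⟩
    exact ⟨fun i => s i + s' i, fun i => add_mem (hs i) (hs' i), by
      rw [← Finset.sum_add_distrib]; exact Finset.sum_congr rfl fun i _ => by ring⟩
  zero_mem' := ⟨0, fun i => zero_mem _, by simp⟩
  smul_mem' := by
    rintro c _ ⟨s, hs, rfl⟩
    exact ⟨fun i => c • s i, fun i => Submodule.smul_mem _ _ (hs i), by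
      rw [Finset.smul_sum]; exact Finset.sum_congr rfl fun i _ => by rw [mul_smul_comm]⟩
lemma JJ_descend (p : ℕ) [hp : Fact p.Prime] [CharP K p] [IsAlgClosed K] {N : ℕ} (hn : 0 < n) (hM : M + 1 = 2 * N)
    (f : Fin r → MvPolynomial (Sig M n) K) (h : MvPolynomial (Sig M n) K) (c s : ℕ)
    (H : h ^ (p ^ s) ∈ JJ f (p ^ s) (p ^ s * c)) : h ∈ JJ f 1 c := by
  induction s with
  | zero => simpa using H
  | succ s ih =>
    apply ih
    obtain ⟨t, ht, hh⟩ := H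
    rw [pow_succ, pow_mul] at hh
    obtain ⟨s', h1, h2⟩ := fsplit p hn hM (e := p ^ s * c) Finset.univ (h ^ p ^ s) (fun i => f i ^ p ^ s) t
      (fun i _ => by have := ht i; rwa [show p ^ (s + 1) * c = p * (p ^ s * c) by ring] at this)
      (by rw [hh]; exact Finset.sum_congr rfl fun i _ => by rw [pow_mul])
    exact ⟨s', fun i => h1 i (Finset.mem_univ _), h2⟩
lemma SI_prod {a : ℕ} (f : Fin r → MvPolynomial (Sig M n) K) (hf : ∀ i, f i ∈ SI K M n a) (α : Fin r → ℕ)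
    (S : Finset (Fin r)) :
    ∏ i ∈ S, f i ^ α i ∈ SI K M n (a * ∑ i ∈ S, α i) := by
  classical
  induction S using Finset.induction_on with
  | empty => simpa using SI_one
  | insert i S hi ih =>
    rw [Finset.prod_insert hi, Finset.sum_insert hi, mul_add, mul_comm a (α i)]
    exact SI_mul (SI_pow (hf i) _) ih
noncomputable def WW (f : Fin r → MvPolynomial (Sig M n) K) (h : MvPolynomial (Sig M n) K) (a b e N : ℕ) :
    Submodule K (MvPolynomial (Sig M n) K) :=
  Submodule.span K {x | ∃ (j : ℕ) (α : Fin r → ℕ), j < e ∧ a * ∑ i, α i + j * b = N * b ∧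
    x = (∏ i, f i ^ α i) * h ^ j}
lemma WW_all (f : Fin r → MvPolynomial (Sig M n) K) (h : MvPolynomial (Sig M n) K) (a b e : ℕ)
    (he : 0 < e) (H : h ^ e ∈ WW f h a b e e) (N : ℕ) : h ^ N ∈ WW f h a b e N := by
  induction N with
  | zero => exact Submodule.subset_span ⟨0, 0, he, by simp, by simp⟩
  | succ N ih =>
    rw [pow_succ]
    have : ∀ x ∈ WW f h a b e N, x * h ∈ WW f h a b e (N + 1) := by
      intro x hx
      induction hx using Submodule.span_induction with
      | mem x hx =>
        obtain ⟨j, α, hj, h1, rfl⟩ := hx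
        rw [mul_assoc, ← pow_succ]
        by_cases hje : j + 1 < e
        · exact Submodule.subset_span ⟨j + 1, α, hje, by rw [Nat.add_mul, Nat.add_mul]; omega, rfl⟩
        · have : j + 1 = e := by omega
          rw [this]
          have h2 : ∀ y ∈ WW f h a b e e, (∏ i, f i ^ α i) * y ∈ WW f h a b e (N + 1) := by
            intro y hy
            induction hy using Submodule.span_induction with
            | mem y hy =>
              obtain ⟨j', β, hj', h2, rfl⟩ := hy
              refine Submodule.subset_span ⟨j', α + β, hj', ?_, ?_⟩
              · simp only [Pi.add_apply, Finset.sum_add_distrib, mul_add]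
                rw [Nat.add_mul, one_mul]
                have : e * b = j * b + b := by rw [← this]; ring
                omega
              · rw [← mul_assoc, ← Finset.prod_mul_distrib]
                congr 1
                exact Finset.prod_congr rfl fun i _ => by rw [Pi.add_apply, pow_add]
            | zero => simp
            | add x y _ _ hx hy => rw [mul_add]; exact add_mem hx hy
            | smul c x _ hx => rw [mul_smul_comm]; exact Submodule.smul_mem _ _ hx
          exact h2 _ H
      | zero => simp
      | add x y _ _ hx hy => rw [add_mul]; exact add_mem hx hy
      | smul c x _ hx => rw [smul_mul_assoc]; exact Submodule.smul_mem _ _ hx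
    exact this _ ih
lemma WW_JJ (f : Fin r → MvPolynomial (Sig M n) K) (h : MvPolynomial (Sig M n) K) (a b e q : ℕ)
    (hf : ∀ i, f i ∈ SI K M n a) (hh : h ∈ SI K M n b) (hb : r * a < b) (hq : e * b < q) :
    WW f h a b e q ≤ JJ f q (q * (b - a)) := by
  classical
  apply Submodule.span_le.mpr
  rintro _ ⟨j, α, hj, h1, rfl⟩
  obtain ⟨i, hi⟩ : ∃ i, q ≤ α i := by
    by_contra hc
    push Not at hc
    have h2 : ∑ i, α i ≤ r * q := by
      have := Finset.sum_le_card_nsmul Finset.univ α q (fun i _ => (hc i).le)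
      simpa using this
    have h3 : a * ∑ i, α i ≤ a * (r * q) := Nat.mul_le_mul_left a h2
    have h4 : j * b ≤ e * b := Nat.mul_le_mul_right b hj.le
    have h5 : q * (r * a + 1) ≤ q * b := Nat.mul_le_mul_left q hb
    have h6 : a * (r * q) = q * (r * a) := by ring
    rw [mul_add, mul_one] at h5
    omega
  let α' : Fin r → ℕ := fun k => if k = i then α k - q else α k
  have hα : ∀ k, α k = α' k + if k = i then q else 0 := by
    intro k; simp only [α']; split_ifs with h
    · subst h; omega
    · rfl
  have e1 : ∏ k, f k ^ α k = f i ^ q * ∏ k, f k ^ α' k := by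
    rw [Finset.prod_congr rfl fun k _ => by rw [hα k, pow_add], Finset.prod_mul_distrib, mul_comm]
    congr 1
    rw [Finset.prod_eq_single i] <;> simp +contextual
  have e2 : ∑ k, α k = (∑ k, α' k) + q := by
    rw [Finset.sum_congr rfl fun k _ => hα k, Finset.sum_add_distrib]; simp
  have hab : a ≤ b := by
    rcases Nat.eq_zero_or_pos r with h | h
    · subst h; exact i.elim0
    · nlinarith
  refine ⟨fun k => if k = i then (∏ k, f k ^ α' k) * h ^ j else 0, ?_, ?_⟩
  · intro k
    dsimp only
    split_ifs
    · have := SI_mul (SI_prod f hf α' Finset.univ) (SI_pow hh j)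
      have e3 : a * ∑ k, α' k + j * b = q * (b - a) := by
        rw [e2, mul_add] at h1
        rw [Nat.mul_sub]
        have : a * q = q * a := mul_comm _ _
        omega
      rwa [e3] at this
    · exact zero_mem _
  · rw [e1, mul_assoc]; simp
lemma comp_aeval {σ : Type} {d : ℕ} (hd : 0 < d) (f : Fin r → MvPolynomial σ K) (hf : ∀ i, (f i).IsHomogeneous d)
    (P : MvPolynomial (Fin r) K) (k : ℕ) :
    homogeneousComponent k (aeval f P) ∈ Submodule.span K {x | ∃ α : Fin r → ℕ, d * ∑ i, α i = k ∧ x = ∏ i, f i ^ α i} := by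
  induction P using MvPolynomial.induction_on' with
  | monomial u c =>
    have h1 : aeval f (monomial u c) = c • ∏ i, f i ^ u i := by
      rw [aeval_monomial, Algebra.smul_def, Finsupp.prod_fintype _ _ (by simp)]
    have h2 : (∏ i, f i ^ u i).IsHomogeneous (d * ∑ i, u i) := by
      rw [Finset.mul_sum]
      exact IsHomogeneous.prod _ _ _ fun i _ => (hf i).pow _
    rw [h1, map_smul, homogeneousComponent_of_mem h2]
    split_ifs with h
    · exact Submodule.smul_mem _ _ (Submodule.subset_span ⟨u, h.symm, rfl⟩)
    · simp
  | add P Q hP hQ => rw [map_add, map_add]; exact add_mem hP hQ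
lemma comp_mul_homog {σ : Type} (g h : MvPolynomial σ K) (d k : ℕ) (hh : h.IsHomogeneous d) :
    homogeneousComponent (k + d) (g * h) = homogeneousComponent k g * h := by
  conv_lhs => rw [← sum_homogeneousComponent g, Finset.sum_mul, map_sum]
  have h1 : ∀ i, homogeneousComponent (k + d) (homogeneousComponent i g * h) =
      if i = k then homogeneousComponent i g * h else 0 := by
    intro i
    rw [homogeneousComponent_of_mem ((homogeneousComponent_isHomogeneous i g).mul hh)]
    by_cases h : i = k
    · simp [h]
    · rw [if_neg (by omega), if_neg h]
  simp only [h1]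
  rw [Finset.sum_ite_eq']
  split_ifs with h
  · rfl
  · rw [homogeneousComponent_eq_zero, zero_mul]
    simpa using h
lemma WW_of_IntEq [Infinite K] (hn : 0 < n) (f : Fin r → MvPolynomial (Sig M n) K) (h : MvPolynomial (Sig M n) K) (a b : ℕ)
    (ha : 0 < a) (hf : ∀ i, f i ∈ SI K M n a) (hh : h ∈ SI K M n b) (H : IntEq K f h) :
    ∃ e, 0 < e ∧ h ^ e ∈ WW f h a b e e := by
  obtain ⟨e, P, he⟩ := H
  refine ⟨e, ?_, ?_⟩
  · rcases Nat.eq_zero_or_pos e with h0 | h0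
    · subst h0; simp at he
    · exact h0
  have hhom := SI_homog hh
  have h1 := congrArg (homogeneousComponent (n * (e * b))) he
  rw [map_sum, homogeneousComponent_of_mem (SI_homog (SI_pow hh e)), if_pos rfl] at h1
  rw [h1]
  apply Submodule.sum_mem
  intro j hj
  have hj := Finset.mem_range.mp hj
  have e1 : n * (e * b) = (n * (e * b) - n * (j * b)) + n * (j * b) := by
    have : n * (j * b) ≤ n * (e * b) := by gcongr
    omega
  rw [e1, comp_mul_homog _ _ _ _ (SI_homog (SI_pow hh j))]
  have h2 := comp_aeval (Nat.mul_pos hn ha) f (fun i => SI_homog (hf i)) (P j) (n * (e * b) - n * (j * b))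
  revert h2
  generalize homogeneousComponent (n * (e * b) - n * (j * b)) (aeval f (P j)) = y
  intro h2
  induction h2 using Submodule.span_induction with
  | mem y hy =>
    obtain ⟨α, h3, rfl⟩ := hy
    refine Submodule.subset_span ⟨j, α, hj, ?_, rfl⟩
    apply Nat.eq_of_mul_eq_mul_left hn
    rw [mul_add, ← mul_assoc, h3]; exact e1.symm
  | zero => simp
  | add x y _ _ hx hy => rw [add_mul]; exact add_mem hx hy
  | smul c x _ hx => rw [smul_mul_assoc]; exact Submodule.smul_mem _ _ hx
lemma T2_odd (p : ℕ) [hp : Fact p.Prime] [CharP K p] [IsAlgClosed K] {N : ℕ} (hn : 0 < n) (hM : M + 1 = 2 * N)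
    (f : Fin r → MvPolynomial (Sig M n) K) (h : MvPolynomial (Sig M n) K) (a b : ℕ)
    (ha : 0 < a) (hf : ∀ i, f i ∈ SI K M n a) (hh : h ∈ SI K M n b) (H : IntEq K f h) (hb : r * a < b) :
    h ∈ JJ f 1 (b - a) := by
  haveI : Infinite K := IsAlgClosed.instInfinite
  obtain ⟨e, he, h1⟩ := WW_of_IntEq hn f h a b ha hf hh H
  apply JJ_descend p hn hM f h (b - a) (e * b)
  exact WW_JJ f h a b e _ hf hh hb (Nat.lt_pow_self hp.out.one_lt) (WW_all f h a b e he h1 _)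
lemma IntEq_map {σ τ : Type} (f : Fin r → MvPolynomial σ K) (h : MvPolynomial σ K) (φ : MvPolynomial σ K →ₐ[K] MvPolynomial τ K)
    (H : IntEq K f h) : IntEq K (fun i => φ (f i)) (φ h) := by
  obtain ⟨e, P, he⟩ := H
  refine ⟨e, P, ?_⟩
  rw [← map_pow, he, map_sum]
  refine Finset.sum_congr rfl fun j _ => ?_
  rw [map_mul, map_pow]
  congr 1
  rw [← AlgHom.comp_apply, MvPolynomial.comp_aeval]
lemma T2_p (p : ℕ) [hp : Fact p.Prime] [CharP K p] [IsAlgClosed K] (hn : 0 < n) (hM : 0 < M)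
    (f : Fin r → MvPolynomial (Sig M n) K) (h : MvPolynomial (Sig M n) K) (a b : ℕ)
    (ha : 0 < a) (hf : ∀ i, f i ∈ SI K M n a) (hh : h ∈ SI K M n b) (H : IntEq K f h) (hb : r * a < b) :
    h ∈ JJ f 1 (b - a) := by
  let M' := 2 * M - 1
  let ρ : MvPolynomial (Sig M n) K →ₐ[K] MvPolynomial (Sig M' n) K :=
    rename fun v => (Fin.castLE (by simp [M']; omega) v.1, v.2)
  let κ : MvPolynomial (Sig M' n) K →ₐ[K] MvPolynomial (Sig M n) K :=
    aeval fun v => if h : v.1.val < M then X (⟨v.1.val, h⟩, v.2) else 0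
  have hκρ : ∀ g, κ (ρ g) = g := by
    intro g
    have : κ.comp ρ = AlgHom.id K _ := by
      apply MvPolynomial.algHom_ext; intro v; simp [κ, ρ]
    exact DFunLike.congr_fun this g
  have hρ : ∀ e g, g ∈ SI K M n e → ρ g ∈ SI K M' n e := by
    intro e g hg P Q hP hQ Y
    have : ∀ Y : Fin M' → Matrix (Fin n) (Fin n) K, ev Y (ρ g) =
        ev (fun l : Fin M => Y (Fin.castLE (by simp [M']; omega) l)) g := by
      intro Y; simp only [ρ, ev]; rw [aeval_rename]; rfl
    rw [this, this]; exact hg P Q hP hQ _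
  have hκ : ∀ e g, g ∈ SI K M' n e → κ g ∈ SI K M n e := by
    intro e g hg P Q hP hQ Y
    have : ∀ Y : Fin M → Matrix (Fin n) (Fin n) K, ev Y (κ g) =
        ev (fun l : Fin M' => if h : l.val < M then Y ⟨l.val, h⟩ else 0) g := by
      intro Y
      have : (ev Y).comp κ = ev (K := K) (fun l : Fin M' => if h : l.val < M then Y ⟨l.val, h⟩ else 0) := by
        apply MvPolynomial.algHom_ext; intro v; simp only [AlgHom.comp_apply, κ, aeval_X, ev]
        split_ifs <;> simp
      rw [← this]; rfl
    rw [this, this, ← hg P Q hP hQ]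
    congr 2; funext l; split_ifs <;> simp
  obtain ⟨s, hs, h1⟩ := T2_odd p (M := M') (N := M) hn (by simp only [M']; omega) (fun i => ρ (f i)) (ρ h) a b ha
    (fun i => hρ _ _ (hf i)) (hρ _ _ hh) (IntEq_map f h ρ H) hb
  refine ⟨fun i => κ (s i), fun i => hκ _ _ (hs i), ?_⟩
  rw [← hκρ h, h1, map_sum]
  exact Finset.sum_congr rfl fun i _ => by rw [map_mul, map_pow, hκρ]
end
abbrev Tau (M n : ℕ) := (Fin n × Fin n) ⊕ (Fin n × Fin n) ⊕ Sig M n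
section
variable (R : Type) [CommRing R] (M n : ℕ)
noncomputable def gP : Matrix (Fin n) (Fin n) (MvPolynomial (Tau M n) R) := Matrix.of fun i j => MvPolynomial.X (Sum.inl (i, j))
noncomputable def gQ : Matrix (Fin n) (Fin n) (MvPolynomial (Tau M n) R) := Matrix.of fun i j => MvPolynomial.X (Sum.inr (Sum.inl (i, j)))
noncomputable def gX : Fin M → Matrix (Fin n) (Fin n) (MvPolynomial (Tau M n) R) := fun l =>
    Matrix.of fun i j => MvPolynomial.X (Sum.inr (Sum.inr (l, i, j)))
noncomputable def Phi (c : ℕ) : MvPolynomial (Sig M n) R →ₗ[R] MvPolynomial (Tau M n) R :=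
  (ev (K := R) fun l => gP R M n * gX R M n l * gQ R M n).toLinearMap -
    ((LinearMap.mulLeft R (((gP R M n).det * (gQ R M n).det) ^ c)).comp (ev (K := R) (gX R M n)).toLinearMap)
lemma Phi_apply (c : ℕ) (f : MvPolynomial (Sig M n) R) : Phi R M n c f =
    ev (fun l => gP R M n * gX R M n l * gQ R M n) f - ((gP R M n).det * (gQ R M n).det) ^ c * ev (gX R M n) f := rfl
variable {R M n}
lemma map_ev' {R' : Type} [CommRing R'] (φ : R →+* R') {L L' : Type} [CommRing L] [CommRing L'] [Algebra R L] [Algebra R' L']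
    (ψ : L →+* L') (hψ : ∀ x, ψ (algebraMap R L x) = algebraMap R' L' (φ x)) (Y : Fin M → Matrix (Fin n) (Fin n) L)
    (f : MvPolynomial (Sig M n) R) : ψ (ev Y f) = ev (K := R') (fun l => (Y l).map ψ) (MvPolynomial.map φ f) := by
  induction f using MvPolynomial.induction_on with
  | C a => simp [ev, hψ]
  | add f g hf hg => simp only [map_add, hf, hg]
  | mul_X f v hf => rw [map_mul, map_mul, hf, map_mul, map_mul, MvPolynomial.map_X, ev_X, ev_X]; rfl
lemma Phi_map {R' : Type} [CommRing R'] (φ : R →+* R') (c : ℕ) (f : MvPolynomial (Sig M n) R) :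
    MvPolynomial.map φ (Phi R M n c f) = Phi R' M n c (MvPolynomial.map φ f) := by
  have hX : ∀ l, (gX R M n l).map (MvPolynomial.map φ) = gX R' M n l := by intro l; ext i j; simp [gX]
  have hP : (gP R M n).map (MvPolynomial.map φ) = gP R' M n := by ext i j; simp [gP]
  have hQ : (gQ R M n).map (MvPolynomial.map φ) = gQ R' M n := by ext i j; simp [gQ]
  have hd : ∀ A : Matrix (Fin n) (Fin n) (MvPolynomial (Tau M n) R), MvPolynomial.map φ A.det = (A.map (MvPolynomial.map φ)).det := by
    intro A; rw [RingHom.map_det]; rfl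
  rw [Phi_apply, Phi_apply, map_sub, map_mul, map_pow, map_mul, hd, hd, hP, hQ,
    map_ev' φ (MvPolynomial.map φ) (by intro x; simp [algebraMap_eq]), map_ev' φ (MvPolynomial.map φ) (by intro x; simp [algebraMap_eq])]
  have h1 : (fun l => (gX R M n l).map (MvPolynomial.map φ)) = gX R' M n := funext hX
  have h2 : (fun l => (gP R M n * gX R M n l * gQ R M n).map (MvPolynomial.map φ)) =
      fun l => gP R' M n * gX R' M n l * gQ R' M n := by
    funext l
    rw [Matrix.map_mul, Matrix.map_mul, hP, hX, hQ]
  rw [h1, h2]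
end
section
variable {K : Type} [Field K] {M n : ℕ}
lemma SI_iff_Phi [Infinite K] (c : ℕ) (f : MvPolynomial (Sig M n) K) : f ∈ SI K M n c ↔ Phi K M n c f = 0 := by
  constructor
  · intro hf
    rw [Phi_apply, SI_ext hf, sub_self]
  · intro h P Q hP hQ Y
    let φ : MvPolynomial (Tau M n) K →ₐ[K] K := aeval (Sum.elim (fun p => P p.1 p.2) (Sum.elim (fun p => Q p.1 p.2)
      (fun p => Y p.1 p.2.1 p.2.2)))
    have hP' : (gP K M n).map φ = P := by ext i j; simp [gP, φ]
    have hQ' : (gQ K M n).map φ = Q := by ext i j; simp [gQ, φ]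
    have hX' : (fun l => (gX K M n l).map φ) = Y := by funext l; ext i j; simp [gX, φ]
    have hX'' : ∀ l, (gX K M n l).map φ = Y l := fun l => by rw [← hX']
    have hd : ∀ A : Matrix (Fin n) (Fin n) (MvPolynomial (Tau M n) K), φ A.det = (A.map φ).det := by
      intro A; rw [AlgHom.map_det]; rfl
    have h1 := congrArg φ h
    rw [Phi_apply, map_sub, map_mul, map_pow, map_mul, hd, hd, hP', hQ', map_zero, map_ev, map_ev, hX'] at h1
    have h2 : (fun l => (gP K M n * gX K M n l * gQ K M n).map φ) = fun l => P * Y l * Q := by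
      funext l
      rw [Matrix.map_mul, Matrix.map_mul, hP', hX'', hQ']
    rw [h2] at h1
    exact sub_eq_zero.mp h1
lemma fredholm {κ ρ : Type} [Fintype κ] (S : Finset ρ) (A : κ → ρ → K) (b : ρ → K)
    (hA : ∀ k, ∀ s ∉ S, A k s = 0) (hb : ∀ s ∉ S, b s = 0)
    (h : ¬ ∃ x : κ → K, ∀ s, ∑ k, x k * A k s = b s) :
    ∃ y : ρ → K, (∀ k, ∑ s ∈ S, y s * A k s = 0) ∧ ∑ s ∈ S, y s * b s = 1 := by
  classical
  let V := S → K
  let A' : κ → V := fun k s => A k s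
  let b' : V := fun s => b s
  have hnot : b' ∉ Submodule.span K (Set.range A') := by
    intro hm
    rw [Submodule.mem_span_range_iff_exists_fun] at hm
    obtain ⟨x, hx⟩ := hm
    apply h
    refine ⟨x, fun s => ?_⟩
    by_cases hs : s ∈ S
    · have := congrFun hx ⟨s, hs⟩
      rw [Finset.sum_apply] at this
      exact this
    · rw [hb s hs]; exact Finset.sum_eq_zero fun k _ => by rw [hA k s hs, mul_zero]
  obtain ⟨ℓ, h1, h2⟩ := Submodule.exists_dual_map_eq_bot_of_notMem hnot inferInstance
  have h3 : ∀ k, ℓ (A' k) = 0 := by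
    intro k
    have : ℓ (A' k) ∈ (Submodule.span K (Set.range A')).map ℓ :=
      Submodule.mem_map_of_mem (Submodule.subset_span ⟨k, rfl⟩)
    exact (Submodule.mem_bot K).mp (h2 ▸ this)
  have h4 : ∀ v : V, ℓ v = ∑ s : S, ℓ (Pi.single s 1) * v s := by
    intro v
    conv_lhs => rw [← Finset.univ_sum_single v, map_sum]
    refine Finset.sum_congr rfl fun s _ => ?_
    have : (Pi.single s (v s) : V) = v s • Pi.single s 1 := by
      rw [← Pi.single_smul]; simp
    rw [this, map_smul, smul_eq_mul, mul_comm]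
  refine ⟨fun s => if hs : s ∈ S then (ℓ b')⁻¹ * ℓ (Pi.single ⟨s, hs⟩ 1) else 0, fun k => ?_, ?_⟩
  · rw [← Finset.sum_coe_sort S (fun s => (if hs : s ∈ S then (ℓ b')⁻¹ * ℓ (Pi.single ⟨s, hs⟩ 1) else 0) * A k s)]
    have := h4 (A' k)
    rw [h3] at this
    simp only [Finset.coe_mem, dif_pos, mul_assoc]
    rw [← Finset.mul_sum]
    erw [← this]; rw [mul_zero]
  · rw [← Finset.sum_coe_sort S (fun s => (if hs : s ∈ S then (ℓ b')⁻¹ * ℓ (Pi.single ⟨s, hs⟩ 1) else 0) * b s)]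
    have := h4 b'
    simp only [Finset.coe_mem, dif_pos, mul_assoc]
    rw [← Finset.mul_sum]
    erw [← this]; rw [inv_mul_cancel₀ h1]
end
lemma jac_int : IsJacobsonRing ℤ := by
  rw [isJacobsonRing_iff_prime_eq]
  intro P hP
  by_cases h : P = ⊥
  · subst h
    rw [eq_bot_iff]
    intro x hx
    have h1 := Ideal.mem_jacobson_bot.mp hx x
    rw [Int.isUnit_iff] at h1
    rw [Ideal.mem_bot]
    rcases h1 with h1 | h1
    · have : x * x = 0 := by linarith
      exact mul_self_eq_zero.mp this
    · nlinarith [mul_self_nonneg x]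
  · haveI := Ideal.IsPrime.isMaximal hP h
    exact Ideal.jacobson_eq_self_of_isMaximal
lemma exists_char_p (Λ : Type) [CommRing Λ] [Nontrivial Λ] [Algebra.FiniteType ℤ Λ] :
    ∃ (p : ℕ) (k : Type) (_ : Field k) (_ : IsAlgClosed k) (_ : CharP k p), p.Prime ∧ Nonempty (Λ →+* k) := by
  obtain ⟨m, hm⟩ := Ideal.exists_maximal Λ
  letI := Ideal.Quotient.field m
  haveI : Algebra.FiniteType ℤ (Λ ⧸ m) := Algebra.FiniteType.of_surjective (Ideal.Quotient.mkₐ ℤ m) Ideal.Quotient.mk_surjective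
  haveI := jac_int
  haveI := finite_of_finite_type_of_isJacobsonRing ℤ (Λ ⧸ m)
  obtain ⟨p, hp⟩ := CharP.exists (Λ ⧸ m)
  refine ⟨p, AlgebraicClosure (Λ ⧸ m), inferInstance, inferInstance, ?_, ?_, ?_⟩
  · exact charP_of_injective_algebraMap (algebraMap (Λ ⧸ m) (AlgebraicClosure (Λ ⧸ m))).injective p
  · rcases CharP.char_is_prime_or_zero (Λ ⧸ m) p with h | h
    · exact h
    · exfalso
      subst h
      haveI := CharP.charP_to_charZero (Λ ⧸ m)
      have := isField_of_isIntegral_of_isField (R := ℤ) (S := Λ ⧸ m) (by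
        intro x y hxy; simpa using hxy) (Field.toIsField _)
      exact Int.not_isField this
  · exact ⟨(algebraMap (Λ ⧸ m) (AlgebraicClosure (Λ ⧸ m))).comp (Ideal.Quotient.mk m)⟩
section
variable {K : Type} [Field K] {M n : ℕ} {r : ℕ}
noncomputable def sysA (R : Type) [CommRing R] {M n r : ℕ} (c : ℕ) (F : Fin r → MvPolynomial (Sig M n) R) (D : Finset (Sig M n →₀ ℕ))
    (k : Fin r × D) : ((Sig M n →₀ ℕ) ⊕ (Fin r × (Tau M n →₀ ℕ))) → R
  | Sum.inl u => coeff u (F k.1 * monomial k.2.1 1)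
  | Sum.inr v => if v.1 = k.1 then coeff v.2 (Phi R M n c (monomial k.2.1 1)) else 0
noncomputable def sysb (R : Type) [CommRing R] {M n : ℕ} (r : ℕ) (H : MvPolynomial (Sig M n) R) :
    ((Sig M n →₀ ℕ) ⊕ (Fin r × (Tau M n →₀ ℕ))) → R
  | Sum.inl u => coeff u H
  | Sum.inr v => 0
lemma sysA_map {R R' : Type} [CommRing R] [CommRing R'] (φ : R →+* R') (c : ℕ) (F : Fin r → MvPolynomial (Sig M n) R)
    (D : Finset (Sig M n →₀ ℕ)) (k : Fin r × D) (s) :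
    φ (sysA R c F D k s) = sysA R' c (fun i => MvPolynomial.map φ (F i)) D k s := by
  rcases s with u | v
  · simp only [sysA]
    rw [← coeff_map, map_mul, map_monomial, map_one]
  · simp only [sysA]
    split_ifs
    · rw [← coeff_map, Phi_map, map_monomial, map_one]
    · simp
lemma sysb_map {R R' : Type} [CommRing R] [CommRing R'] (φ : R →+* R') (H : MvPolynomial (Sig M n) R) (s) :
    φ (sysb R r H s) = sysb R' r (MvPolynomial.map φ H) s := by
  rcases s with u | v
  · simp only [sysb]; rw [coeff_map]
  · simp [sysb]
lemma sys_iff [Infinite K] (c : ℕ) (f : Fin r → MvPolynomial (Sig M n) K) (h : MvPolynomial (Sig M n) K)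
    (D : Finset (Sig M n →₀ ℕ)) (hD : ∀ g ∈ SI K M n c, ∀ u ∈ g.support, u ∈ D) :
    (∃ x : Fin r × D → K, ∀ s, ∑ k, x k * sysA K c f D k s = sysb K r h s) ↔ h ∈ JJ f 1 c := by
  classical
  have key : ∀ (x : Fin r × D → K), (∀ s, ∑ k, x k * sysA K c f D k s = sysb K r h s) ↔
      ((∑ i, f i * ∑ d, monomial d.1 (x (i, d)) = h) ∧ ∀ i, Phi K M n c (∑ d : D, monomial d.1 (x (i, d))) = 0) := by
    intro x
    have e0 : ∀ i (d : D), (monomial d.1 (x (i, d)) : MvPolynomial (Sig M n) K) = x (i, d) • monomial d.1 1 := by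
      intro i d; rw [smul_monomial, smul_eq_mul, mul_one]
    have e1 : ∀ u, ∑ k, x k * sysA K c f D k (Sum.inl u) = coeff u (∑ i, f i * ∑ d : D, monomial d.1 (x (i, d))) := by
      intro u
      rw [Fintype.sum_prod_type, coeff_sum]
      refine Finset.sum_congr rfl fun i _ => ?_
      rw [Finset.mul_sum, coeff_sum]
      refine Finset.sum_congr rfl fun d _ => ?_
      rw [e0, mul_smul_comm, coeff_smul]; rfl
    have e2 : ∀ i u, ∑ k, x k * sysA K c f D k (Sum.inr (i, u)) = coeff u (Phi K M n c (∑ d : D, monomial d.1 (x (i, d)))) := by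
      intro i u
      rw [Fintype.sum_prod_type, Finset.sum_eq_single i]
      · rw [map_sum, coeff_sum]
        refine Finset.sum_congr rfl fun d _ => ?_
        rw [e0, map_smul, coeff_smul]; simp [sysA]
      · intro j _ hj
        exact Finset.sum_eq_zero fun d _ => by simp [sysA, Ne.symm hj]
      · simp
    constructor
    · intro H
      constructor
      · ext u; rw [← e1, H]; rfl
      · intro i; ext u; rw [← e2, H]; rfl
    · rintro ⟨H1, H2⟩ (u | ⟨i, u⟩)
      · rw [e1, H1]; rfl
      · rw [e2, H2]; rfl
  constructor
  · rintro ⟨x, hx⟩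
    obtain ⟨h1, h2⟩ := (key x).mp hx
    exact ⟨fun i => ∑ d : D, monomial d.1 (x (i, d)), fun i => (SI_iff_Phi _ _).mpr (h2 i), by simpa using h1.symm⟩
  · rintro ⟨s, hs, rfl⟩
    have e : ∀ i, ∑ d : D, monomial d.1 (coeff d.1 (s i)) = s i := by
      intro i
      rw [Finset.sum_coe_sort D (fun d => monomial d (coeff d (s i)))]
      conv_rhs => rw [(s i).as_sum]
      symm
      apply Finset.sum_subset (hD _ (hs i))
      intro u _ hu
      rw [notMem_support_iff.mp hu, monomial_zero]
    refine ⟨fun k => coeff k.2.1 (s k.1), (key _).mpr ⟨?_, ?_⟩⟩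
    · simp only [e, pow_one]
    · intro i; simp only [e]; exact (SI_iff_Phi _ _).mp (hs i)
lemma T2_zero [CharZero K] (hn : 0 < n) (hM : 0 < M)
    (f : Fin r → MvPolynomial (Sig M n) K) (h : MvPolynomial (Sig M n) K) (a b : ℕ)
    (ha : 0 < a) (hf : ∀ i, f i ∈ SI K M n a) (hh : h ∈ SI K M n b) (H : IntEq K f h) (hb : r * a < b) :
    h ∈ JJ f 1 (b - a) := by
  classical
  let c := b - a
  let D : Finset (Sig M n →₀ ℕ) := (Finset.univ : Finset (Sig M n)).finsuppAntidiag (n * c)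
  have hD : ∀ (k : Type) [Field k] [Infinite k], ∀ g ∈ SI k M n c, ∀ u ∈ g.support, u ∈ D := by
    intro k _ _ g hg u hu
    have h1 := SI_homog hg (mem_support_iff.mp hu)
    rw [Finset.mem_finsuppAntidiag]
    refine ⟨?_, Finset.subset_univ _⟩
    rw [← h1, Finsupp.weight_apply, Finsupp.sum_fintype _ _ (by simp)]; simp
  by_contra hcon
  rw [← sys_iff c f h D (hD K)] at hcon
  let S : Finset ((Sig M n →₀ ℕ) ⊕ (Fin r × (Tau M n →₀ ℕ))) :=
    ((h.support ∪ Finset.univ.biUnion fun k : Fin r × D => (f k.1 * monomial k.2.1 1).support).disjSum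
      (Finset.univ ×ˢ Finset.univ.biUnion fun k : D => (Phi K M n c (monomial k.1 1)).support))
  obtain ⟨y, hy1, hy2⟩ := fredholm S (sysA K c f D) (sysb K r h) (by
    rintro k (u | v) hs
    · simp only [S, Finset.inl_mem_disjSum, Finset.mem_union, Finset.mem_biUnion, Finset.mem_univ, true_and, not_or, not_exists] at hs
      exact notMem_support_iff.mp (hs.2 k)
    · simp only [S, Finset.inr_mem_disjSum, Finset.mem_product, Finset.mem_biUnion, Finset.mem_univ, true_and, not_exists] at hs
      simp only [sysA]
      rw [notMem_support_iff.mp (hs k.2), ite_self]) (by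
    rintro (u | v) hs
    · simp only [S, Finset.inl_mem_disjSum, Finset.mem_union, Finset.mem_biUnion, Finset.mem_univ, true_and, not_or, not_exists] at hs
      exact notMem_support_iff.mp hs.1
    · rfl) hcon
  obtain ⟨e, P, he⟩ := H
  let G : Finset K := h.coeffs ∪ (Finset.univ.biUnion fun i => (f i).coeffs) ∪
    ((Finset.range e).biUnion fun j => (P j).coeffs) ∪ S.image y
  let Λ := Algebra.adjoin ℤ (G : Set K)
  haveI : Algebra.FiniteType ℤ Λ := (Subalgebra.fg_iff_finiteType _).mp (Subalgebra.fg_adjoin_finset G)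
  let ι : Λ →+* K := Λ.subtype
  have hι : Function.Injective ι := Subtype.val_injective
  have hG : ∀ x ∈ G, x ∈ Set.range ι := fun x hx => ⟨⟨x, Algebra.subset_adjoin hx⟩, rfl⟩
  have lift : ∀ {τ : Type} (g : MvPolynomial τ K), g.coeffs ⊆ G → ∃ g', MvPolynomial.map ι g' = g := by
    intro τ g hg
    exact mem_range_map_iff_coeffs_subset.mpr fun x hx => hG x (hg hx)
  obtain ⟨h', hh'⟩ := lift h (by intro x hx; simp only [G, Finset.mem_union]; tauto)
  have : ∀ i, ∃ g', MvPolynomial.map ι g' = f i := fun i => lift (f i) (by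
    intro x hx; simp only [G, Finset.mem_union, Finset.mem_biUnion, Finset.mem_univ, true_and]; exact Or.inl (Or.inl (Or.inr ⟨i, hx⟩)))
  choose f' hf' using this
  have : ∀ j, ∃ g', j < e → MvPolynomial.map ι g' = P j := fun j => by
    by_cases hj : j < e
    · obtain ⟨g, hg⟩ := lift (P j) (by
        intro x hx; simp only [G, Finset.mem_union, Finset.mem_biUnion, Finset.mem_univ, true_and]
        exact Or.inl (Or.inr ⟨j, Finset.mem_range.mpr hj, hx⟩))
      exact ⟨g, fun _ => hg⟩
    · exact ⟨0, fun h => absurd h hj⟩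
  choose P' hP' using this
  have : ∀ s, ∃ z : Λ, s ∈ S → ι z = y s := fun s => by
    by_cases hs : s ∈ S
    · obtain ⟨z, hz⟩ := hG (y s) (by simp only [G, Finset.mem_union]; exact Or.inr (Finset.mem_image_of_mem _ hs))
      exact ⟨z, fun _ => hz⟩
    · exact ⟨0, fun h => absurd h hs⟩
  choose y' hy' using this
  have E1 : ∀ k, ∑ s ∈ S, y' s * sysA Λ c f' D k s = 0 := by
    intro k
    apply hι
    rw [map_sum, map_zero, ← hy1 k]
    refine Finset.sum_congr rfl fun s hs => ?_
    rw [map_mul, hy' s hs, sysA_map]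
    simp only [hf']
  have E2 : ∑ s ∈ S, y' s * sysb Λ r h' s = 1 := by
    apply hι
    rw [map_sum, map_one, ← hy2]
    refine Finset.sum_congr rfl fun s hs => ?_
    rw [map_mul, hy' s hs, sysb_map, hh']
  have hinj : ∀ τ : Type, Function.Injective (MvPolynomial.map ι : MvPolynomial τ Λ → MvPolynomial τ K) :=
    fun τ => MvPolynomial.map_injective ι hι
  have hae : ∀ (R : Type) [CommRing R] (φ : Λ →+* R) (Q : MvPolynomial (Fin r) Λ), MvPolynomial.map φ (aeval f' Q) =
      aeval (fun i => MvPolynomial.map φ (f' i)) (MvPolynomial.map φ Q) := by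
    intro R _ φ Q
    induction Q using MvPolynomial.induction_on with
    | C x => simp [algebraMap_eq]
    | add g g' hg hg' => simp only [map_add, hg, hg']
    | mul_X g v hg => simp only [map_mul, hg, MvPolynomial.map_X, aeval_X]
  have E3 : h' ^ e = ∑ j ∈ Finset.range e, aeval f' (P' j) * h' ^ j := by
    apply hinj _
    rw [map_pow, hh', he, map_sum]
    refine Finset.sum_congr rfl fun j hj => ?_
    rw [map_mul, map_pow, hh', hae, hP' j (Finset.mem_range.mp hj)]
    simp only [hf']
  have E4 : ∀ i, Phi Λ M n a (f' i) = 0 := by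
    intro i; apply hinj _; rw [Phi_map, hf', map_zero]; exact (SI_iff_Phi _ _).mp (hf i)
  have E5 : Phi Λ M n b h' = 0 := by
    apply hinj _; rw [Phi_map, hh', map_zero]; exact (SI_iff_Phi _ _).mp hh
  obtain ⟨p, k, _, _, _, hp, ⟨φ⟩⟩ := exists_char_p Λ
  haveI : Fact p.Prime := ⟨hp⟩
  haveI : Infinite k := IsAlgClosed.instInfinite
  have hfin := T2_p p hn hM (fun i => MvPolynomial.map φ (f' i)) (MvPolynomial.map φ h') a b ha
    (fun i => (SI_iff_Phi _ _).mpr (by rw [← Phi_map, E4, map_zero])) ((SI_iff_Phi _ _).mpr (by rw [← Phi_map, E5, map_zero]))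
    ⟨e, fun j => MvPolynomial.map φ (P' j), by
      rw [← map_pow, E3, map_sum]
      exact Finset.sum_congr rfl fun j _ => by rw [map_mul, map_pow, hae]⟩ hb
  rw [← sys_iff c _ _ D (hD k)] at hfin
  obtain ⟨x, hx⟩ := hfin
  have E6 := congrArg φ E2
  rw [map_sum, map_one] at E6
  apply one_ne_zero (α := k)
  rw [← E6]
  have : ∀ s ∈ S, φ (y' s * sysb Λ r h' s) = ∑ q, x q * φ (y' s * sysA Λ c f' D q s) := by
    intro s _
    rw [map_mul, sysb_map, ← hx, Finset.mul_sum]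
    refine Finset.sum_congr rfl fun q _ => ?_
    rw [map_mul, sysA_map]; ring
  rw [Finset.sum_congr rfl this, Finset.sum_comm]
  apply Finset.sum_eq_zero
  intro q _
  rw [← Finset.mul_sum, ← map_sum, E1, map_zero, mul_zero]
theorem T2 [IsAlgClosed K] (hn : 0 < n) (hM : 0 < M)
    (f : Fin r → MvPolynomial (Sig M n) K) (h : MvPolynomial (Sig M n) K) (a b : ℕ)
    (ha : 0 < a) (hf : ∀ i, f i ∈ SI K M n a) (hh : h ∈ SI K M n b) (H : IntEq K f h) (hb : r * a < b) :
    h ∈ JJ f 1 (b - a) := by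
  obtain ⟨p, hp⟩ := CharP.exists K
  rcases CharP.char_is_prime_or_zero K p with h1 | h1
  · haveI : Fact p.Prime := ⟨h1⟩
    exact T2_p p hn hM f h a b ha hf hh H hb
  · subst h1
    haveI := CharP.charP_to_charZero K
    exact T2_zero hn hM f h a b ha hf hh H hb
end
section
variable {F : Type} [Field F] {ι : Type} [Fintype ι] [DecidableEq ι]
lemma rank_fac (A : Matrix ι ι F) : ∃ (P : Matrix (Fin A.rank) ι F) (Q : Matrix ι (Fin A.rank) F)
    (P' : Matrix ι (Fin A.rank) F) (Q' : Matrix (Fin A.rank) ι F), P * A * Q = 1 ∧ A = P' * Q' := by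
  obtain ⟨V, U, e, hV, hU, h⟩ := A.exists_rank_normal_form
  let E1 : Matrix ι (Fin A.rank) F := Matrix.of fun i j => if e i = Sum.inl j then 1 else 0
  let E2 : Matrix (Fin A.rank) ι F := Matrix.of fun j i => if e i = Sum.inl j then 1 else 0
  have h1 : (fromBlocks (1 : Matrix (Fin A.rank) (Fin A.rank) F) 0 0 (0 : Matrix (Fin (Fintype.card ι - A.rank)) (Fin (Fintype.card ι - A.rank)) F)).submatrix e e = E1 * E2 := by
    ext i j
    simp only [submatrix_apply, mul_apply, E1, E2, of_apply]
    rcases hi : e i with a | a <;> rcases hj : e j with b | b <;>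
      simp [hi, hj, Matrix.one_apply, eq_comm]
  have h2 : E2 * E1 = 1 := by
    ext a b
    simp only [mul_apply, E1, E2, of_apply]
    rw [← e.symm.sum_comp]
    simp [Matrix.one_apply, eq_comm]
  rw [isUnit_iff_isUnit_det] at hV hU
  refine ⟨E2 * V, U * E1, V⁻¹ * E1, E2 * U⁻¹, ?_, ?_⟩
  · calc E2 * V * A * (U * E1) = E2 * (V * A * U) * E1 := by simp only [Matrix.mul_assoc]
      _ = (E2 * E1) * (E2 * E1) := by rw [h, h1]; simp only [Matrix.mul_assoc]
      _ = 1 := by rw [h2, mul_one]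
  · calc A = V⁻¹ * (V * A * U) * U⁻¹ := by
          rw [Matrix.mul_assoc V, Matrix.nonsing_inv_mul_cancel_left _ _ hV, Matrix.mul_nonsing_inv_cancel_right _ _ hU]
      _ = _ := by rw [h, h1]; simp only [Matrix.mul_assoc]
lemma rank_ge_of_PQ {κ : Type} [Fintype κ] [DecidableEq κ] (A : Matrix ι ι F) (P : Matrix κ ι F) (Q : Matrix ι κ F)
    (h : (P * A * Q).det ≠ 0) : Fintype.card κ ≤ A.rank := by
  have h1 := rank_of_det_ne_zero h
  rw [← h1]
  exact (rank_mul_le_left _ _).trans (rank_mul_le_right _ _)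
lemma PQ_of_rank {r : ℕ} (A : Matrix ι ι F) (hr : r ≤ A.rank) :
    ∃ (P : Matrix (Fin r) ι F) (Q : Matrix ι (Fin r) F), (P * A * Q).det ≠ 0 := by
  obtain ⟨P, Q, _, _, h, _⟩ := rank_fac A
  refine ⟨P.submatrix (Fin.castLE hr) id, Q.submatrix id (Fin.castLE hr), ?_⟩
  have : P.submatrix (Fin.castLE hr) id * A * Q.submatrix id (Fin.castLE hr) = (P * A * Q).submatrix (Fin.castLE hr) (Fin.castLE hr) := by
    ext i j; simp [mul_apply]
  rw [this, h, submatrix_one _ (Fin.castLE_injective hr), det_one]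
  exact one_ne_zero
lemma rank_map_le {L : Type} [Field L] (f : F →+* L) (A : Matrix ι ι F) : A.rank = (A.map f).rank := by
  obtain ⟨P, Q, P', Q', h1, h2⟩ := rank_fac A
  apply le_antisymm
  · have h3 : (P.map f * A.map f * Q.map f).det ≠ 0 := by
      rw [← Matrix.map_mul, ← Matrix.map_mul, h1, Matrix.map_one _ (map_zero f) (map_one f), det_one]; exact one_ne_zero
    simpa using rank_ge_of_PQ _ _ _ h3
  · conv_lhs => rw [h2]
    rw [Matrix.map_mul]
    refine (rank_mul_le_left _ _).trans ((rank_le_card_width _).trans (by simp))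
def big {M n : ℕ} {R : Type} [CommRing R] {ι : Type} (T : Fin M → Matrix ι ι R) (Y : Fin M → Matrix (Fin n) (Fin n) R) :
    Matrix (ι × Fin n) (ι × Fin n) R := ∑ l, Matrix.kroneckerMap (· * ·) (T l) (Y l)
lemma big_apply {M n : ℕ} {R : Type} [CommRing R] {ι : Type} (T : Fin M → Matrix ι ι R) (Y : Fin M → Matrix (Fin n) (Fin n) R)
    (a b : ι × Fin n) : big T Y a b = ∑ l, T l a.1 b.1 * Y l a.2 b.2 := by
  simp [big, Matrix.sum_apply]
lemma big_map {M n : ℕ} {R R' : Type} [CommRing R] [CommRing R'] (f : R →+* R') {ι : Type} (T : Fin M → Matrix ι ι R) (Y : Fin M → Matrix (Fin n) (Fin n) R) :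
    (big T Y).map f = big (fun l => (T l).map f) (fun l => (Y l).map f) := by
  ext a b; simp [big_apply]
lemma transfer {k L : Type} [Field k] [Infinite k] [Field L] (f : k →+* L) {τ : Type} (p : MvPolynomial τ L)
    (x : τ → L) (h : eval x p ≠ 0) : ∃ y : τ → k, eval (fun i => f (y i)) p ≠ 0 := by
  by_contra hc
  push Not at hc
  apply h
  rw [MvPolynomial.funext_set (p := p) (q := 0) (fun _ => Set.range f) (fun _ => Set.infinite_range_of_injective f.injective) ?_]
  · simp
  · intro y hy
    choose z hz using fun i => hy i (Set.mem_univ i)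
    have := hc z
    simp only [hz] at this
    rw [show (fun i => y i) = y from rfl] at this
    rw [this, map_zero]
lemma transfer_rank {k L : Type} [Field k] [Infinite k] [Field L] (f : k →+* L) {τ : Type} [Fintype τ]
    (E : τ → Matrix ι ι L) (x : τ → L) (r : ℕ) (h : r ≤ (∑ t, x t • E t).rank) :
    ∃ y : τ → k, r ≤ (∑ t, f (y t) • E t).rank := by
  obtain ⟨P, Q, hPQ⟩ := PQ_of_rank _ h
  let G : Matrix (Fin r) (Fin r) (MvPolynomial τ L) :=
    P.map (C : L → MvPolynomial τ L) * (∑ t, (X t : MvPolynomial τ L) • (E t).map (C : L → MvPolynomial τ L)) * Q.map (C : L → MvPolynomial τ L)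
  have key : ∀ y : τ → L, eval y G.det = (P * (∑ t, y t • E t) * Q).det := by
    intro y
    rw [RingHom.map_det]
    congr 1
    have h1 : ∀ {a b : Type} (A : Matrix a b L), (A.map (C : L → MvPolynomial τ L)).map (eval y) = A := by
      intro a b A; ext i j; simp
    have h2 : (∑ t, (X t : MvPolynomial τ L) • (E t).map (C : L →  MvPolynomial τ L)).map (eval y) = ∑ t, y t • E t := by
      ext i j; simp [Matrix.sum_apply]
    simp only [G, RingHom.mapMatrix_apply]
    rw [Matrix.map_mul, Matrix.map_mul, h1, h1, h2]
  obtain ⟨y, hy⟩ := transfer f G.det x (by rw [key]; exact hPQ)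
  rw [key] at hy
  exact ⟨y, by simpa using rank_ge_of_PQ _ _ _ hy⟩
end
section
variable {F : Type} [Field F] {e : ℕ}
lemma cyc_val (j : Fin (e+1)) : ((j + 1 : Fin (e+1)).val : ℤ) = j.val + 1 - (e + 1) * (if j = Fin.last e then 1 else 0) := by
  rw [Fin.val_add_one]
  split_ifs with h
  · subst h; simp
  · push_cast; ring
lemma cyc_det_ne (B : Matrix (Fin (e+1)) (Fin (e+1)) (Polynomial F)) (hB : B ≠ 0)
    (h0 : ∀ j k, B j k = 0 ↔ B (j+1) (k+1) = 0)
    (hdeg : ∀ j k, B j k ≠ 0 → (if j = Fin.last e then 1 else 0) + (B (j+1) (k+1)).natDegree =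
      (B j k).natDegree + (if k = Fin.last e then 1 else 0)) : B.det ≠ 0 := by
  classical
  let ν : Fin (e+1) → Fin (e+1) → ℤ := fun j k => (e+1) * (B j k).natDegree + k.val - j.val
  have hν : ∀ j k, B j k ≠ 0 → ν (j+1) (k+1) = ν j k := by
    intro j k h
    simp only [ν, cyc_val]
    have := hdeg j k h
    have h2 : (((if j = Fin.last e then 1 else 0 : ℕ)) : ℤ) + (B (j+1) (k+1)).natDegree =
      (B j k).natDegree + ((if k = Fin.last e then 1 else 0 : ℕ) : ℤ) := by exact_mod_cast this
    push_cast at h2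
    linear_combination ((e : ℤ) + 1) * h2
  have hz : ∀ (j c : Fin (e+1)), B j (j + c) = 0 ↔ B 0 c = 0 := by
    intro j c
    induction j using Fin.induction with
    | zero => simp
    | succ i ih =>
      rw [← ih, h0 i.castSucc]
      rw [← Fin.coeSucc_eq_succ, add_right_comm]
  have hc : ∀ (j c : Fin (e+1)), B 0 c ≠ 0 → ν j (j + c) = ν 0 c := by
    intro j c h
    induction j using Fin.induction with
    | zero => simp
    | succ i ih =>
      rw [← ih, ← hν i.castSucc]
      · rw [← Fin.coeSucc_eq_succ, add_right_comm]
      · exact fun h' => h ((hz _ _).mp h')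
  have hne : (Finset.univ.filter fun c => B 0 c ≠ 0).Nonempty := by
    by_contra hcon
    rw [Finset.not_nonempty_iff_eq_empty, Finset.filter_eq_empty_iff] at hcon
    apply hB
    ext1 j k
    have := (hz j (k - j)).mpr (not_not.mp (hcon (Finset.mem_univ (k - j))))
    rwa [add_sub_cancel] at this
  obtain ⟨c, hcm, hmax⟩ := Finset.exists_max_image _ (fun c => ν 0 c) hne
  rw [Finset.mem_filter] at hcm
  have hc0 := hcm.2
  have hinj : ∀ c', ν 0 c' = ν 0 c → c' = c := by
    intro c' h
    simp only [ν] at h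
    have h1 : ((e : ℤ) + 1) ∣ (c'.val : ℤ) - c.val := ⟨(B 0 c).natDegree - (B 0 c').natDegree, by linear_combination h⟩
    have h2 : (c'.val : ℤ) - c.val = 0 := by
      apply Int.eq_zero_of_abs_lt_dvd h1
      have := c.2; have := c'.2
      rw [abs_lt]; constructor <;> omega
    ext; omega
  let π : Equiv.Perm (Fin (e+1)) := Equiv.subRight c
  have hπ : ∀ j, B (π j) j ≠ 0 := by
    intro j h
    apply hc0
    rw [← hz (π j) c]
    simpa [π] using h
  let N := ∑ j, (B (π j) j).natDegree
  have hsum : ∀ ρ : Equiv.Perm (Fin (e+1)), ((e : ℤ) + 1) * ∑ j, ((B (ρ j) j).natDegree : ℤ) = ∑ j, ν (ρ j) j := by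
    intro ρ
    simp only [ν]
    rw [Finset.sum_sub_distrib, Finset.sum_add_distrib, ← Finset.mul_sum, Equiv.sum_comp ρ (fun j : Fin (e+1) => (j.val : ℤ))]
    ring
  have hle : ∀ j k, B j k ≠ 0 → ν j k ≤ ν 0 c ∧ (ν j k = ν 0 c → k - j = c) := by
    intro j k h
    have h1 : B 0 (k - j) ≠ 0 := by
      rw [Ne, ← hz j (k - j), add_sub_cancel]; exact h
    have h2 := hc j (k - j) h1
    rw [add_sub_cancel] at h2
    rw [h2]
    exact ⟨hmax _ (by simp [h1]), hinj _⟩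
  have hπν : ∀ j, ν (π j) j = ν 0 c := by
    intro j
    have := hc (π j) c hc0
    simpa [π] using this
  have hco : B.det.coeff N ≠ 0 := by
    rw [det_apply', Polynomial.finsetSum_coeff, Finset.sum_eq_single π]
    · rw [← Polynomial.C_eq_intCast, Polynomial.coeff_C_mul]
      refine mul_ne_zero ?_ ?_
      · rcases Int.units_eq_one_or (Equiv.Perm.sign π) with h | h <;> simp [h]
      · have : N = (∏ j, B (π j) j).natDegree := by
          rw [Polynomial.natDegree_prod _ _ fun j _ => hπ j]
        rw [this]
        exact Polynomial.leadingCoeff_ne_zero.mpr (Finset.prod_ne_zero_iff.mpr fun j _ => hπ j)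
    · intro ρ _ hρ
      rw [← Polynomial.C_eq_intCast, Polynomial.coeff_C_mul]
      by_cases hall : ∀ j, B (ρ j) j ≠ 0
      · rw [Polynomial.coeff_eq_zero_of_natDegree_lt, mul_zero]
        rw [Polynomial.natDegree_prod _ _ fun j _ => hall j]
        have hlt : ∑ j, ν (ρ j) j < ∑ j, ν (π j) j := by
          apply Finset.sum_lt_sum
          · intro j _; rw [hπν]; exact (hle _ _ (hall j)).1
          · by_contra hcon
            push Not at hcon
            apply hρ
            ext1 j
            have h1 := hcon j (Finset.mem_univ j)
            rw [hπν] at h1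
            have h2 := (hle _ _ (hall j)).2 (le_antisymm (hle _ _ (hall j)).1 h1)
            simp only [π, Equiv.subRight_apply, ← h2]
            abel
        rw [← hsum, ← hsum] at hlt
        have h3 := lt_of_mul_lt_mul_left hlt (by positivity)
        exact_mod_cast h3
      · push Not at hall
        obtain ⟨j, hj⟩ := hall
        rw [Finset.prod_eq_zero (f := fun i => B (ρ i) i) (Finset.mem_univ j) hj, Polynomial.coeff_zero, mul_zero]
    · simp
  intro h
  rw [h, Polynomial.coeff_zero] at hco
  exact hco rfl
end
section
variable {F L : Type} [Field F] [Field L] [Algebra (Polynomial F) L] [IsFractionRing (Polynomial F) L] {e : ℕ}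
noncomputable def tw (F : Type) [Field F] {e : ℕ} (j : Fin (e+1)) : Polynomial F := if j = Fin.last e then Polynomial.X else 1
lemma tw_ne (j : Fin (e+1)) : tw F j ≠ 0 := by
  unfold tw; split_ifs; exact Polynomial.X_ne_zero; exact one_ne_zero
lemma tw_deg (j : Fin (e+1)) : (tw F j).natDegree = if j = Fin.last e then 1 else 0 := by
  unfold tw; split_ifs <;> simp
noncomputable def UU (F L : Type) [Field F] [Field L] [Algebra (Polynomial F) L] (e : ℕ) : Matrix (Fin (e+1)) (Fin (e+1)) L :=
  Matrix.of fun j k => if k = j + 1 then algebraMap (Polynomial F) L (tw F j) else 0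
lemma UU_mul (A : Matrix (Fin (e+1)) (Fin (e+1)) L) (j k : Fin (e+1)) :
    (UU F L e * A) j k = algebraMap (Polynomial F) L (tw F j) * A (j+1) k := by
  simp [UU, mul_apply]
lemma mul_UU (A : Matrix (Fin (e+1)) (Fin (e+1)) L) (j k : Fin (e+1)) :
    (A * UU F L e) j (k+1) = A j k * algebraMap (Polynomial F) L (tw F k) := by
  simp [UU, mul_apply]
noncomputable def DD (F : Type) [Field F] [Algebra (Polynomial F) L] (s : L ≃+* L) (e : ℕ) : Subring (Matrix (Fin (e+1)) (Fin (e+1)) L) where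
  carrier := {A | UU F L e * s.toRingHom.mapMatrix A = A * UU F L e}
  mul_mem' := by
    intro a b ha hb
    simp only [Set.mem_setOf_eq] at *
    rw [map_mul, ← mul_assoc, ha, mul_assoc, hb, mul_assoc]
  one_mem' := by simp
  add_mem' := by
    intro a b ha hb
    simp only [Set.mem_setOf_eq] at *
    rw [map_add, mul_add, ha, hb, add_mul]
  zero_mem' := by simp
  neg_mem' := by
    intro a ha
    simp only [Set.mem_setOf_eq] at *
    rw [map_neg, mul_neg, ha, neg_mul]
lemma mem_DD (s : L ≃+* L) (A : Matrix (Fin (e+1)) (Fin (e+1)) L) : A ∈ DD F s e ↔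
    ∀ j k, algebraMap (Polynomial F) L (tw F j) * s (A (j+1) (k+1)) = A j k * algebraMap (Polynomial F) L (tw F k) := by
  constructor
  · intro h j k
    have h' : UU F L e * s.toRingHom.mapMatrix A = A * UU F L e := h
    have := congrFun (congrFun h' j) (k+1)
    rwa [UU_mul, mul_UU] at this
  · intro h
    show UU F L e * s.toRingHom.mapMatrix A = A * UU F L e
    ext j k
    have := h j (k-1)
    rw [show k = (k - 1) + 1 by abel, UU_mul, mul_UU, ← this]
    simp
lemma DD_det (σ : F ≃+* F) (s : L ≃+* L) (hs : ∀ p : Polynomial F, s (algebraMap _ L p) = algebraMap _ L (p.map σ.toRingHom))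
    (A : Matrix (Fin (e+1)) (Fin (e+1)) L) (hA : A ∈ DD F s e) (h0 : A ≠ 0) : A.det ≠ 0 := by
  obtain ⟨⟨q, hq⟩, hq'⟩ := IsLocalization.exist_integer_multiples_of_finite (nonZeroDivisors (Polynomial F))
    (fun x : Fin (e+1) × Fin (e+1) => A x.1 x.2)
  have hq0 : q ≠ 0 := nonZeroDivisors.ne_zero hq
  choose B' hB' using hq'
  let B : Matrix (Fin (e+1)) (Fin (e+1)) (Polynomial F) := Matrix.of fun j k => B' (j, k)
  have hB : ∀ j k, algebraMap (Polynomial F) L (B j k) = algebraMap _ L q * A j k := by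
    intro j k
    rw [← Algebra.smul_def]; exact hB' (j, k)
  have hinj : Function.Injective (algebraMap (Polynomial F) L) := IsFractionRing.injective _ _
  have hqL : algebraMap (Polynomial F) L q ≠ 0 := by rwa [Ne, map_eq_zero_iff _ hinj]
  rw [mem_DD] at hA
  have rel : ∀ j k, tw F j * q * (B (j+1) (k+1)).map σ.toRingHom = q.map σ.toRingHom * B j k * tw F k := by
    intro j k
    apply hinj
    rw [map_mul, map_mul, map_mul, map_mul, ← hs, ← hs, hB, hB, map_mul]
    linear_combination (algebraMap (Polynomial F) L q) * s (algebraMap (Polynomial F) L q) * hA j k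
  have hσ : Function.Injective σ.toRingHom := σ.injective
  have hqσ : q.map σ.toRingHom ≠ 0 := (Polynomial.map_ne_zero_iff hσ).mpr hq0
  have hz : ∀ j k, B j k = 0 ↔ B (j+1) (k+1) = 0 := by
    intro j k
    have h1 := rel j k
    constructor
    · intro h
      rw [h] at h1
      simp only [mul_zero, zero_mul, mul_eq_zero, tw_ne, hq0, false_or] at h1
      exact (Polynomial.map_eq_zero_iff hσ).mp h1
    · intro h
      rw [h] at h1
      simp only [Polynomial.map_zero, mul_zero] at h1
      have := h1.symm
      simpa only [mul_eq_zero, tw_ne, hqσ, false_or, or_false] using this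
  have hdet : B.det ≠ 0 := by
    apply cyc_det_ne B
    · intro h
      apply h0
      ext j k
      have := hB j k
      rw [h] at this
      simpa [hqL] using this
    · exact hz
    · intro j k h
      have h2 : B (j+1) (k+1) ≠ 0 := fun h' => h ((hz j k).mpr h')
      have h3 := congrArg Polynomial.natDegree (rel j k)
      rw [Polynomial.natDegree_mul (mul_ne_zero (tw_ne _) hq0) ((Polynomial.map_ne_zero_iff hσ).mpr h2), Polynomial.natDegree_mul (tw_ne _) hq0,
        Polynomial.natDegree_mul (mul_ne_zero hqσ h) (tw_ne _), Polynomial.natDegree_mul hqσ h, tw_deg, tw_deg,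
        Polynomial.natDegree_map_eq_of_injective hσ, Polynomial.natDegree_map_eq_of_injective hσ] at h3
      omega
  intro hA0
  apply hdet
  apply hinj
  rw [RingHom.map_det, map_zero]
  have : (algebraMap (Polynomial F) L).mapMatrix B = algebraMap (Polynomial F) L q • A := by
    ext j k; simp [hB]
  rw [this, det_smul, hA0, mul_zero]
lemma DD_inv (s : L ≃+* L) (A : Matrix (Fin (e+1)) (Fin (e+1)) L) (hA : A ∈ DD F s e) (hd : A.det ≠ 0) : A⁻¹ ∈ DD F s e := by
  have hu : IsUnit A.det := isUnit_iff_ne_zero.mpr hd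
  have hA' : UU F L e * s.toRingHom.mapMatrix A = A * UU F L e := hA
  show UU F L e * s.toRingHom.mapMatrix A⁻¹ = A⁻¹ * UU F L e
  calc UU F L e * s.toRingHom.mapMatrix A⁻¹ = A⁻¹ * (A * UU F L e) * s.toRingHom.mapMatrix A⁻¹ := by
        rw [Matrix.nonsing_inv_mul_cancel_left _ _ hu]
    _ = A⁻¹ * UU F L e * s.toRingHom.mapMatrix (A * A⁻¹) := by rw [← hA', map_mul]; simp only [Matrix.mul_assoc]
    _ = _ := by rw [Matrix.mul_nonsing_inv _ hu, map_one, mul_one]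
lemma UU_pow (c : ℕ) : ∃ u : Fin (e+1) → L, (∀ j, u j ≠ 0) ∧ ∀ j k, (UU F L e ^ c) j k = if k = j + Fin.ofNat (e+1) c then u j else 0 := by
  induction c with
  | zero => exact ⟨fun _ => 1, fun _ => one_ne_zero, fun j k => by simp [Matrix.one_apply, eq_comm, show Fin.ofNat (e+1) 0 = 0 from rfl]⟩
  | succ c ih =>
    obtain ⟨u, hu, h⟩ := ih
    refine ⟨fun j => algebraMap (Polynomial F) L (tw F j) * u (j+1), fun j => mul_ne_zero ?_ (hu _), fun j k => ?_⟩
    · rw [Ne, map_eq_zero_iff _ (IsFractionRing.injective _ _)]; exact tw_ne j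
    · rw [pow_succ', UU_mul, h, mul_ite, mul_zero]
      have : j + Fin.ofNat (e+1) (c+1) = j + 1 + Fin.ofNat (e+1) c := by
        rw [add_assoc]; congr 1
        apply Fin.ext; simp [Fin.val_add, Nat.add_mod, add_comm]
      rw [this]
lemma DD_span (s : L ≃+* L) (hX : s (algebraMap (Polynomial F) L (Polynomial.X : Polynomial F)) = algebraMap (Polynomial F) L Polynomial.X)
    (z : Fin (e+1) → L) (hz : Function.Injective z) (hsz : ∀ j, s (z (j+1)) = z j) :
    ∃ E : Fin (e+1) × Fin (e+1) → Matrix (Fin (e+1)) (Fin (e+1)) L, (∀ t, E t ∈ DD F s e) ∧ ∀ A, ∃ x : _ → L, A = ∑ t, x t • E t := by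
  refine ⟨fun t => diagonal z ^ (t.1 : ℕ) * UU F L e ^ (t.2 : ℕ), fun t => mul_mem (pow_mem ?_ _) (pow_mem ?_ _), fun A => ?_⟩
  · rw [mem_DD]
    intro j k
    by_cases h : j = k
    · subst h; simp [hsz, mul_comm]
    · have : j + 1 ≠ k + 1 := fun h' => h (by simpa using h')
      simp [diagonal_apply_ne _ h, diagonal_apply_ne _ this]
  · show UU F L e * s.toRingHom.mapMatrix (UU F L e) = UU F L e * UU F L e
    congr 1
    ext j k
    simp only [UU, RingHom.mapMatrix_apply, map_apply, of_apply]
    split_ifs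
    · unfold tw; split_ifs
      · exact hX
      · simp
    · simp
  · choose u hu hU using fun c : ℕ => UU_pow (F := F) (L := L) (e := e) c
    have hV : IsUnit (vandermonde z).det := isUnit_iff_ne_zero.mpr (det_vandermonde_ne_zero_iff.mpr hz)
    let y : Fin (e+1) → Fin (e+1) → L := fun c => (vandermonde z)⁻¹ *ᵥ (fun j => A j (j + c) / u c j)
    have hy : ∀ c j, ∑ i : Fin (e+1), z j ^ (i : ℕ) * y c i = A j (j + c) / u c j := by
      intro c j
      have : vandermonde z *ᵥ y c = fun j => A j (j + c) / u c j := by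
        simp only [y]
        rw [mulVec_mulVec, mul_nonsing_inv _ hV, one_mulVec]
      have := congrFun this j
      simpa [mulVec, dotProduct, vandermonde_apply] using this
    refine ⟨fun t => y t.2 t.1, ?_⟩
    ext j k
    rw [Matrix.sum_apply, Fintype.sum_prod_type_right]
    have h1 : ∀ c : Fin (e+1), ∑ i : Fin (e+1), (y c i • (diagonal z ^ (i : ℕ) * UU F L e ^ (c : ℕ))) j k =
        if k = j + c then A j (j + c) else 0 := by
      intro c
      simp only [Matrix.smul_apply, diagonal_pow, diagonal_mul, hU, smul_eq_mul, Pi.pow_apply, show Fin.ofNat (e+1) c.val = c from Fin.ext (Nat.mod_eq_of_lt c.2)]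
      split_ifs with h
      · rw [← mul_div_cancel₀ (A j (j + c)) (hu c j)]
        rw [← hy, Finset.mul_sum]
        exact Finset.sum_congr rfl fun i _ => by ring
      · simp
    simp only [h1]
    rw [Finset.sum_eq_single (k - j)]
    · simp
    · intro c _ hc
      rw [if_neg]
      rintro rfl
      exact hc (by simp)
    · simp
end
lemma exists_DD (k : Type) [Field k] (e : ℕ) : ∃ (L : Type) (_ : Field L) (f : k →+* L)
    (D : Subring (Matrix (Fin (e+1)) (Fin (e+1)) L)) (E : Fin (e+1) × Fin (e+1) → Matrix (Fin (e+1)) (Fin (e+1)) L),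
    (∀ A ∈ D, A ≠ 0 → A.det ≠ 0 ∧ A⁻¹ ∈ D) ∧ (∀ c, diagonal (fun _ => f c) ∈ D) ∧ (∀ t, E t ∈ D) ∧
    ∀ A, ∃ x : _ → L, A = ∑ t, x t • E t := by
  let R := MvPolynomial (Fin (e+1)) k
  let F := FractionRing R
  let L := FractionRing (Polynomial F)
  let ρ : R ≃ₐ[k] R := MvPolynomial.renameEquiv k (Equiv.subRight (1 : Fin (e+1)))
  let σ : F ≃+* F := IsFractionRing.ringEquivOfRingEquiv ρ.toRingEquiv
  let s : L ≃+* L := IsFractionRing.ringEquivOfRingEquiv (Polynomial.mapEquiv σ)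
  have hσ : ∀ r : R, σ (algebraMap R F r) = algebraMap R F (ρ r) := fun r => IsFractionRing.ringEquivOfRingEquiv_algebraMap _ _
  have hs : ∀ p : Polynomial F, s (algebraMap _ L p) = algebraMap _ L (p.map σ.toRingHom) := fun p =>
    IsFractionRing.ringEquivOfRingEquiv_algebraMap _ _
  have hinj : Function.Injective (algebraMap (Polynomial F) L) := IsFractionRing.injective _ _
  have hinj' : Function.Injective (algebraMap R F) := IsFractionRing.injective _ _
  let f : k →+* L := (algebraMap (Polynomial F) L).comp (Polynomial.C.comp ((algebraMap R F).comp (MvPolynomial.C)))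
  let z : Fin (e+1) → L := fun j => algebraMap (Polynomial F) L (Polynomial.C (algebraMap R F (X j)))
  obtain ⟨E, hE, hE'⟩ := DD_span (F := F) s (by rw [hs, Polynomial.map_X]) z
    (fun i j h => MvPolynomial.X_injective (hinj' (Polynomial.C_injective (hinj h))))
    (fun j => by
      simp only [z]
      rw [hs, Polynomial.map_C]
      show algebraMap _ L (Polynomial.C (σ _)) = _
      rw [hσ, show ρ (X (j+1)) = X j by
        show rename _ (X (j+1)) = _
        rw [rename_X]; simp])
  refine ⟨L, inferInstance, f, DD F s e, E, fun A hA h0 => ?_, fun c => ?_, hE, hE'⟩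
  · have := DD_det σ s hs A hA h0
    exact ⟨this, DD_inv s A hA this⟩
  · rw [mem_DD]
    have hc : s (f c) = f c := by
      simp only [f, RingHom.comp_apply]
      rw [hs, Polynomial.map_C]
      show algebraMap _ L (Polynomial.C (σ _)) = _
      rw [hσ, show ρ (C c) = C c from rename_C _ _]
    intro j k
    by_cases h : j = k
    · subst h; simp [hc, mul_comm]
    · have : j + 1 ≠ k + 1 := fun h' => h (by simpa using h')
      simp [diagonal_apply_ne _ h, diagonal_apply_ne _ this]
lemma div_fac {Δ : Type} [DivisionRing Δ] {n : ℕ} (Z : Matrix (Fin n) (Fin n) Δ) :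
    ∃ (r : ℕ) (P : Matrix (Fin r) (Fin n) Δ) (Q : Matrix (Fin n) (Fin r) Δ)
    (P' : Matrix (Fin n) (Fin r) Δ) (Q' : Matrix (Fin r) (Fin n) Δ), P * Z * Q = 1 ∧ Z = P' * Q' := by
  let f := Matrix.toLinearMapRight' (R := Δ) Z
  let r := Module.finrank Δ (LinearMap.range f)
  let eq : LinearMap.range f ≃ₗ[Δ] (Fin r → Δ) := LinearEquiv.ofFinrankEq _ _ (by simp [r])
  let h : (Fin n → Δ) →ₗ[Δ] (Fin r → Δ) := eq.toLinearMap.comp f.rangeRestrict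
  let g : (Fin r → Δ) →ₗ[Δ] (Fin n → Δ) := (LinearMap.range f).subtype.comp eq.symm.toLinearMap
  have hgh : g.comp h = f := by ext v; simp [g, h]
  have hh : Function.Surjective h := eq.surjective.comp f.surjective_rangeRestrict
  have hg : Function.Injective g := Subtype.val_injective.comp eq.symm.injective
  obtain ⟨s, hs⟩ := LinearMap.exists_rightInverse_of_surjective h (LinearMap.range_eq_top.mpr hh)
  obtain ⟨u, hu⟩ := LinearMap.exists_leftInverse_of_injective g (LinearMap.ker_eq_bot.mpr hg)
  have key : ∀ {a b : ℕ} (m : (Fin a → Δ) →ₗ[Δ] (Fin b → Δ)), ∃ A, Matrix.toLinearMapRight' (R := Δ) A = m :=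
    fun m => ⟨_, LinearEquiv.apply_symm_apply _ m⟩
  obtain ⟨P, hP⟩ := key s
  obtain ⟨Q, hQ⟩ := key u
  obtain ⟨P', hP'⟩ := key h
  obtain ⟨Q', hQ'⟩ := key g
  refine ⟨r, P, Q, P', Q', ?_, ?_⟩
  · apply (Matrix.toLinearMapRight' (R := Δ)).injective
    rw [toLinearMapRight'_mul, toLinearMapRight'_mul, hP, hQ, toLinearMapRight'_one]
    show u.comp (f.comp s) = _
    rw [← hgh, LinearMap.comp_assoc, hs, LinearMap.comp_id, hu]
  · apply (Matrix.toLinearMapRight' (R := Δ)).injective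
    rw [toLinearMapRight'_mul, hP', hQ', hgh]
def flat {L : Type} {d a b : ℕ} (Z : Matrix (Fin a) (Fin b) (Matrix (Fin d) (Fin d) L)) : Matrix (Fin d × Fin a) (Fin d × Fin b) L :=
  Matrix.of fun x y => Z x.2 y.2 x.1 y.1
lemma flat_mul {L : Type} [Field L] {d a b c : ℕ} (Z : Matrix (Fin a) (Fin b) (Matrix (Fin d) (Fin d) L))
    (W : Matrix (Fin b) (Fin c) (Matrix (Fin d) (Fin d) L)) : flat (Z * W) = flat Z * flat W := by
  ext x y
  simp only [flat, of_apply, mul_apply, Matrix.sum_apply, Fintype.sum_prod_type]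
  rw [Finset.sum_comm]
lemma flat_one {L : Type} [Field L] {d a : ℕ} : flat (1 : Matrix (Fin a) (Fin a) (Matrix (Fin d) (Fin d) L)) = 1 := by
  ext x y
  obtain ⟨i, a⟩ := x
  obtain ⟨j, b⟩ := y
  simp only [flat, of_apply, Matrix.one_apply, Prod.mk.injEq]
  by_cases h : a = b <;> by_cases h' : i = j <;> simp [h, h', Matrix.one_apply]
lemma rank_flat {L : Type} [Field L] {d n : ℕ} [NeZero d] (D : Subring (Matrix (Fin d) (Fin d) L))
    (hD : ∀ A ∈ D, A ≠ 0 → A.det ≠ 0 ∧ A⁻¹ ∈ D) (Z : Matrix (Fin n) (Fin n) (Matrix (Fin d) (Fin d) L))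
    (hZ : ∀ i j, Z i j ∈ D) : ∃ r, (flat Z).rank = r * d := by
  letI : DivisionRing D := DivisionRing.ofIsUnitOrEqZero (fun ⟨A, hA⟩ => by
    by_cases h : A = 0
    · right; exact Subtype.ext h
    · left
      have h1 := hD A hA h
      have hu := isUnit_iff_ne_zero.mpr h1.1
      exact ⟨⟨⟨A, hA⟩, ⟨A⁻¹, h1.2⟩, Subtype.ext (mul_nonsing_inv _ hu), Subtype.ext (nonsing_inv_mul _ hu)⟩, rfl⟩)
  obtain ⟨r, P, Q, P', Q', h1, h2⟩ := div_fac (Δ := D) (Matrix.of fun i j => (⟨Z i j, hZ i j⟩ : D))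
  let φ : D →+* Matrix (Fin d) (Fin d) L := D.subtype
  have hZ' : (Matrix.of fun i j => (⟨Z i j, hZ i j⟩ : D)).map φ = Z := by ext; rfl
  have h1' := congrArg (fun A => flat (A.map φ)) h1
  have h2' := congrArg (fun A => flat (A.map φ)) h2
  simp only [Matrix.map_mul, hZ', flat_mul, Matrix.map_one _ (map_zero φ) (map_one φ), flat_one] at h1' h2'
  refine ⟨r, le_antisymm ?_ ?_⟩
  · rw [h2']
    exact (rank_mul_le_left _ _).trans ((rank_le_card_width _).trans (by simp [mul_comm]))
  · have := rank_ge_of_PQ (flat Z) (flat (P.map φ)) (flat (Q.map φ)) (by rw [h1', det_one]; exact one_ne_zero)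
    simpa [mul_comm] using this
section
variable {k : Type} [Field k] [Infinite k] {M n : ℕ}
theorem A1 (Y : Fin M → Matrix (Fin n) (Fin n) k) {d : ℕ} (hd : 0 < d) (T : Fin M → Matrix (Fin d) (Fin d) k) (s : ℕ)
    (h : s * d < (big T Y).rank) : ∃ T' : Fin M → Matrix (Fin d) (Fin d) k, (s + 1) * d ≤ (big T' Y).rank := by
  obtain ⟨e, rfl⟩ : ∃ e, d = e + 1 := ⟨d - 1, by omega⟩
  obtain ⟨L, _, f, D, E, hD, hc, hE, hspan⟩ := exists_DD k e
  choose x hx using fun l => hspan ((T l).map f)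
  let G : Fin M × (Fin (e+1) × Fin (e+1)) → Matrix (Fin (e+1) × Fin n) (Fin (e+1) × Fin n) L :=
    fun t => kroneckerMap (· * ·) (E t.2) ((Y t.1).map f)
  have h1 : (big T Y).map f = ∑ t, x t.1 t.2 • G t := by
    rw [big_map]
    simp only [hx]
    ext a b
    simp only [big_apply, Matrix.sum_apply, Matrix.smul_apply, Fintype.sum_prod_type (f := fun t : Fin M × (Fin (e+1) × Fin (e+1)) => _), G,
      kroneckerMap_apply, smul_eq_mul, Finset.sum_mul, mul_assoc]
  have h2 : s * (e+1) + 1 ≤ (∑ t, x t.1 t.2 • G t).rank := by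
    rw [← h1, ← rank_map_le]; exact h
  obtain ⟨y, hy⟩ := transfer_rank f G (fun t => x t.1 t.2) _ h2
  let Z : Matrix (Fin n) (Fin n) (Matrix (Fin (e+1)) (Fin (e+1)) L) := Matrix.of fun a b =>
    ∑ t : Fin M × (Fin (e+1) × Fin (e+1)), diagonal (fun _ => f (y t * Y t.1 a b)) * E t.2
  have hZ : ∀ a b, Z a b ∈ D := fun a b => sum_mem fun t _ => mul_mem (hc _) (hE _)
  have hZf : ∑ t, f (y t) • G t = flat Z := by
    ext a b
    simp only [flat, Z, G, of_apply, Matrix.sum_apply, Matrix.smul_apply, kroneckerMap_apply, diagonal_mul, map_mul, map_apply, smul_eq_mul]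
    exact Finset.sum_congr rfl fun t _ => by ring
  obtain ⟨r, hr⟩ := rank_flat D hD Z hZ
  rw [hZf, hr] at hy
  have hrs : s + 1 ≤ r := by
    by_contra hcon
    have : r ≤ s := by omega
    have := Nat.mul_le_mul_right (e+1) this
    omega
  have h3 : (s + 1) * (e+1) ≤ (flat Z).rank := by rw [hr]; exact Nat.mul_le_mul_right _ hrs
  let H : Fin M × (Fin (e+1) × Fin (e+1)) → Matrix (Fin (e+1) × Fin n) (Fin (e+1) × Fin n) L :=
    fun t => kroneckerMap (· * ·) (Matrix.single t.2.1 t.2.2 1) ((Y t.1).map f)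
  let w : Fin M × (Fin (e+1) × Fin (e+1)) → L := fun t => ∑ q, f (y (t.1, q)) * E q t.2.1 t.2.2
  have key : ∀ v : Fin M × (Fin (e+1) × Fin (e+1)) → L, ∑ t, v t • H t =
      big (fun l => Matrix.of fun i j => v (l, (i, j))) (fun l => (Y l).map f) := by
    intro v
    ext a b
    simp only [big_apply, Matrix.sum_apply, Matrix.smul_apply, H, kroneckerMap_apply, smul_eq_mul, of_apply]
    rw [Fintype.sum_prod_type]
    refine Finset.sum_congr rfl fun l _ => ?_
    rw [Finset.sum_eq_single (a.1, b.1)]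
    · simp
    · rintro ⟨i, j⟩ _ hij
      rw [Matrix.single_apply, if_neg, zero_mul, mul_zero]
      rintro ⟨rfl, rfl⟩; exact hij rfl
    · simp
  have h4 : flat Z = ∑ t, w t • H t := by
    rw [key, ← hZf]
    ext a b
    simp only [big_apply, Matrix.sum_apply, Matrix.smul_apply, G, w, kroneckerMap_apply, smul_eq_mul, of_apply]
    rw [Fintype.sum_prod_type]
    refine Finset.sum_congr rfl fun l _ => ?_
    rw [Finset.sum_mul]
    exact Finset.sum_congr rfl fun q _ => by ring
  rw [h4] at h3
  obtain ⟨v, hv⟩ := transfer_rank f H w _ h3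
  refine ⟨fun l => Matrix.of fun i j => v (l, (i, j)), hv.trans ?_⟩
  rw [rank_map_le f, big_map, key]
  exact le_of_eq rfl
end
section
variable {k : Type} [Field k] {M n : ℕ}
lemma big_mulVec {ι : Type} [Fintype ι] [DecidableEq ι] (T : Fin M → Matrix ι ι k) (Y : Fin M → Matrix (Fin n) (Fin n) k)
    (v : ι × Fin n → k) (p : ι × Fin n) :
    (big T Y *ᵥ v) p = ∑ j, ∑ b, (∑ l, T l p.1 j * Y l p.2 b) * v (j, b) := by
  simp only [mulVec, dotProduct, big_apply, Fintype.sum_prod_type]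
lemma rank_null {ι : Type} [Fintype ι] [DecidableEq ι] (A : Matrix ι ι k) :
    A.rank + Module.finrank k (LinearMap.ker A.mulVecLin) = Fintype.card ι := by
  have := LinearMap.finrank_range_add_finrank_ker A.mulVecLin
  simpa [Matrix.rank] using this
def Good {ι : Type} (Y : Fin M → Matrix (Fin n) (Fin n) k) (s : ℕ) (u : ι × Fin n → k) : Prop :=
  ∃ (ι' : Type) (_ : Fintype ι') (_ : DecidableEq ι') (T' : Fin M → Matrix ι' ι' k) (em : ι → ι') (y : ι' × Fin n → k),
    big T' Y *ᵥ y = 0 ∧ (∀ i a, y (em i, a) = u (i, a)) ∧ s * Fintype.card ι' ≤ (big T' Y).rank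
lemma Good_step {ι : Type} [Fintype ι] [DecidableEq ι] (Y : Fin M → Matrix (Fin n) (Fin n) k) (s : ℕ)
    (hmax : ∀ (ι' : Type) [Fintype ι'] [DecidableEq ι'] (T' : Fin M → Matrix ι' ι' k), (big T' Y).rank ≤ s * Fintype.card ι')
    (T : Fin M → Matrix ι ι k) (hT : (big T Y).rank = s * Fintype.card ι) (u : ι × Fin n → k) (hu : Good Y s u)
    (S : Fin M → Matrix ι ι k) : (∃ v, big T Y *ᵥ v = big S Y *ᵥ u) ∧
      ∀ v, big T Y *ᵥ v = - (big S Y *ᵥ u) → Good Y s v := by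
  classical
  obtain ⟨ι', _, _, T', em, y, hy, hyu, hr⟩ := hu
  let T2 : Fin M → Matrix (ι' ⊕ ι) (ι' ⊕ ι) k := fun l =>
    fromBlocks (T' l) 0 (S l * (Matrix.of fun j j' => if em j = j' then 1 else 0 : Matrix ι ι' k)) (T l)
  have f1 : ∀ v p, (big T2 Y *ᵥ v) (Sum.inl p.1, p.2) = (big T' Y *ᵥ fun q => v (Sum.inl q.1, q.2)) p := by
    intro v p
    rw [big_mulVec, big_mulVec, Fintype.sum_sum_type]
    simp [T2]
  have f2 : ∀ v p, (big T2 Y *ᵥ v) (Sum.inr p.1, p.2) = (big S Y *ᵥ fun q => v (Sum.inl (em q.1), q.2)) p +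
      (big T Y *ᵥ fun q => v (Sum.inr q.1, q.2)) p := by
    intro v p
    rw [big_mulVec, big_mulVec, big_mulVec, Fintype.sum_sum_type]
    congr 1
    simp only [T2, fromBlocks_apply₂₁, mul_apply, of_apply, mul_ite, mul_one, mul_zero]
    have : ∀ (j' : ι') (b : Fin n), (∑ l, (∑ j, if em j = j' then S l p.1 j else 0) * Y l p.2 b) * v (Sum.inl j', b)
        = ∑ j, if em j = j' then (∑ l, S l p.1 j * Y l p.2 b) * v (Sum.inl (em j), b) else 0 := by
      intro j' b
      simp only [Finset.sum_mul]
      rw [Finset.sum_comm]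
      refine Finset.sum_congr rfl fun j _ => ?_
      split_ifs with h
      · rw [h]
      · simp
    simp only [this]
    rw [Finset.sum_comm]
    rw [Finset.sum_comm (s := Finset.univ (α := ι)) (t := Finset.univ (α := Fin n))]
    refine Finset.sum_congr rfl fun b _ => ?_
    rw [Finset.sum_comm]
    refine Finset.sum_congr rfl fun j _ => ?_
    simp
  let K2 := LinearMap.ker (big T2 Y).mulVecLin
  let K1 := LinearMap.ker (big T' Y).mulVecLin
  let K0 := LinearMap.ker (big T Y).mulVecLin
  let p : K2 →ₗ[k] (ι' × Fin n → k) := (LinearMap.funLeft k k (fun q : ι' × Fin n => ((Sum.inl q.1, q.2) : (ι' ⊕ ι) × Fin n))).comp K2.subtype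
  have hK2 : ∀ v, v ∈ K2 ↔ big T2 Y *ᵥ v = 0 := fun v => by simp [K2]
  have hp : LinearMap.range p ≤ K1 := by
    rintro _ ⟨⟨v, hv⟩, rfl⟩
    rw [hK2] at hv
    rw [LinearMap.mem_ker, mulVecLin_apply]
    funext q
    have := f1 v q
    rw [hv] at this
    exact this.symm
  let q : LinearMap.ker p →ₗ[k] (ι × Fin n → k) := (LinearMap.funLeft k k (fun q : ι × Fin n => ((Sum.inr q.1, q.2) : (ι' ⊕ ι) × Fin n))).comp (K2.subtype.comp (LinearMap.ker p).subtype)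
  have hinl : ∀ x : LinearMap.ker p, ∀ i a, x.1.1 (Sum.inl i, a) = 0 := by
    intro x i a
    exact congrFun (LinearMap.mem_ker.mp x.2) (i, a)
  have hq0 : ∀ x, q x ∈ K0 := by
    intro x
    rw [LinearMap.mem_ker, mulVecLin_apply]
    funext r
    have := f2 x.1.1 r
    rw [(hK2 _).mp x.1.2] at this
    simp only [hinl] at this
    rw [show (fun q : ι × Fin n => (0 : k)) = 0 from rfl, mulVec_zero, Pi.zero_apply, Pi.zero_apply, zero_add] at this
    exact this.symm
  have hqi : Function.Injective q := by
    intro x x' h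
    apply Subtype.ext; apply Subtype.ext
    funext ⟨i, a⟩
    rcases i with i | i
    · rw [hinl, hinl]
    · exact congrFun h (i, a)
  have d0 : Module.finrank k (LinearMap.ker p) ≤ Module.finrank k K0 :=
    LinearMap.finrank_le_finrank_of_injective (f := q.codRestrict K0 hq0) (fun x x' h => hqi (congrArg Subtype.val h))
  have d1 := LinearMap.finrank_range_add_finrank_ker p
  have r2 := rank_null (big T2 Y)
  have r1 := rank_null (big T' Y)
  have r0 := rank_null (big T Y)
  have d2 := Submodule.finrank_mono hp
  have m2 := hmax _ T2
  have m1 := hmax _ T'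
  simp only [Fintype.card_prod, Fintype.card_sum, Fintype.card_fin, add_mul, mul_add] at r2 r1 r0 m2
  have hyK1 : y ∈ K1 := by rw [LinearMap.mem_ker, mulVecLin_apply, hy]
  refine ⟨?_, ?_⟩
  · have hmem : y ∈ LinearMap.range p := by
      by_contra hcon
      have : LinearMap.range p < K1 := lt_of_le_of_ne hp (fun h => hcon (h ▸ hyK1))
      have := Submodule.finrank_lt_finrank_of_lt this
      simp only [K2, K1, K0] at *
      omega
    obtain ⟨⟨v, hv⟩, hvy⟩ := hmem
    rw [hK2] at hv
    refine ⟨fun q => - v (Sum.inr q.1, q.2), ?_⟩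
    funext r
    have h3 := f2 v r
    rw [hv] at h3
    have h4 : (fun q : ι × Fin n => v (Sum.inl (em q.1), q.2)) = u := by
      funext q
      rw [← hyu, ← hvy]; rfl
    rw [h4] at h3
    have h5 : (fun q : ι × Fin n => - v (Sum.inr q.1, q.2)) = - fun q : ι × Fin n => v (Sum.inr q.1, q.2) := rfl
    rw [h5, mulVec_neg, Pi.neg_apply]
    rw [Pi.zero_apply] at h3
    linear_combination h3
  · intro v hv
    refine ⟨ι' ⊕ ι, inferInstance, inferInstance, T2, Sum.inr, fun q => Sum.elim (fun i => y (i, q.2)) (fun i => v (i, q.2)) q.1, ?_, fun i a => rfl, ?_⟩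
    · funext ⟨i, a⟩
      rcases i with i | i
      · have := f1 (fun q => Sum.elim (fun i => y (i, q.2)) (fun i => v (i, q.2)) q.1) (i, a)
        rw [this]
        exact congrFun hy (i, a)
      · have := f2 (fun q => Sum.elim (fun i => y (i, q.2)) (fun i => v (i, q.2)) q.1) (i, a)
        rw [this]
        have h4 : (fun q : ι × Fin n => Sum.elim (fun i => y (i, q.2)) (fun i => v (i, q.2)) (Sum.inl (em q.1) : ι' ⊕ ι)) = u := by
          funext q; exact hyu _ _
        have h5 : (fun q : ι × Fin n => Sum.elim (fun i => y (i, q.2)) (fun i => v (i, q.2)) (Sum.inr q.1 : ι' ⊕ ι)) = v := rfl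
        rw [h4, h5, hv]
        simp
    · simp only [Fintype.card_sum, mul_add]
      simp only [K2, K1, K0] at *
      omega
theorem A3 {ι : Type} [Fintype ι] [DecidableEq ι] [Nonempty ι] (Y : Fin M → Matrix (Fin n) (Fin n) k) (s : ℕ) (hs : s < n)
    (hmax : ∀ (ι' : Type) [Fintype ι'] [DecidableEq ι'] (T' : Fin M → Matrix ι' ι' k), (big T' Y).rank ≤ s * Fintype.card ι')
    (T : Fin M → Matrix ι ι k) (hT : (big T Y).rank = s * Fintype.card ι) :
    ∃ U W : Submodule k (Fin n → k), (∀ l, ∀ u ∈ U, Y l *ᵥ u ∈ W) ∧ Module.finrank k W < Module.finrank k U := by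
  classical
  let U : Submodule k (ι × Fin n → k) := Submodule.span k {u | Good Y s u}
  let W : Submodule k (ι × Fin n → k) := Submodule.span k {w | ∃ u S, Good Y s u ∧ w = big S Y *ᵥ u}
  have hker : LinearMap.ker (big T Y).mulVecLin ≤ U := by
    intro x hx
    exact Submodule.subset_span ⟨ι, inferInstance, inferInstance, T, id, x, hx, fun _ _ => rfl, hT.ge⟩
  have hW : W ≤ U.map (big T Y).mulVecLin := by
    rw [Submodule.span_le]
    rintro _ ⟨u, S, hu, rfl⟩
    obtain ⟨h1, h2⟩ := Good_step Y s hmax T hT u hu S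
    obtain ⟨v, hv⟩ := h1
    have h3 := h2 (-v) (by rw [mulVec_neg, hv])
    refine ⟨v, ?_, hv⟩
    have := U.neg_mem (Submodule.subset_span h3)
    rwa [neg_neg] at this
  have hdim : Module.finrank k W < Module.finrank k U := by
    have h1 := Submodule.finrank_mono hW
    have h2 := LinearMap.finrank_range_add_finrank_ker ((big T Y).mulVecLin.domRestrict U)
    rw [LinearMap.range_domRestrict] at h2
    have h3 : Module.finrank k (LinearMap.ker (big T Y).mulVecLin) ≤ Module.finrank k (LinearMap.ker ((big T Y).mulVecLin.domRestrict U)) :=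
      LinearMap.finrank_le_finrank_of_injective
        (f := ((Submodule.inclusion hker).codRestrict (LinearMap.ker ((big T Y).mulVecLin.domRestrict U)) (fun x => x.2)))
        (fun x x' h => Subtype.ext (congrArg (fun z => z.1.1) h))
    have h4 := rank_null (big T Y)
    rw [hT, Fintype.card_prod, Fintype.card_fin] at h4
    have h5 : s * Fintype.card ι < Fintype.card ι * n := by
      rw [mul_comm]; exact Nat.mul_lt_mul_of_pos_left hs Fintype.card_pos
    omega
  let emb : ι → (Fin n → k) →ₗ[k] (ι × Fin n → k) := fun i =>
    { toFun := fun w q => if q.1 = i then w q.2 else 0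
      map_add' := fun x y => by funext q; by_cases h : q.1 = i <;> simp [h]
      map_smul' := fun c x => by funext q; by_cases h : q.1 = i <;> simp [h] }
  let W' : Submodule k (Fin n → k) := ⨅ i, W.comap (emb i)
  let U' : Submodule k (Fin n → k) := ⨅ l, W'.comap (Y l).mulVecLin
  refine ⟨U', W', fun l u hu => (Submodule.mem_iInf _).mp hu l, ?_⟩
  have hU' : ∀ x ∈ U, ∀ j, (fun a => x (j, a)) ∈ U' := by
    intro x hx j
    have : U ≤ U'.comap (LinearMap.funLeft k k (fun a => (j, a))) := by
      rw [Submodule.span_le]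
      intro u hu
      show (fun a => u (j, a)) ∈ U'
      rw [Submodule.mem_iInf]; intro l
      show Y l *ᵥ (fun a => u (j, a)) ∈ W'
      rw [Submodule.mem_iInf]; intro i
      refine Submodule.subset_span ⟨u, fun l' => if l' = l then Matrix.single i j 1 else 0, hu, ?_⟩
      funext q
      rw [big_mulVec]
      have : ∀ (j' : ι) (b : Fin n), (∑ l', (if l' = l then Matrix.single i j (1:k) else 0) q.1 j' * Y l' q.2 b) =
          if q.1 = i ∧ j' = j then Y l q.2 b else 0 := by
        intro j' b
        rw [Finset.sum_eq_single l]
        · by_cases h : q.1 = i <;> by_cases h' : j' = j <;> simp only [if_true, Matrix.single_apply, h, h'] <;> grind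
        · intro l' _ h; simp [h]
        · simp
      simp only [this]
      show (if q.1 = i then _ else _) = _
      split_ifs with h
      · rw [Finset.sum_eq_single j]
        · simp [h, mulVec, dotProduct]
        · intro j' _ h'; simp [h']
        · simp
      · simp [h]
    exact this hx
  have c1 : Module.finrank k U ≤ Fintype.card ι * Module.finrank k U' := by
    let g : U →ₗ[k] (ι → U') := LinearMap.pi fun j => (((LinearMap.funLeft k k (fun a => (j, a))).comp U.subtype).codRestrict U' (fun x => hU' x.1 x.2 j))
    have := LinearMap.finrank_le_finrank_of_injective (f := g) (fun x x' h => by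
      apply Subtype.ext; funext ⟨j, a⟩
      exact congrFun (congrArg Subtype.val (congrFun h j)) a)
    rwa [Module.finrank_pi_fintype, Finset.sum_const, smul_eq_mul, Finset.card_univ] at this
  have c2 : Fintype.card ι * Module.finrank k W' ≤ Module.finrank k W := by
    let g0 : (ι → W') →ₗ[k] (ι × Fin n → k) :=
      ∑ i, (emb i).comp (W'.subtype.comp (LinearMap.proj i))
    have hg0 : ∀ x q, g0 x q = (x q.1).1 q.2 := by
      intro x q
      simp only [g0, LinearMap.sum_apply, Finset.sum_apply]
      rw [Finset.sum_eq_single q.1]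
      · show (if q.1 = q.1 then _ else _) = _
        rw [if_pos rfl]; rfl
      · intro i _ h
        show (if q.1 = i then _ else _) = _
        rw [if_neg (Ne.symm h)]
      · simp
    have hg : ∀ x, g0 x ∈ W := by
      intro x
      simp only [g0, LinearMap.sum_apply]
      exact sum_mem fun i _ => (Submodule.mem_iInf _).mp (x i).2 i
    have := LinearMap.finrank_le_finrank_of_injective (f := g0.codRestrict W hg) (fun x x' h => by
      funext i; apply Subtype.ext; funext a
      have := congrFun (congrArg Subtype.val h) (i, a)
      simpa only [LinearMap.codRestrict_apply, hg0] using this)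
    rwa [Module.finrank_pi_fintype, Finset.sum_const, smul_eq_mul, Finset.card_univ] at this
  exact Nat.lt_of_mul_lt_mul_left (c2.trans_lt (hdim.trans_le c1))
end
section
variable {k : Type} [Field k] {M n : ℕ}
lemma A2 (hn : 0 < n) {d : ℕ} (Y : Fin M → Matrix (Fin n) (Fin n) k) (T : Fin M → Matrix (Fin (d+1)) (Fin (d+1)) k)
    (h : (big T Y).det ≠ 0) : ∃ T' : Fin M → Matrix (Fin d) (Fin d) k, n * d + 1 ≤ (big T' Y).rank + n := by
  classical
  let N := big T Y
  let R : (Fin (d+1) × Fin n → k) →ₗ[k] (Fin d × Fin n → k) :=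
    (LinearMap.funLeft k k (fun q : Fin d × Fin n => (q.1.succ, q.2))).comp N.mulVecLin
  have hR : ∀ v q, R v q = (N *ᵥ v) (q.1.succ, q.2) := fun v q => rfl
  have hsurj : LinearMap.range R = ⊤ := by
    rw [LinearMap.range_eq_top]
    intro w
    refine ⟨N⁻¹ *ᵥ (fun p => Fin.cons (α := fun _ => k) 0 (fun i => w (i, p.2)) p.1), ?_⟩
    funext q
    rw [hR, mulVec_mulVec, Matrix.mul_nonsing_inv _ (Ne.isUnit h), one_mulVec]
    simp
  have hd := LinearMap.finrank_range_add_finrank_ker R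
  rw [hsurj, finrank_top] at hd
  simp only [Module.finrank_fintype_fun_eq_card, Fintype.card_prod, Fintype.card_fin, add_mul, one_mul, add_right_inj] at hd
  have hne : LinearMap.ker R ≠ ⊥ := by
    intro h0; rw [h0, finrank_bot] at hd; omega
  obtain ⟨v, hv, hv0⟩ := Submodule.exists_mem_ne_zero_of_ne_bot hne
  obtain ⟨⟨j, a⟩, hja⟩ := Function.ne_iff.mp hv0
  let T' : Fin M → Matrix (Fin d) (Fin d) k := fun l => (T l).submatrix Fin.succ j.succAbove
  let e : (Fin d × Fin n → k) →ₗ[k] (Fin (d+1) × Fin n → k) :=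
    { toFun := fun v p => Fin.insertNth (α := fun _ => k) j 0 (fun i => v (i, p.2)) p.1
      map_add' := fun x y => by
        funext ⟨i, a⟩
        rcases Fin.eq_self_or_eq_succAbove j i with rfl | ⟨i, rfl⟩ <;> simp
      map_smul' := fun c x => by
        funext ⟨i, a⟩
        rcases Fin.eq_self_or_eq_succAbove j i with rfl | ⟨i, rfl⟩ <;> simp }
  have e1 : ∀ x a, e x (j, a) = 0 := fun x a => by simp [e]
  have e2 : ∀ x i a, e x (j.succAbove i, a) = x (i, a) := fun x i a => by simp [e]
  have hei : Function.Injective e := by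
    intro x y hxy; funext ⟨i, a⟩; rw [← e2 x, hxy, e2]
  let K' := LinearMap.ker (big T' Y).mulVecLin
  have hlt : K'.map e < LinearMap.ker R := by
    refine lt_of_le_of_ne ?_ ?_
    · rintro _ ⟨x, hx, rfl⟩
      rw [LinearMap.mem_ker]
      funext ⟨i, a⟩
      rw [hR, big_mulVec, Fin.sum_univ_succAbove _ j]
      simp only [e1, e2, mul_zero, Finset.sum_const_zero, zero_add]
      have := congrFun (show big T' Y *ᵥ x = 0 from hx) (i, a)
      rw [big_mulVec] at this
      exact this
    · intro heq
      rw [← heq] at hv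
      obtain ⟨x, _, hx⟩ := hv
      rw [← hx] at hja
      exact hja (e1 x a)
  have h1 := Submodule.finrank_lt_finrank_of_lt hlt
  rw [(Submodule.equivMapOfInjective e hei K').symm.finrank_eq] at h1
  have h2 := rank_null (big T' Y)
  simp only [Fintype.card_prod, Fintype.card_fin] at h2
  refine ⟨T', ?_⟩
  have : Module.finrank k K' = Module.finrank k (LinearMap.ker (big T' Y).mulVecLin) := rfl
  rw [mul_comm n d]
  omega
lemma det_of_rank {ι : Type} [Fintype ι] [DecidableEq ι] (A : Matrix ι ι k) (h : Fintype.card ι ≤ A.rank) : A.det ≠ 0 := by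
  have h1 := rank_null A
  have h2 : Module.finrank k (LinearMap.ker A.mulVecLin) = 0 := by omega
  rw [Submodule.finrank_eq_zero, LinearMap.ker_eq_bot] at h2
  exact (Matrix.isUnit_iff_isUnit_det A).mp (Matrix.mulVec_injective_iff_isUnit.mp h2) |>.ne_zero
lemma down [Infinite k] (hn : 0 < n) (Y : Fin M → Matrix (Fin n) (Fin n) k) (c : ℕ) : ∀ (T : Fin M → Matrix (Fin (n + c)) (Fin (n + c)) k)
    (h : (big T Y).det ≠ 0), ∃ T' : Fin M → Matrix (Fin n) (Fin n) k, (big T' Y).det ≠ 0 := by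
  induction c with
  | zero => exact fun T h => ⟨T, h⟩
  | succ c ih =>
    intro T h
    obtain ⟨T', h'⟩ := A2 hn (d := n + c) Y T h
    have h0 : (n - 1) * (n + c) + (n + c) = n * (n + c) := by
      obtain ⟨n', hn'⟩ : ∃ n', n = n' + 1 := ⟨n - 1, by omega⟩
      rw [hn']; simp; ring
    obtain ⟨T'', h''⟩ := A1 Y (by omega) T' (n - 1) (by omega)
    refine ih T'' (det_of_rank _ ?_)
    rw [show n - 1 + 1 = n by omega] at h''
    simpa [mul_comm] using h''
lemma adapted (U : Submodule k (Fin n → k)) : ∃ (b : Module.Basis (Fin n) k (Fin n → k)) (J : Finset (Fin n)),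
    J.card = Module.finrank k U ∧ (∀ j ∈ J, b j ∈ U) ∧ ∀ w ∈ U, ∀ i ∉ J, b.repr w i = 0 := by
  classical
  obtain ⟨U', hU'⟩ := U.exists_isCompl
  let b0 := (Module.finBasis k U).prod (Module.finBasis k U') |>.map (Submodule.prodEquivOfIsCompl U U' hU')
  have hc : Fintype.card (Fin (Module.finrank k U) ⊕ Fin (Module.finrank k U')) = n := by
    rw [← Module.finrank_eq_card_basis b0]; simp
  let e : Fin (Module.finrank k U) ⊕ Fin (Module.finrank k U') ≃ Fin n := Fintype.equivFinOfCardEq hc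
  refine ⟨b0.reindex e, Finset.univ.image (fun i => e (Sum.inl i)), ?_, ?_, ?_⟩
  · rw [Finset.card_image_of_injective _ (show Function.Injective (fun i => e (Sum.inl i)) from e.injective.comp Sum.inl_injective)]; simp
  · intro j hj
    obtain ⟨i, -, rfl⟩ := Finset.mem_image.mp hj
    simp [b0]
  · intro w hw i hi
    obtain ⟨i, rfl⟩ := e.surjective i
    rcases i with i | i
    · exact absurd (Finset.mem_image_of_mem _ (Finset.mem_univ i)) hi
    · have : (Submodule.prodEquivOfIsCompl U U' hU').symm w = (⟨w, hw⟩, 0) := by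
        rw [LinearEquiv.symm_apply_eq]; simp
      simp [b0, this]
theorem nullA [Infinite k] (hn : 0 < n) (Y : Fin M → Matrix (Fin n) (Fin n) k) :
    (∃ T : Fin M → Matrix (Fin n) (Fin n) k, (big T Y).det ≠ 0) ∨
    ∃ (P Q : Matrix (Fin n) (Fin n) k) (I J : Finset (Fin n)), P.det ≠ 0 ∧ Q.det ≠ 0 ∧ n < I.card + J.card ∧
      ∀ l, ∀ i ∈ I, ∀ j ∈ J, (P * Y l * Q) i j = 0 := by
  classical
  let p : ℕ → Prop := fun s => ∃ d, 0 < d ∧ ∃ T : Fin M → Matrix (Fin d) (Fin d) k, s * d ≤ (big T Y).rank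
  have p0 : p 0 := ⟨1, one_pos, fun _ => 0, by simp⟩
  have pb : ∀ s, p s → s ≤ n := by
    rintro s ⟨d, hd, T, h⟩
    have := h.trans (rank_le_card_width _)
    simp only [Fintype.card_prod, Fintype.card_fin] at this
    rw [mul_comm] at this
    exact Nat.le_of_mul_le_mul_left this hd
  let s := Nat.findGreatest p n
  have ps : p s := Nat.findGreatest_spec (Nat.zero_le n) p0
  have pm : ∀ t, p t → t ≤ s := fun t ht => Nat.le_findGreatest (pb t ht) ht
  have hmax0 : ∀ d (T : Fin M → Matrix (Fin d) (Fin d) k), (big T Y).rank ≤ s * d := by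
    intro d T
    rcases Nat.eq_zero_or_pos d with rfl | hd
    · exact (rank_le_card_width _).trans (by simp)
    · by_contra hc
      obtain ⟨T', h'⟩ := A1 Y hd T s (by omega)
      have := pm (s+1) ⟨d, hd, T', h'⟩
      omega
  obtain ⟨d, hd, T, hT⟩ := ps
  rcases (pb s ⟨d, hd, T, hT⟩).lt_or_eq with hs | hs
  · right
    have hmax : ∀ (ι' : Type) [Fintype ι'] [DecidableEq ι'] (T' : Fin M → Matrix ι' ι' k), (big T' Y).rank ≤ s * Fintype.card ι' := by
      intro ι' _ _ T'
      let e := Fintype.equivFin ι'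
      have := hmax0 _ (fun l => (T' l).submatrix e.symm e.symm)
      have h2 : big (fun l => (T' l).submatrix e.symm e.symm) Y = (big T' Y).submatrix (e.symm.prodCongr (Equiv.refl _)) (e.symm.prodCongr (Equiv.refl _)) := by
        ext a b; simp [big_apply]
      rwa [h2, rank_submatrix] at this
    haveI : Nonempty (Fin d) := ⟨⟨0, hd⟩⟩
    obtain ⟨U, W, hUW, hlt⟩ := A3 (ι := Fin d) Y s hs hmax T (le_antisymm (by simpa using hmax0 d T) (by simpa using hT))
    obtain ⟨bU, JU, c1, u1, u2⟩ := adapted U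
    obtain ⟨bW, JW, c2, w1, w2⟩ := adapted W
    let st := Pi.basisFun k (Fin n)
    refine ⟨bW.toMatrix st, st.toMatrix bU, JWᶜ, JU, ?_, ?_, ?_, ?_⟩
    · have := bW.toMatrix_mul_toMatrix_flip st
      intro h0
      have := congrArg det this
      rw [det_mul, h0, zero_mul, det_one] at this
      exact zero_ne_one this
    · have := st.toMatrix_mul_toMatrix_flip bU
      intro h0
      have := congrArg det this
      rw [det_mul, h0, zero_mul, det_one] at this
      exact zero_ne_one this
    · rw [Finset.card_compl, Fintype.card_fin]
      have := Finset.card_le_univ JW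
      rw [Fintype.card_fin] at this
      omega
    · intro l i hi j hj
      have h1 : (bW.toMatrix st * Y l * st.toMatrix bU) i j = bW.repr (Y l *ᵥ bU j) i := by
        have h3 : ∀ w : Fin n → k, bW.repr w i = (bW.toMatrix st *ᵥ w) i := by
          intro w
          have h4 : w = ∑ t, w t • st t := by
            funext a; simp [st, Finset.sum_apply, Pi.single_apply]
          conv_lhs => rw [h4]
          simp [mulVec, dotProduct, Module.Basis.toMatrix_apply, mul_comm]
        rw [h3, mulVec_mulVec]
        rw [mul_apply]
        simp [mulVec, dotProduct, Module.Basis.toMatrix_apply, st]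
      rw [h1]
      exact w2 _ (hUW l _ (u1 j hj)) i (by simpa using hi)
  · left
    obtain ⟨c, hc⟩ : ∃ c, n * d = n + c := ⟨n * d - n, by have := Nat.le_mul_of_pos_right n hd; omega⟩
    let e : Fin n × Fin d ≃ Fin (n + c) := Fintype.equivFinOfCardEq (by simp [hc])
    have hdet := det_of_rank (big T Y) (by rw [hs] at hT; simpa [mul_comm] using hT)
    refine down hn Y c (fun l => (Matrix.kroneckerMap (· * ·) (1 : Matrix (Fin n) (Fin n) k) (T l)).submatrix e.symm e.symm) ?_
    have h2 : big (fun l => (Matrix.kroneckerMap (· * ·) (1 : Matrix (Fin n) (Fin n) k) (T l)).submatrix e.symm e.symm) Y =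
        (Matrix.kroneckerMap (· * ·) (1 : Matrix (Fin n) (Fin n) k) (big T Y)).submatrix
          ((e.symm.prodCongr (Equiv.refl _)).trans (Equiv.prodAssoc _ _ _)) ((e.symm.prodCongr (Equiv.refl _)).trans (Equiv.prodAssoc _ _ _)) := by
      ext a b; simp [big_apply, Finset.mul_sum, mul_assoc]
    rw [h2, det_submatrix_equiv_self, det_kronecker]
    simp [hdet]
end
section
variable {B F L : Type} [CommRing B] [IsDomain B] [UniqueFactorizationMonoid B] [Field F] [Algebra B F] [IsFractionRing B F]
  [Field L] [Algebra B L] [Algebra F L] [IsScalarTower B F L]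
lemma exists_prime_bad [IsIntegrallyClosed B] [FiniteDimensional F L] (h : L) (hh : ¬ IsIntegral B h) :
    ∃ π : B, Prime π ∧ ∀ s, ¬ π ∣ s → ¬ IsIntegral B (s • h) := by
  have hF : IsIntegral F h := Algebra.IsIntegral.isIntegral h
  have h1 : ∃ i, (minpoly F h).coeff i ∉ Set.range (algebraMap B F) := by
    by_contra hc
    push Not at hc
    obtain ⟨q, hq, -, hm⟩ := Polynomial.lifts_and_degree_eq_and_monic
      ((Polynomial.lifts_iff_coeff_lifts _).mpr hc) (minpoly.monic hF)
    refine hh ⟨q, hm, ?_⟩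
    have := minpoly.aeval F h
    rw [← hq, Polynomial.aeval_map_algebraMap] at this
    exact this
  obtain ⟨i, hi⟩ := h1
  obtain ⟨a, b, hab, hc⟩ := IsFractionRing.exists_reduced_fraction B ((minpoly F h).coeff i)
  have hb0 : (b : B) ≠ 0 := nonZeroDivisors.ne_zero b.2
  have hb : ¬ IsUnit (b : B) := by
    intro hu
    apply hi
    obtain ⟨u, hu⟩ := hu
    refine ⟨a * (u⁻¹ : Bˣ), ?_⟩
    rw [← hc, IsLocalization.eq_mk'_iff_mul_eq, ← hu, ← map_mul, mul_assoc, Units.inv_mul, mul_one]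
  obtain ⟨π, hπ, hπb⟩ := WfDvdMonoid.exists_irreducible_factor hb hb0
  have hπp : Prime π := hπ.prime
  have hπa : ¬ π ∣ a := fun h => hπ.not_isUnit (hab h hπb)
  refine ⟨π, hπp, fun s hs hint => ?_⟩
  have hs0 : s ≠ 0 := fun h => hs (h ▸ dvd_zero _)
  have h2 := minpoly.isIntegrallyClosed_eq_field_fractions' F hint
  have h3 : s • h = (algebraMap B F s) • h := by rw [algebraMap_smul]
  rw [h3, IsIntegrallyClosed.minpoly_smul (by simpa using hs0) hF] at h2
  have h4 := congrArg (fun p => Polynomial.coeff p i) h2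
  simp only [Polynomial.coeff_scaleRoots, Polynomial.coeff_map] at h4
  set c := (minpoly B (algebraMap B F s • h)).coeff i
  rw [← hc, ← map_pow] at h4
  have h5 : a * s ^ ((minpoly F h).natDegree - i) = c * b := by
    apply IsFractionRing.injective B F
    rw [map_mul, map_mul, ← h4, mul_right_comm, IsLocalization.mk'_spec]
  have h6 : π ∣ a * s ^ ((minpoly F h).natDegree - i) := h5 ▸ (hπb.mul_left c)
  rcases hπp.dvd_or_dvd h6 with h7 | h7
  · exact hπa h7
  · exact hs (hπp.dvd_of_dvd_pow h7)
lemma exists_V (h : L) (hinj : Function.Injective (algebraMap B L)) (π : B) (hπ : Prime π) (H : ∀ s, ¬ π ∣ s → ¬ IsIntegral B (s • h)) :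
    ∃ V : ValuationSubring L, (∀ b : B, algebraMap B L b ∈ V) ∧ h ∉ V ∧ ∀ s : B, ¬ π ∣ s → (algebraMap B L s)⁻¹ ∈ V := by
  haveI : (Ideal.span {π}).IsPrime := (Ideal.span_singleton_prime hπ.ne_zero).mpr hπ
  let p := Ideal.span {π}
  have hp : ∀ s, s ∈ p.primeCompl ↔ ¬ π ∣ s := by
    intro s; rw [Ideal.mem_primeCompl_iff, Ideal.mem_span_singleton]
  have hu : ∀ y : p.primeCompl, IsUnit (algebraMap B L y) := by
    intro y
    refine Ne.isUnit fun h0 => ?_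
    rw [map_eq_zero_iff _ hinj] at h0
    exact (hp _).mp y.2 (h0 ▸ dvd_zero _)
  let j : Localization.AtPrime p →+* L := IsLocalization.lift (M := p.primeCompl) hu
  letI : Algebra (Localization.AtPrime p) L := j.toAlgebra
  haveI : IsScalarTower B (Localization.AtPrime p) L := IsScalarTower.of_algebraMap_eq fun b => by
    show _ = j _
    rw [IsLocalization.lift_eq]
  have hn : h ∉ (integralClosure (Localization.AtPrime p) L).toSubring := by
    intro hh
    obtain ⟨m, hm⟩ := IsIntegral.exists_multiple_integral_of_isLocalization p.primeCompl h hh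
    exact H m.1 ((hp _).mp m.2) hm
  obtain ⟨V, hV, hhV⟩ := Subring.exists_le_valuationSubring_of_isIntegrallyClosedIn hn
  have hj : ∀ x, j x ∈ V := fun x => hV (isIntegral_algebraMap (R := Localization.AtPrime p) (x := x))
  refine ⟨V, fun b => ?_, hhV, fun s hs => ?_⟩
  · have := hj (algebraMap B _ b)
    rwa [IsLocalization.lift_eq] at this
  · have := hj (IsLocalization.mk' _ 1 ⟨s, (hp s).mpr hs⟩)
    have e : j (IsLocalization.mk' _ 1 ⟨s, (hp s).mpr hs⟩) * algebraMap B L s = 1 := by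
      rw [← IsLocalization.lift_eq (S := Localization.AtPrime p) hu s, ← map_mul]
      rw [show IsLocalization.mk' (Localization.AtPrime p) 1 (⟨s, (hp s).mpr hs⟩ : p.primeCompl) * algebraMap B _ s = algebraMap B _ 1 from IsLocalization.mk'_spec _ _ _, map_one, map_one]
    rw [← eq_inv_of_mul_eq_one_left e]
    exact this
lemma two_terms (V : ValuationSubring L) [FiniteDimensional F L] (x : L) (hx : x ≠ 0) :
    ∃ (m : ℕ) (c c' : F), 0 < m ∧ m ≤ Module.finrank F L ∧ c ≠ 0 ∧ c' ≠ 0 ∧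
      V.valuation (algebraMap F L c) * V.valuation x ^ m = V.valuation (algebraMap F L c') := by
  classical
  let P := minpoly F x
  have hF : IsIntegral F x := Algebra.IsIntegral.isIntegral x
  let t : ℕ → L := fun i => algebraMap F L (P.coeff i) * x ^ i
  have hsum : ∑ i ∈ Finset.range (P.natDegree + 1), t i = 0 := by
    have := minpoly.aeval F x
    rw [Polynomial.aeval_eq_sum_range] at this
    simpa only [Algebra.smul_def] using this
  have hle : P.natDegree ≤ Module.finrank F L := minpoly.natDegree_le x
  obtain ⟨i, hi, hmax⟩ := Finset.exists_max_image (Finset.range (P.natDegree + 1)) (fun i => V.valuation (t i)) ⟨0, by simp⟩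
  have htop : t P.natDegree ≠ 0 := by
    simp only [t]
    rw [Polynomial.coeff_natDegree, (minpoly.monic hF).leadingCoeff, map_one, one_mul]
    exact pow_ne_zero _ hx
  have hti : V.valuation (t i) ≠ 0 := by
    have h1 := hmax P.natDegree (by simp)
    have h2 : V.valuation (t P.natDegree) ≠ 0 := (Valuation.ne_zero_iff _).mpr htop
    exact (lt_of_lt_of_le (zero_lt_iff.mpr h2) h1).ne'
  have : ∃ i' ∈ (Finset.range (P.natDegree + 1)).erase i, V.valuation (t i') = V.valuation (t i) := by
    by_contra hc
    push Not at hc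
    have h1 := Valuation.map_sum_lt V.valuation (s := (Finset.range (P.natDegree + 1)).erase i) (f := t) hti
      (fun j hj => lt_of_le_of_ne (hmax j (Finset.mem_of_mem_erase hj)) (hc j hj))
    rw [← Finset.add_sum_erase _ _ hi] at hsum
    have h2 : ∑ j ∈ (Finset.range (P.natDegree + 1)).erase i, t j = - t i := by linear_combination hsum
    rw [h2, Valuation.map_neg] at h1
    exact lt_irrefl _ h1
  obtain ⟨i', hi', heq⟩ := this
  have key : ∀ a b, a < b → b ≤ P.natDegree → V.valuation (t a) = V.valuation (t b) → V.valuation (t a) ≠ 0 → ∃ (m : ℕ) (c c' : F), 0 < m ∧ m ≤ Module.finrank F L ∧ c ≠ 0 ∧ c' ≠ 0 ∧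
      V.valuation (algebraMap F L c) * V.valuation x ^ m = V.valuation (algebraMap F L c') := by
    intro a b hab hb he hne
    have hne' := he ▸ hne
    refine ⟨b - a, P.coeff b, P.coeff a, by omega, by omega, ?_, ?_, ?_⟩
    · intro h0; apply hne'; simp [t, h0]
    · intro h0; apply hne; simp [t, h0]
    · simp only [t, map_mul, map_pow] at he
      have hx' : V.valuation x ^ a ≠ 0 := pow_ne_zero _ ((Valuation.ne_zero_iff _).mpr hx)
      apply mul_right_cancel₀ hx'
      rw [he, mul_assoc, ← pow_add, Nat.sub_add_cancel hab.le]
  rw [Finset.mem_erase, Finset.mem_range] at hi'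
  rw [Finset.mem_range] at hi
  rcases lt_or_gt_of_ne hi'.1 with h | h
  · exact key i' i h (by omega) heq (heq ▸ hti)
  · exact key i i' h (by omega) heq.symm hti
theorem DV [IsIntegrallyClosed B] [FiniteDimensional F L] (h : L) (hh : ¬ IsIntegral B h) :
    ∃ (V : ValuationSubring L) (κ : L → ℤ), (∀ b : B, algebraMap B L b ∈ V) ∧ h ∉ V ∧
      (∀ x y, x ≠ 0 → y ≠ 0 → κ (x * y) = κ x + κ y) ∧ ∀ x, x ≠ 0 → (x ∈ V ↔ 0 ≤ κ x) := by
  have hinj : Function.Injective (algebraMap B L) := by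
    rw [IsScalarTower.algebraMap_eq B F L]
    exact (algebraMap F L).injective.comp (IsFractionRing.injective B F)
  obtain ⟨π, hπ, H⟩ := exists_prime_bad (F := F) h hh
  obtain ⟨V, hB, hhV, hs⟩ := exists_V h hinj π hπ H
  let v := V.valuation
  let i := algebraMap B L
  have hi0 : ∀ b, b ≠ 0 → i b ≠ 0 := fun b hb h0 => hb ((map_eq_zero_iff _ hinj).mp h0)
  have hvs : ∀ s, ¬ π ∣ s → v (i s) = 1 := by
    intro s hd
    have h0 : i s ≠ 0 := hi0 s (fun h => hd (h ▸ dvd_zero _))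
    apply le_antisymm ((V.valuation_le_one_iff _).mpr (hB s))
    have h1 := (V.valuation_le_one_iff _).mpr (hs s hd)
    rw [map_inv₀] at h1
    exact (inv_le_one₀ (zero_lt_iff.mpr ((Valuation.ne_zero_iff _).mpr h0))).mp h1
  have hfac : ∀ b, b ≠ 0 → ∃ e : ℕ, v (i b) = v (i π) ^ e := by
    intro b hb
    obtain ⟨e, a, ha, rfl⟩ := WfDvdMonoid.max_power_factor hb hπ.irreducible
    exact ⟨e, by rw [map_mul, map_pow, map_mul, map_pow, hvs a ha, mul_one]⟩
  have hπ0 : v (i π) ≠ 0 := (Valuation.ne_zero_iff _).mpr (hi0 π hπ.ne_zero)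
  have hfacF : ∀ c : F, c ≠ 0 → ∃ z : ℤ, v (algebraMap F L c) = v (i π) ^ z := by
    intro c hc
    obtain ⟨a, b, hb, rfl⟩ := IsFractionRing.div_surjective (A := B) c
    have hb0 : b ≠ 0 := nonZeroDivisors.ne_zero hb
    have ha0 : a ≠ 0 := fun h => hc (by simp [h])
    obtain ⟨e1, h1⟩ := hfac a ha0
    obtain ⟨e2, h2⟩ := hfac b hb0
    refine ⟨e1 - e2, ?_⟩
    rw [map_div₀, map_div₀, ← IsScalarTower.algebraMap_apply, ← IsScalarTower.algebraMap_apply, zpow_sub₀ hπ0, zpow_natCast, zpow_natCast]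
    exact congrArg₂ _ h1 h2
  have hπ1 : v (i π) < 1 := by
    refine lt_of_le_of_ne ((V.valuation_le_one_iff _).mpr (hB π)) fun h1 => ?_
    have hFV : ∀ c : F, algebraMap F L c ∈ V := by
      intro c
      by_cases hc : c = 0
      · rw [hc, map_zero]; exact V.zero_mem
      · obtain ⟨z, hz⟩ := hfacF c hc
        rw [h1, _root_.one_zpow] at hz
        exact (V.valuation_le_one_iff _).mp hz.le
    apply hhV
    obtain ⟨p, hp, hp0⟩ := (Algebra.IsIntegral.isIntegral (R := F) h)
    let j : F →+* V := (algebraMap F L).codRestrict V.toSubring hFV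
    have hV : IsIntegral V h := by
      refine ⟨p.map j, hp.map j, ?_⟩
      rw [Polynomial.eval₂_map]
      exact hp0
    obtain ⟨y, hy⟩ := IsIntegrallyClosed.isIntegral_iff.mp hV
    rw [← hy]; exact y.2
  have hπp : 0 < v (i π) := zero_lt_iff.mpr hπ0
  let N := (Module.finrank F L).factorial
  have hN : N ≠ 0 := Nat.factorial_ne_zero _
  have hx : ∀ x : L, x ≠ 0 → ∃ z : ℤ, v x ^ N = v (i π) ^ z := by
    intro x hx
    obtain ⟨m, c, c', hm, hmN, hc, hc', he⟩ := two_terms (F := F) V x hx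
    obtain ⟨z, hz⟩ := hfacF c hc
    obtain ⟨z', hz'⟩ := hfacF c' hc'
    obtain ⟨q, hq⟩ : m ∣ N := Nat.dvd_factorial hm hmN
    refine ⟨(z' - z) * q, ?_⟩
    have : v x ^ m = v (i π) ^ (z' - z) := by
      rw [zpow_sub₀ hπ0, eq_div_iff (zpow_ne_zero _ hπ0), mul_comm, ← hz, ← hz']
      exact he
    rw [hq, pow_mul, this, _root_.zpow_mul, zpow_natCast]
  choose! κ hκ using hx
  refine ⟨V, κ, hB, hhV, fun x y hx hy => ?_, fun x hx => ?_⟩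
  · apply zpow_right_injective₀ hπp hπ1.ne
    show v (i π) ^ _ = v (i π) ^ _
    rw [← hκ _ (mul_ne_zero hx hy), zpow_add₀ hπ0, ← hκ x hx, ← hκ y hy, map_mul, mul_pow]
  · rw [← zpow_le_one_iff_right_of_lt_one₀ hπp hπ1, ← hκ x hx, ← V.valuation_le_one_iff]
    exact (pow_le_one_iff hN).symm
end
section
variable {K S : Type} [Field K] [CommRing S] [IsDomain S] [Algebra K S] [Algebra.FiniteType K S]
open TensorProduct
lemma resfield0 {C S E : Type} [CommRing C] [IsDomain C] [CommRing S] [Algebra C S] [Algebra.FiniteType C S] [Field E] [Algebra C E] [IsFractionRing C E]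
    (hinj : Function.Injective (algebraMap C S)) : ∃ (L : Type) (_ : Field L) (iE : E →+* L) (φ : S →+* L),
    (∀ c, φ (algebraMap C S c) = iE (algebraMap C E c)) ∧ iE.Finite := by
  haveI : Algebra.FiniteType E (E ⊗[C] S) := inferInstance
  haveI : Nontrivial (E ⊗[C] S) := by
    have hflat : Module.Flat C E := IsLocalization.flat E (nonZeroDivisors C)
    have h1 := Module.Flat.lTensor_preserves_injective_linearMap (M := E) (Algebra.linearMap C S) hinj
    have h2 : Function.Injective ((LinearMap.lTensor E (Algebra.linearMap C S)).comp (TensorProduct.rid C E).symm.toLinearMap) :=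
      h1.comp (TensorProduct.rid C E).symm.injective
    exact h2.nontrivial
  obtain ⟨m, hm⟩ := Ideal.exists_maximal (E ⊗[C] S)
  letI : Field ((E ⊗[C] S) ⧸ m) := Ideal.Quotient.field m
  haveI : Algebra.FiniteType E ((E ⊗[C] S) ⧸ m) := Algebra.FiniteType.of_surjective (Ideal.Quotient.mkₐ E m) (Ideal.Quotient.mkₐ_surjective E m)
  have hfin : Module.Finite E ((E ⊗[C] S) ⧸ m) := finite_of_finite_type_of_isJacobsonRing E ((E ⊗[C] S) ⧸ m)
  refine ⟨(E ⊗[C] S) ⧸ m, inferInstance, algebraMap E _, (Ideal.Quotient.mk m).comp (Algebra.TensorProduct.includeRight (R := C) (A := E) (B := S)).toRingHom, ?_, ?_⟩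
  · intro c
    show Ideal.Quotient.mk m ((1 : E) ⊗ₜ[C] (algebraMap C S c)) = Ideal.Quotient.mk m (algebraMap C E c ⊗ₜ[C] (1 : S))
    congr 1
    rw [Algebra.algebraMap_eq_smul_one, Algebra.algebraMap_eq_smul_one, TensorProduct.smul_tmul]
  · rw [RingHom.finite_algebraMap]; exact hfin
lemma resfield (C : Subalgebra K S) : ∃ (L : Type) (_ : Field L) (_ : Algebra K L) (φ : S →ₐ[K] L),
    (∀ c ∈ C, φ c = 0 → c = 0) ∧ ∀ F0 : Subfield L, (∀ c ∈ C, φ c ∈ F0) → Module.Finite F0 L := by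
  haveI : Algebra.FiniteType C S := Algebra.FiniteType.of_restrictScalars_finiteType K C S
  obtain ⟨L, _, iE, φ0, hφ0, hfin⟩ := resfield0 (C := C) (S := S) (E := FractionRing C) (fun a b h => Subtype.ext h)
  letI algK : Algebra K L := (φ0.comp (algebraMap K S)).toAlgebra
  let φ : S →ₐ[K] L := { φ0 with commutes' := fun k => rfl }
  refine ⟨L, inferInstance, algK, φ, ?_, ?_⟩
  · intro c hc h0
    have h1 : iE (algebraMap C (FractionRing C) ⟨c, hc⟩) = 0 := by rw [← hφ0]; exact h0
    rw [map_eq_zero_iff _ iE.injective, map_eq_zero_iff _ (IsFractionRing.injective C (FractionRing C))] at h1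
    exact congrArg Subtype.val h1
  · intro F0 hF0
    have hmem : ∀ x, iE x ∈ F0 := by
      intro x
      obtain ⟨a, b, hb, rfl⟩ := IsFractionRing.div_surjective (A := C) x
      rw [map_div₀, ← hφ0, ← hφ0]
      exact F0.div_mem (hF0 _ a.2) (hF0 _ b.2)
    have : ((F0.subtype).comp (iE.codRestrict F0 hmem)).Finite := hfin
    have h2 := RingHom.Finite.of_comp_finite this
    rw [RingHom.Finite] at h2
    exact h2
lemma D1core {L B : Type} [Field L] [Algebra K L] [CommRing B] [IsDomain B] [UniqueFactorizationMonoid B] [IsIntegrallyClosed B]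
    (g : B →+* L) (hg : Function.Injective g) (a : L)
    (hfin : ∀ F0 : Subfield L, (∀ b, g b ∈ F0) → a ∈ F0 → Module.Finite F0 L)
    (halg : ∃ p : Polynomial B, p ≠ 0 ∧ p.eval₂ g a = 0) (hint : ¬ g.IsIntegralElem a) :
    ∃ (V : ValuationSubring L) (κ : L → ℤ), (∀ b : B, g b ∈ V) ∧ a ∉ V ∧
      (∀ x y, x ≠ 0 → y ≠ 0 → κ (x * y) = κ x + κ y) ∧ ∀ x, x ≠ 0 → (x ∈ V ↔ 0 ≤ κ x) := by
  letI : Algebra B L := g.toAlgebra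
  haveI : FaithfulSMul B L := (faithfulSMul_iff_algebraMap_injective B L).mpr hg
  let F := FractionRing B
  letI : Algebra F L := FractionRing.liftAlgebra B L
  haveI : IsScalarTower B F L := FractionRing.isScalarTower_liftAlgebra B L
  have hal : IsAlgebraic B a := by
    obtain ⟨p, h1, h2⟩ := halg
    exact ⟨p, h1, h2⟩
  have halF : IsIntegral F a := (hal.extendScalars (IsFractionRing.injective B F)).isIntegral
  let G := IntermediateField.adjoin F {a}
  haveI : FiniteDimensional F G := IntermediateField.adjoin.finiteDimensional halF
  haveI h1 : Module.Finite G L := hfin G.toSubfield (fun b => by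
    have := G.algebraMap_mem (algebraMap B F b)
    rw [← IsScalarTower.algebraMap_apply] at this
    exact this) (IntermediateField.mem_adjoin_simple_self F a)
  haveI : FiniteDimensional F L := Module.Finite.trans G L
  exact DV (B := B) (F := F) a hint
theorem D1 {r : ℕ} (f : Fin r → S) (hf : AlgebraicIndependent K f) (h : S)
    (hh : ¬ (aeval f : MvPolynomial (Fin r) K →ₐ[K] S).toRingHom.IsIntegralElem h) :
    ∃ (L : Type) (_ : Field L) (_ : Algebra K L) (φ : S →ₐ[K] L) (V : ValuationSubring L) (κ : L → ℤ),
      (∀ p : MvPolynomial (Fin r) K, φ (aeval f p) ∈ V) ∧ φ h ∉ V ∧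
      (∀ x y, x ≠ 0 → y ≠ 0 → κ (x * y) = κ x + κ y) ∧ ∀ x, x ≠ 0 → (x ∈ V ↔ 0 ≤ κ x) := by
  let C : Subalgebra K S := Algebra.adjoin K (insert h (Set.range f))
  obtain ⟨L, _, _, φ, hinj, hfin⟩ := resfield C
  have hhC : h ∈ C := Algebra.subset_adjoin (Set.mem_insert _ _)
  have hfC : ∀ p : MvPolynomial (Fin r) K, aeval f p ∈ C := by
    intro p
    have h1 : aeval f p ∈ Algebra.adjoin K (Set.range f) := by
      rw [Algebra.adjoin_range_eq_range_aeval]; exact ⟨p, rfl⟩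
    exact Algebra.adjoin_mono (Set.subset_insert _ _) h1
  have hinj' : ∀ c ∈ C, ∀ c' ∈ C, φ c = φ c' → c = c' := by
    intro c hc c' hc' h
    have := hinj (c - c') (C.sub_mem hc hc') (by rw [map_sub, h, sub_self])
    exact sub_eq_zero.mp this
  have hfin' : ∀ F0 : Subfield L, (∀ k : K, algebraMap K L k ∈ F0) → (∀ i, φ (f i) ∈ F0) → φ h ∈ F0 → Module.Finite F0 L := by
    intro F0 h0 h1 h2
    apply hfin
    intro c hc
    induction hc using Algebra.adjoin_induction with
    | mem x hx =>
      rcases hx with rfl | ⟨i, rfl⟩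
      · exact h2
      · exact h1 i
    | algebraMap k => rw [AlgHom.commutes]; exact h0 k
    | add x y _ _ hx hy => rw [map_add]; exact F0.add_mem hx hy
    | mul x y _ _ hx hy => rw [map_mul]; exact F0.mul_mem hx hy
  have hpoly : ∀ p : Polynomial (MvPolynomial (Fin r) K), p.eval₂ (aeval f : MvPolynomial (Fin r) K →ₐ[K] S).toRingHom h ∈ C := by
    intro p
    rw [Polynomial.eval₂_eq_sum]
    exact C.sum_mem fun i _ => C.mul_mem (hfC _) (C.pow_mem hhC _)
  have hev : ∀ p : Polynomial (MvPolynomial (Fin r) K), φ (p.eval₂ (aeval f : MvPolynomial (Fin r) K →ₐ[K] S).toRingHom h) =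
      p.eval₂ (φ.comp (aeval f : MvPolynomial (Fin r) K →ₐ[K] S)).toRingHom (φ h) := by
    intro p
    exact Polynomial.hom_eval₂ p _ φ.toRingHom h
  have hgi : Function.Injective (φ.comp (aeval f : MvPolynomial (Fin r) K →ₐ[K] S)).toRingHom := by
    intro p q hpq
    exact hf (hinj' _ (hfC p) _ (hfC q) hpq)
  have hfφ : AlgebraicIndependent K (fun i => φ (f i)) := by
    have : (aeval (fun i => φ (f i)) : MvPolynomial (Fin r) K →ₐ[K] L) = φ.comp (aeval f) := by
      apply MvPolynomial.algHom_ext; intro i; simp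
    rw [AlgebraicIndependent, this]
    exact hgi
  by_cases halg : ∃ p : Polynomial (MvPolynomial (Fin r) K), p ≠ 0 ∧ p.eval₂ (φ.comp (aeval f : MvPolynomial (Fin r) K →ₐ[K] S)).toRingHom (φ h) = 0
  · obtain ⟨V, κ, h1, h2⟩ := D1core (K := K) (φ.comp (aeval f : MvPolynomial (Fin r) K →ₐ[K] S)).toRingHom hgi (φ h)
      (fun F0 h0 h1 => hfin' F0 (fun k => by simpa using h0 (MvPolynomial.C k)) (fun i => by simpa using h0 (X i)) h1) halg (by
        rintro ⟨p, hp, hp0⟩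
        refine hh ⟨p, hp, ?_⟩
        rw [← hev] at hp0
        exact hinj _ (hpoly p) hp0)
    exact ⟨L, inferInstance, inferInstance, φ, V, κ, h1, h2⟩
  · have htr : Transcendental (Algebra.adjoin K (Set.range fun i => φ (f i))) (φ h) := by
      rintro ⟨p, hp, hp0⟩
      apply halg
      let e := hfφ.aevalEquiv
      refine ⟨p.map e.symm.toRingEquiv.toRingHom, ?_, ?_⟩
      · rwa [Ne, Polynomial.map_eq_zero_iff]
        exact e.symm.injective
      · rw [Polynomial.eval₂_map]
        rw [Polynomial.aeval_def] at hp0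
        rw [← hp0]
        congr 1
        ext x
        have h1 : (e (e.symm x) : L) = x := by rw [e.apply_symm_apply]
        rw [show (e (e.symm x) : L) = aeval (fun i => φ (f i)) (e.symm x) from hfφ.algebraMap_aevalEquiv _] at h1
        refine Eq.trans ?_ h1
        show φ (aeval f (e.symm x)) = _
        have : (aeval (fun i => φ (f i)) : MvPolynomial (Fin r) K →ₐ[K] L) = φ.comp (aeval f) := by
          apply MvPolynomial.algHom_ext; intro i; simp
        rw [this]; rfl
    have hne : φ h ≠ 0 := by
      intro h0; apply htr; rw [h0]; exact isAlgebraic_zero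
    have htr' : Transcendental (Algebra.adjoin K (Set.range fun i => φ (f i))) (φ h)⁻¹ := by
      intro h1; apply htr; have := h1.inv; rwa [inv_inv] at this
    have hopt := (hfφ.option_iff_transcendental (φ h)⁻¹).mpr htr'
    let y : Option (Fin r) → L := fun o => o.elim (φ h)⁻¹ (fun i => φ (f i))
    have hyi : Function.Injective (aeval y : MvPolynomial (Option (Fin r)) K →ₐ[K] L).toRingHom := hopt
    have hy0 : aeval (R := K) y (X none) = (φ h)⁻¹ := by simp [y]
    have hy1 : ∀ i, aeval (R := K) y (X (some i)) = φ (f i) := by intro i; simp [y]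
    obtain ⟨V, κ, h1, h2⟩ := D1core (K := K) (aeval y : MvPolynomial (Option (Fin r)) K →ₐ[K] L).toRingHom hyi (φ h)
      (fun F0 h0 h1 => hfin' F0 (fun k => by simpa using h0 (MvPolynomial.C k)) (fun i => by have := h0 (X (some i)); rwa [← hy1 i]) h1)
      ⟨Polynomial.C (X none) * Polynomial.X - 1, by
          intro h0
          have := congrArg (fun p => Polynomial.coeff p 1) h0
          simp [Polynomial.coeff_one] at this, by
          rw [Polynomial.eval₂_sub, Polynomial.eval₂_mul, Polynomial.eval₂_C, Polynomial.eval₂_X, Polynomial.eval₂_one]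
          show aeval y (X none) * φ h - 1 = 0
          rw [hy0, inv_mul_cancel₀ hne, sub_self]⟩ (by
        intro hint
        letI : Algebra (MvPolynomial (Option (Fin r)) K) L := (aeval y : MvPolynomial (Option (Fin r)) K →ₐ[K] L).toRingHom.toAlgebra
        have hint' : ∃ p : Polynomial (MvPolynomial (Option (Fin r)) K), p.Monic ∧ p.eval₂ (aeval y : MvPolynomial (Option (Fin r)) K →ₐ[K] L).toRingHom (φ h) = 0 := hint
        obtain ⟨p, hp, hp0⟩ := hint'
        have hrev : (p.reverse).eval₂ (aeval y : MvPolynomial (Option (Fin r)) K →ₐ[K] L).toRingHom ((φ h)⁻¹) = 0 := by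
          letI := invertibleOfNonzero hne
          have := (Polynomial.eval₂_reverse_eq_zero_iff (aeval y : MvPolynomial (Option (Fin r)) K →ₐ[K] L).toRingHom (φ h) p).mpr hp0
          rwa [invOf_eq_inv] at this
        have h3 : (aeval y : MvPolynomial (Option (Fin r)) K →ₐ[K] L).toRingHom (p.reverse.eval (X none)) = 0 := by
          rw [← hrev, ← hy0]
          exact (Polynomial.eval₂_at_apply _ _).symm
        rw [map_eq_zero_iff _ hyi] at h3
        have h4 := congrArg (constantCoeff) h3
        rw [map_zero, ← Polynomial.eval₂_at_apply, constantCoeff_X, Polynomial.eval₂_at_zero, Polynomial.coeff_zero_reverse, hp.leadingCoeff, map_one] at h4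
        exact one_ne_zero h4)
    exact ⟨L, inferInstance, inferInstance, φ, V, κ, fun p => by
      have := h1 (rename some p)
      convert this using 1
      show _ = aeval y (rename some p)
      rw [aeval_rename]
      have : (aeval (y ∘ some) : MvPolynomial (Fin r) K →ₐ[K] L) = φ.comp (aeval f) := by
          apply MvPolynomial.algHom_ext; intro i; simp [y]
      rw [this]; rfl, h2⟩
end
section
variable {K : Type} [Field K] {M n : ℕ}
lemma det_big_PQ {R : Type} [CommRing R] (T Y : Fin M → Matrix (Fin n) (Fin n) R) (P Q : Matrix (Fin n) (Fin n) R) :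
    (big T (fun l => P * Y l * Q)).det = (P.det * Q.det) ^ n * (big T Y).det := by
  have h : big T (fun l => P * Y l * Q) = Matrix.kroneckerMap (· * ·) (1 : Matrix (Fin n) (Fin n) R) P * big T Y *
      Matrix.kroneckerMap (· * ·) (1 : Matrix (Fin n) (Fin n) R) Q := by
    simp only [big, Matrix.mul_sum, Matrix.sum_mul]
    refine Finset.sum_congr rfl fun l _ => ?_
    have := Matrix.mul_kronecker_mul (1 : Matrix (Fin n) (Fin n) R) (T l) P (Y l)
    have h2 := Matrix.mul_kronecker_mul (1 * T l) (1 : Matrix (Fin n) (Fin n) R) (P * Y l) Q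
    rw [this, one_mul, mul_one] at h2
    exact h2
  rw [h, det_mul, det_mul]
  have hk := Matrix.det_kronecker (1 : Matrix (Fin n) (Fin n) R) P
  have hk' := Matrix.det_kronecker (1 : Matrix (Fin n) (Fin n) R) Q
  simp only [det_one, one_pow, one_mul, Fintype.card_fin] at hk hk'
  rw [show (Matrix.kroneckerMap (· * ·) (1 : Matrix (Fin n) (Fin n) R) P).det = P.det ^ n from hk,
    show (Matrix.kroneckerMap (· * ·) (1 : Matrix (Fin n) (Fin n) R) Q).det = Q.det ^ n from hk']
  ring
noncomputable def detBig (T : Fin M → Matrix (Fin n) (Fin n) K) : MvPolynomial (Sig M n) K :=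
  (big (fun l => (T l).map (algebraMap K (MvPolynomial (Sig M n) K))) (gm K M n)).det
lemma ev_detBig {L : Type} [CommRing L] [Algebra K L] (T : Fin M → Matrix (Fin n) (Fin n) K) (X : Fin M → Matrix (Fin n) (Fin n) L) :
    ev X (detBig T) = (big (fun l => (T l).map (algebraMap K L)) X).det := by
  rw [detBig, AlgHom.map_det]
  congr 1
  have := big_map (ev (K := K) X).toRingHom (fun l => (T l).map (algebraMap K (MvPolynomial (Sig M n) K))) (gm K M n)
  refine Eq.trans this ?_
  congr 1
  · funext l; ext i j
    show ev X (algebraMap K _ (T l i j)) = algebraMap K L (T l i j)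
    exact AlgHom.commutes _ _
  · funext l; ext i j
    show ev X (MvPolynomial.X (l, i, j)) = _
    rw [ev_X]
lemma detBig_mem (T : Fin M → Matrix (Fin n) (Fin n) K) : detBig T ∈ SI K M n n := by
  intro P Q hP hQ X
  rw [ev_detBig, ev_detBig, det_big_PQ]
variable {L : Type} [Field L] [Algebra K L]
lemma D2core [Infinite K] (hn : 0 < n) (V : ValuationSubring L) (κ : L → ℤ) (hmul : ∀ x y, x ≠ 0 → y ≠ 0 → κ (x * y) = κ x + κ y)
    (hV : ∀ x, x ≠ 0 → (x ∈ V ↔ 0 ≤ κ x)) (hK : ∀ a : K, algebraMap K L a ∈ V) (X : Fin M → Matrix (Fin n) (Fin n) L)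
    (hSI : ∀ g ∈ SI K M n n, ev X g ∈ V) (e : ℕ) (h : MvPolynomial (Sig M n) K) (hh : h ∈ SI K M n e) (hhV : ev X h ∉ V) : False := by
  classical
  have κ1 : κ 1 = 0 := by have := hmul 1 1 one_ne_zero one_ne_zero; rw [mul_one] at this; omega
  have κinv : ∀ x, x ≠ 0 → κ x⁻¹ = - κ x := by
    intro x hx; have := hmul x x⁻¹ hx (inv_ne_zero hx); rw [mul_inv_cancel₀ hx, κ1] at this; omega
  have κpow : ∀ x, x ≠ 0 → ∀ m : ℕ, κ (x ^ m) = m * κ x := by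
    intro x hx m
    induction m with
    | zero => simp [κ1]
    | succ m ih => rw [pow_succ, hmul _ _ (pow_ne_zero _ hx) hx, ih]; push_cast; ring
  have hh0 : ev X h ≠ 0 := fun h0 => hhV (h0 ▸ V.zero_mem)
  have hκh : κ (ev X h) < 0 := by
    by_contra hc; exact hhV ((hV _ hh0).mpr (by omega))
  have evV : ∀ (Y : Fin M → Matrix (Fin n) (Fin n) L) (hY : ∀ l i j, Y l i j ∈ V) (g : MvPolynomial (Sig M n) K), ev Y g ∈ V := by
    intro Y hY g
    induction g using MvPolynomial.induction_on with
    | C a => rw [← algebraMap_eq, AlgHom.commutes]; exact hK a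
    | add p q hp hq => rw [map_add]; exact V.add_mem _ _ hp hq
    | mul_X p i hp => rw [map_mul, ev_X]; exact V.mul_mem _ _ hp (hY _ _ _)
  let Adm : Matrix (Fin n) (Fin n) L → Matrix (Fin n) (Fin n) L → Prop := fun P Q =>
    P.det ≠ 0 ∧ Q.det ≠ 0 ∧ ∀ l i j, (P * X l * Q) i j ∈ V
  have hpos : ∀ P Q, Adm P Q → 0 < κ (P.det * Q.det) := by
    intro P Q ⟨hP, hQ, hA⟩
    have h1 := evV _ hA h
    have hd := mul_ne_zero hP hQ
    rw [SI_ext hh, hV _ (mul_ne_zero (pow_ne_zero _ hd) hh0), hmul _ _ (pow_ne_zero _ hd) hh0, κpow _ hd] at h1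
    have h2 : 0 < (e : ℤ) * κ (P.det * Q.det) := by omega
    exact pos_of_mul_pos_right h2 (Int.natCast_nonneg e)
  have hden : ∀ s : Finset L, ∃ c : L, c ≠ 0 ∧ c ∈ V ∧ ∀ x ∈ s, c * x ∈ V := by
    intro s
    induction s using Finset.induction_on with
    | empty => exact ⟨1, one_ne_zero, V.one_mem, by simp⟩
    | insert a s ha ih =>
      obtain ⟨c, hc, hcV, hcs⟩ := ih
      by_cases haV : a ∈ V
      · refine ⟨c, hc, hcV, fun x hx => ?_⟩
        rcases Finset.mem_insert.mp hx with rfl | hx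
        · exact V.mul_mem _ _ hcV haV
        · exact hcs x hx
      · have ha0 : a ≠ 0 := fun h0 => haV (h0 ▸ V.zero_mem)
        have hai := (V.mem_or_inv_mem a).resolve_left haV
        refine ⟨a⁻¹ * c, mul_ne_zero (inv_ne_zero ha0) hc, V.mul_mem _ _ hai hcV, fun x hx => ?_⟩
        rcases Finset.mem_insert.mp hx with rfl | hx
        · rw [mul_right_comm, inv_mul_cancel₀ ha0, one_mul]; exact hcV
        · rw [mul_assoc]; exact V.mul_mem _ _ hai (hcs x hx)
  have hex : ∃ m : ℕ, ∃ P Q, Adm P Q ∧ κ (P.det * Q.det) = m := by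
    obtain ⟨c, hc, -, hcs⟩ := hden (Finset.univ.image fun p : Sig M n => X p.1 p.2.1 p.2.2)
    have hA : Adm (c • 1) 1 := by
      refine ⟨?_, by simp, fun l i j => ?_⟩
      · rw [det_smul]; simp [hc]
      · have := hcs (X l i j) (Finset.mem_image_of_mem _ (Finset.mem_univ (l, i, j)))
        simpa using this
    exact ⟨(κ ((c • (1 : Matrix (Fin n) (Fin n) L)).det * (1 : Matrix (Fin n) (Fin n) L).det)).toNat, _, _, hA, (Int.toNat_of_nonneg (hpos _ _ hA).le).symm⟩
  obtain ⟨P, Q, hA, hPQ⟩ := Nat.find_spec hex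
  have hmin : ∀ P' Q', Adm P' Q' → κ (P.det * Q.det) ≤ κ (P'.det * Q'.det) := by
    intro P' Q' h'
    rw [hPQ, ← Int.toNat_of_nonneg (hpos _ _ h').le]
    exact_mod_cast Nat.find_min' hex ⟨P', Q', h', (Int.toNat_of_nonneg (hpos _ _ h').le).symm⟩
  have hp0 := hpos _ _ hA
  obtain ⟨hP, hQ, hY⟩ := hA
  let k := IsLocalRing.ResidueField V
  let res : V →+* k := IsLocalRing.residue V
  let jK : K →+* V := (algebraMap K L).codRestrict V.toSubring hK
  haveI : Infinite k := Infinite.of_injective (res.comp jK) (RingHom.injective _)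
  let Y : Fin M → Matrix (Fin n) (Fin n) V := fun l => Matrix.of fun i j => ⟨_, hY l i j⟩
  have hYL : ∀ l, (Y l).map V.subtype = P * X l * Q := fun l => by ext i j; rfl
  have hunit : ∀ x : V, res x ≠ 0 → (x : L) ≠ 0 ∧ κ x = 0 := by
    intro x hx
    have hu : IsUnit x := (IsLocalRing.residue_ne_zero_iff_isUnit x).mp hx
    obtain ⟨y, hy⟩ := hu.exists_right_inv
    have hxy : (x : L) * y = 1 := congrArg Subtype.val hy
    have hx0 : (x : L) ≠ 0 := left_ne_zero_of_mul_eq_one hxy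
    have hy0 : (y : L) ≠ 0 := right_ne_zero_of_mul_eq_one hxy
    refine ⟨hx0, ?_⟩
    have h1 := (hV _ hx0).mp x.2
    have h2 := (hV _ hy0).mp y.2
    have h3 := hmul _ _ hx0 hy0
    rw [hxy, κ1] at h3
    omega
  have hnonunit : ∀ x : V, res x = 0 → (x : L) ≠ 0 → 0 < κ x := by
    intro x hx hx0
    have h1 := (hV _ hx0).mp x.2
    refine lt_of_le_of_ne h1 fun h2 => ?_
    have h3 : (x : L)⁻¹ ∈ V := (hV _ (inv_ne_zero hx0)).mpr (by rw [κinv _ hx0]; omega)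
    have h4 : x * ⟨_, h3⟩ = 1 := Subtype.ext (mul_inv_cancel₀ hx0)
    have := congrArg res h4
    rw [map_mul, hx, zero_mul, map_one] at this
    exact zero_ne_one this
  rcases nullA hn (fun l => (Y l).map res) with ⟨T0, hT0⟩ | ⟨P0, Q0, I, J, hP0, hQ0, hIJ, hz⟩
  ·
    let p : MvPolynomial (Sig M n) k := (big (gm k M n) (fun l => ((Y l).map res).map (algebraMap k (MvPolynomial (Sig M n) k)))).det
    have hpev : ∀ x : Sig M n → k, eval x p = (big (fun l => Matrix.of fun i j => x (l, i, j)) (fun l => (Y l).map res)).det := by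
      intro x
      simp only [p]
      rw [RingHom.map_det]
      congr 1
      refine Eq.trans (big_map (eval x) _ _) ?_
      congr 1
      · funext l; ext i j; simp [gm]
      · funext l; ext i j; simp
    obtain ⟨y, hy⟩ := transfer (res.comp jK) p (fun q => T0 q.1 q.2.1 q.2.2) (by rw [hpev]; exact hT0)
    rw [hpev] at hy
    let T : Fin M → Matrix (Fin n) (Fin n) K := fun l => Matrix.of fun i j => y (l, i, j)
    let D : V := (big (fun l => (T l).map jK) Y).det
    have hD : res D ≠ 0 := by
      simp only [D]
      rw [RingHom.map_det]
      convert hy using 2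
      exact (big_map res _ _)
    have hDL : (D : L) = (P.det * Q.det) ^ n * ev X (detBig T) := by
      rw [ev_detBig, ← det_big_PQ]
      show V.subtype D = _
      simp only [D]
      rw [RingHom.map_det]
      congr 1
      refine Eq.trans (big_map V.subtype _ _) ?_
      congr 1
    obtain ⟨h1, h2⟩ := hunit D hD
    have hd := mul_ne_zero hP hQ
    have h3 : ev X (detBig T) ≠ 0 := by
      intro h0; rw [hDL, h0, mul_zero] at h1; exact h1 rfl
    have h4 := (hV _ h3).mp (hSI _ (detBig_mem T))
    rw [hDL, hmul _ _ (pow_ne_zero _ hd) h3, κpow _ hd] at h2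
    have : 0 < (n : ℤ) * κ (P.det * Q.det) := mul_pos (by exact_mod_cast hn) hp0
    omega
  ·
    choose lift hlift using (IsLocalRing.residue_surjective (R := V))
    have hmaplift : ∀ A : Matrix (Fin n) (Fin n) k, (A.map lift).map res = A := by
      intro A; ext i j; exact hlift _
    have hdet : ∀ A : Matrix (Fin n) (Fin n) k, A.det ≠ 0 → ((A.map lift).map V.subtype).det ≠ 0 ∧ κ ((A.map lift).map V.subtype).det = 0 := by
      intro A hA
      have h1 := hunit (A.map lift).det (by
        rw [RingHom.map_det]
        show ((A.map lift).map res).det ≠ 0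
        rw [hmaplift]; exact hA)
      have h2 : ((A.map lift).map V.subtype).det = ((A.map lift).det : L) := (RingHom.map_det V.subtype _).symm
      rw [h2]; exact h1
    let Y' : Fin M → Matrix (Fin n) (Fin n) V := fun l => P0.map lift * Y l * Q0.map lift
    have hY'res : ∀ l, ∀ i ∈ I, ∀ j ∈ J, res (Y' l i j) = 0 := by
      intro l i hi j hj
      have : (Y' l).map res = P0 * (Y l).map res * Q0 := by
        simp only [Y']
        rw [Matrix.map_mul, Matrix.map_mul, hmaplift, hmaplift]
      have h2 := congrFun (congrFun this i) j
      rw [hz l i hi j hj] at h2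
      exact h2
    have hs : ∀ Z : Finset L, (∀ z ∈ Z, z = 0 ∨ 0 < κ z) → ∃ s : L, s ≠ 0 ∧ 0 < κ s ∧ ∀ z ∈ Z, s⁻¹ * z ∈ V := by
      intro Z
      induction Z using Finset.induction_on with
      | empty => exact fun _ => ⟨(ev X h)⁻¹, inv_ne_zero hh0, by rw [κinv _ hh0]; omega, by simp⟩
      | insert a Z ha ih =>
        intro hZ
        obtain ⟨s, hs0, hsκ, hsZ⟩ := ih fun z hz => hZ z (Finset.mem_insert_of_mem hz)
        by_cases haV : s⁻¹ * a ∈ V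
        · exact ⟨s, hs0, hsκ, by simpa [haV] using hsZ⟩
        · have ha0 : a ≠ 0 := fun h0 => haV (by rw [h0, mul_zero]; exact V.zero_mem)
          have h1 := (V.mem_or_inv_mem _).resolve_left haV
          refine ⟨a, ha0, (hZ a (Finset.mem_insert_self _ _)).resolve_left ha0, fun z hz => ?_⟩
          rcases Finset.mem_insert.mp hz with rfl | hz
          · rw [inv_mul_cancel₀ ha0]; exact V.one_mem
          · have := V.mul_mem _ _ h1 (hsZ z hz)
            convert this using 1
            field_simp
    obtain ⟨s, hs0, hsκ, hsZ⟩ := hs ((Finset.univ.filter fun p : Sig M n => p.2.1 ∈ I ∧ p.2.2 ∈ J).image fun p => (Y' p.1 p.2.1 p.2.2 : L)) (by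
      intro z hz'
      obtain ⟨p, hp, rfl⟩ := Finset.mem_image.mp hz'
      rw [Finset.mem_filter] at hp
      by_cases h0 : (Y' p.1 p.2.1 p.2.2 : L) = 0
      · exact Or.inl h0
      · exact Or.inr (hnonunit _ (hY'res _ _ hp.2.1 _ hp.2.2) h0))
    have hsV : s ∈ V := (hV s hs0).mpr hsκ.le
    let D1 : Matrix (Fin n) (Fin n) L := Matrix.diagonal fun i => if i ∈ I then s⁻¹ else 1
    let D2 : Matrix (Fin n) (Fin n) L := Matrix.diagonal fun j => if j ∈ Jᶜ then s else 1
    have hD1 : D1.det = s⁻¹ ^ I.card := by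
      simp only [D1, det_diagonal]; rw [Finset.prod_ite_mem, Finset.univ_inter, Finset.prod_const]
    have hD2 : D2.det = s ^ (Jᶜ).card := by
      simp only [D2, det_diagonal]; rw [Finset.prod_ite_mem, Finset.univ_inter, Finset.prod_const]
    let PL := (P0.map lift).map V.subtype
    let QL := (Q0.map lift).map V.subtype
    obtain ⟨hPL, hPLκ⟩ := hdet P0 hP0
    obtain ⟨hQL, hQLκ⟩ := hdet Q0 hQ0
    have hent : ∀ l, (D1 * PL * P) * X l * (Q * QL * D2) = D1 * (Y' l).map V.subtype * D2 := by
      intro l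
      have : (Y' l).map V.subtype = PL * (P * X l * Q) * QL := by
        simp only [Y']
        rw [Matrix.map_mul, Matrix.map_mul, hYL]
      rw [this]
      simp only [Matrix.mul_assoc]
    have hA' : Adm (D1 * PL * P) (Q * QL * D2) := by
      refine ⟨?_, ?_, fun l i j => ?_⟩
      · rw [det_mul, det_mul, hD1]
        exact mul_ne_zero (mul_ne_zero (pow_ne_zero _ (inv_ne_zero hs0)) hPL) hP
      · rw [det_mul, det_mul, hD2]
        exact mul_ne_zero (mul_ne_zero hQ hQL) (pow_ne_zero _ hs0)
      · rw [hent, mul_diagonal, diagonal_mul]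
        show (if i ∈ I then s⁻¹ else 1) * (Y' l i j : L) * (if j ∈ Jᶜ then s else 1) ∈ V
        by_cases hi : i ∈ I
        · by_cases hj : j ∈ J
          · rw [if_pos hi, if_neg (by simpa using hj), mul_one]
            exact hsZ _ (Finset.mem_image.mpr ⟨(l, i, j), by simp [hi, hj], rfl⟩)
          · rw [if_pos hi, if_pos (by simpa using hj), mul_right_comm, inv_mul_cancel₀ hs0, one_mul]
            exact (Y' l i j).2
        · rw [if_neg hi, one_mul]
          refine V.mul_mem _ _ (Y' l i j).2 ?_
          split_ifs
          · exact hsV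
          · exact V.one_mem
    have hle := hmin _ _ hA'
    have hsi := inv_ne_zero hs0
    have heq : (D1 * PL * P).det * (Q * QL * D2).det = (P.det * Q.det) * (PL.det * QL.det) * (s⁻¹ ^ I.card * s ^ (Jᶜ).card) := by
      rw [det_mul, det_mul, det_mul, det_mul, hD1, hD2]; ring
    rw [heq, hmul _ _ (mul_ne_zero (mul_ne_zero hP hQ) (mul_ne_zero hPL hQL)) (mul_ne_zero (pow_ne_zero _ hsi) (pow_ne_zero _ hs0)),
      hmul _ _ (mul_ne_zero hP hQ) (mul_ne_zero hPL hQL), hmul _ _ hPL hQL, hmul _ _ (pow_ne_zero _ hsi) (pow_ne_zero _ hs0),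
      κpow _ hsi, κpow _ hs0, κinv _ hs0, hPLκ, hQLκ] at hle
    rw [Finset.card_compl, Fintype.card_fin] at hle
    have hJ : J.card ≤ n := by simpa using Finset.card_le_univ J
    push_cast [Nat.cast_sub hJ] at hle
    have h6 : (n:ℤ) < I.card + J.card := by exact_mod_cast hIJ
    have h5 : (0 : ℤ) < (I.card + J.card - n) * κ s := mul_pos (by omega) hsκ
    nlinarith [h5, hle]
theorem D2 [Infinite K] (hn : 0 < n) {r : ℕ} (f : Fin r → MvPolynomial (Sig M n) K) (hf : AlgebraicIndependent K f)
    (hint : ∀ g ∈ SI K M n n, (aeval f : MvPolynomial (Fin r) K →ₐ[K] MvPolynomial (Sig M n) K).toRingHom.IsIntegralElem g)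
    {e : ℕ} (h : MvPolynomial (Sig M n) K) (hh : h ∈ SI K M n e) :
    (aeval f : MvPolynomial (Fin r) K →ₐ[K] MvPolynomial (Sig M n) K).toRingHom.IsIntegralElem h := by
  by_contra hc
  obtain ⟨L, _, _, φ, V, κ, h1, h2, h3, h4⟩ := D1 f hf h hc
  let X : Fin M → Matrix (Fin n) (Fin n) L := fun l => (gm K M n l).map φ
  have hφ : ∀ g, ev X g = φ g := by
    intro g; rw [← map_ev φ (gm K M n) g, ev_gm]
  refine D2core (K := K) hn V κ h3 h4 (fun a => by simpa using h1 (MvPolynomial.C a)) X (fun g hg => ?_) e h hh (by rw [hφ]; exact h2)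
  rw [hφ]
  obtain ⟨p, hp, hp0⟩ := hint g hg
  let j : MvPolynomial (Fin r) K →+* V := ((φ.comp (aeval f : MvPolynomial (Fin r) K →ₐ[K] MvPolynomial (Sig M n) K)).toRingHom).codRestrict V.toSubring h1
  have hVi : IsIntegral V (φ g) := by
    refine ⟨p.map j, hp.map j, ?_⟩
    rw [Polynomial.eval₂_map]
    have := congrArg φ hp0
    rw [map_zero] at this
    rw [← this]
    exact (Polynomial.hom_eval₂ p _ φ.toRingHom g).symm
  obtain ⟨y, hy⟩ := IsIntegrallyClosed.isIntegral_iff.mp hVi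
  rw [← hy]; exact y.2
end
lemma homog_subst {σ K A : Type} [Field K] [CommRing A] [Algebra K A] (F : MvPolynomial σ K) (D : ℕ) (hF : F.IsHomogeneous D)
    (u : σ → Polynomial A) (hu : ∀ i, (u i).natDegree ≤ 1) :
    (aeval u F).natDegree ≤ D ∧ (aeval u F).coeff D = aeval (fun i => (u i).coeff 1) F := by
  classical
  have key : ∀ d : σ →₀ ℕ, (d.prod fun i k => u i ^ k).natDegree ≤ d.degree ∧
      (d.prod fun i k => u i ^ k).coeff d.degree = d.prod fun i k => (u i).coeff 1 ^ k := by
    intro d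
    induction d using Finsupp.induction with
    | zero => simp
    | single_add i k d hi hk ih =>
      rw [Finsupp.prod_add_index' (by simp) (by intros; rw [pow_add]), Finsupp.prod_add_index' (by simp) (by intros; rw [pow_add]),
        Finsupp.prod_single_index (by simp), Finsupp.prod_single_index (by simp), map_add, Finsupp.degree_single]
      have h1 : (u i ^ k).natDegree ≤ k := by
        simpa using Polynomial.natDegree_pow_le_of_le k (hu i)
      refine ⟨Polynomial.natDegree_mul_le_of_le h1 ih.1, ?_⟩
      rw [Polynomial.coeff_mul_add_eq_of_natDegree_le h1 ih.1, ih.2]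
      congr 1
      simpa using Polynomial.coeff_pow_of_natDegree_le (m := k) (hu i)
  have hs : aeval u F = ∑ d ∈ F.support, algebraMap K (Polynomial A) (F.coeff d) * d.prod fun i k => u i ^ k := by
    rw [aeval_def, eval₂_eq]; rfl
  have hs' : aeval (fun i => (u i).coeff 1) F = ∑ d ∈ F.support, algebraMap K A (F.coeff d) * d.prod fun i k => (u i).coeff 1 ^ k := by
    rw [aeval_def, eval₂_eq]; rfl
  have hd : ∀ d ∈ F.support, d.degree = D := fun d hd => by
    rw [hF.degree_eq_sum_deg_support hd]; rfl
  rw [hs, hs', Polynomial.finset_sum_coeff]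
  constructor
  · refine Polynomial.natDegree_sum_le_of_forall_le _ _ (fun d h => ?_)
    rw [← hd d h, Polynomial.algebraMap_apply]
    exact (Polynomial.natDegree_C_mul_le _ _).trans (key d).1
  · refine Finset.sum_congr rfl (fun d h => ?_)
    rw [Polynomial.algebraMap_apply, Polynomial.coeff_C_mul, ← (key d).2, hd d h]
lemma comp_subst {σ τ K : Type} [Field K] (g : σ → MvPolynomial τ K) (d : ℕ) (hd : 0 < d) (hg : ∀ i, (g i).IsHomogeneous d)
    (F : MvPolynomial σ K) (k : ℕ) : homogeneousComponent (d * k) (aeval g F) = aeval g (homogeneousComponent k F) := by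
  have hh : ∀ j, (aeval g (homogeneousComponent j F)).IsHomogeneous (d * j) := fun j =>
    (homogeneousComponent_isHomogeneous j F).aeval g hg
  conv_lhs => rw [← sum_homogeneousComponent F, map_sum, map_sum]
  rw [Finset.sum_eq_single k]
  · exact homogeneousComponent_eq_self (hh k)
  · intro j _ hj
    rw [homogeneousComponent_of_mem ((mem_homogeneousSubmodule _ _).mpr (hh j)), if_neg]
    intro h; exact hj ((Nat.eq_of_mul_eq_mul_left hd h).symm)
  · intro h
    rw [Finset.mem_range, not_lt] at h
    rw [homogeneousComponent_eq_zero k F (by omega)]; simp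
lemma homog_rel {σ τ K : Type} [Field K] (g : σ → MvPolynomial τ K) (d : ℕ) (hd : 0 < d) (hg : ∀ i, (g i).IsHomogeneous d)
    (h : ¬ AlgebraicIndependent K g) : ∃ (F : MvPolynomial σ K) (D : ℕ), F.IsHomogeneous D ∧ F ≠ 0 ∧ aeval g F = 0 := by
  rw [algebraicIndependent_iff] at h
  push Not at h
  obtain ⟨F, hF, hF0⟩ := h
  have : ∃ k, homogeneousComponent k F ≠ 0 := by
    by_contra hc
    push Not at hc
    apply hF0
    rw [← sum_homogeneousComponent F]
    exact Finset.sum_eq_zero fun i _ => hc i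
  obtain ⟨k, hk⟩ := this
  refine ⟨homogeneousComponent k F, k, homogeneousComponent_isHomogeneous k F, hk, ?_⟩
  have h1 := comp_subst g d hd hg F k
  rw [← h1, hF, map_zero]
lemma noeth_step {K S : Type} [Field K] [Infinite K] [CommRing S] [Algebra K S] {N : ℕ} (g : Fin (N+1) → S)
    (F : MvPolynomial (Fin (N+1)) K) (D : ℕ) (hF : F.IsHomogeneous D) (hF0 : F ≠ 0) (hr : aeval g F = 0) :
    ∃ c : Fin N → K, ∀ i, IsIntegral (Algebra.adjoin K (Set.range fun i : Fin N => g i.succ - c i • g 0)) (g i) := by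
  have : ∃ x : Fin (N+1) → K, eval x (X 0 * F) ≠ 0 := by
    by_contra hc
    push Not at hc
    exact (mul_ne_zero (X_ne_zero 0) hF0) (MvPolynomial.funext fun x => by rw [hc, map_zero])
  obtain ⟨x, hx⟩ := this
  rw [map_mul, eval_X] at hx
  have hx0 := left_ne_zero_of_mul hx
  have hxF := right_ne_zero_of_mul hx
  let c : Fin N → K := fun i => x i.succ * (x 0)⁻¹
  refine ⟨c, ?_⟩
  set A := Algebra.adjoin K (Set.range fun i : Fin N => g i.succ - c i • g 0) with hA
  let g' : Fin N → A := fun i => ⟨g i.succ - c i • g 0, Algebra.subset_adjoin ⟨i, rfl⟩⟩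
  let u : Fin (N+1) → Polynomial A := fun i => Polynomial.C (Fin.cons (α := fun _ => A) 0 g' i) + Polynomial.C (algebraMap K A (x i)) * Polynomial.X
  obtain ⟨h1, h2⟩ := homog_subst F D hF u (fun i => by simp only [u]; compute_degree)
  have hu1 : (fun i => (u i).coeff 1) = fun i => algebraMap K A (x i) := by
    funext i; simp [u, Polynomial.coeff_C]
  rw [hu1] at h2
  have h2' : (aeval u F).coeff D = algebraMap K A (eval x F) := by
    rw [h2]
    have := MvPolynomial.aeval_algebraMap_apply A x F
    simpa [MvPolynomial.coe_aeval_eq_eval, Function.comp_def] using this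
  have hint : IsIntegral A ((x 0)⁻¹ • g 0) := by
    refine ⟨Polynomial.C (algebraMap K A (eval x F)⁻¹) * aeval u F, ?_, ?_⟩
    · apply Polynomial.monic_of_natDegree_le_of_coeff_eq_one D
      · exact (Polynomial.natDegree_C_mul_le _ _).trans h1
      · rw [Polynomial.coeff_C_mul, h2', ← map_mul, inv_mul_cancel₀ hxF, map_one]
    · rw [← Polynomial.aeval_def, map_mul]
      have : (Polynomial.aeval ((x 0)⁻¹ • g 0) : Polynomial A →ₐ[A] S) (aeval u F) = 0 := by
        rw [← hr]
        have : ((Polynomial.aeval ((x 0)⁻¹ • g 0) : Polynomial A →ₐ[A] S).restrictScalars K).comp (aeval u) = aeval g := by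
          apply MvPolynomial.algHom_ext
          intro i
          simp only [AlgHom.comp_apply, aeval_X, AlgHom.restrictScalars_apply, u, map_add, map_mul, Polynomial.aeval_C, Polynomial.aeval_X]
          rw [← IsScalarTower.algebraMap_apply K A S, ← Algebra.smul_def, smul_smul]
          refine Fin.cases ?_ (fun j => ?_) i
          · rw [mul_inv_cancel₀ hx0, one_smul]; simp
          · show (g j.succ - c j • g 0) + _ = _
            simp [c]
        rw [← this]; rfl
      rw [this, mul_zero]
  have h0 : IsIntegral A (g 0) := by
    have := hint.smul (x 0)
    rwa [smul_smul, mul_inv_cancel₀ hx0, one_smul] at this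
  intro i
  refine Fin.cases h0 (fun j => ?_) i
  have h3 : IsIntegral A (g' j : S) := isIntegral_algebraMap (x := g' j)
  have := h3.add (h0.smul (c j))
  simpa [g'] using this
lemma int_trans {K S : Type} [Field K] [CommRing S] [Algebra K S] (A B : Subalgebra K S) (s : Set S) (hA : A = Algebra.adjoin K s)
    (hs : ∀ x ∈ s, IsIntegral B x) (y : S) (hy : IsIntegral A y) : IsIntegral B y := by
  let C := integralClosure B S
  have hle : A ≤ C.restrictScalars K := by
    rw [hA]; exact Algebra.adjoin_le fun x hx => hs x hx
  have : IsIntegral C y := by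
    obtain ⟨p, hp, hp0⟩ := hy
    let ι : A →+* C := A.val.toRingHom.codRestrict C (fun x => hle x.2)
    refine ⟨p.map ι, hp.map _, ?_⟩
    rw [Polynomial.eval₂_map]
    exact hp0
  exact isIntegral_trans y this
lemma noeth {K : Type} [Field K] [Infinite K] {M n : ℕ} (hn : 0 < n) :
    ∃ (r : ℕ) (f : Fin r → MvPolynomial (Sig M n) K), (∀ i, f i ∈ SI K M n n) ∧ AlgebraicIndependent K f ∧
      ∀ g ∈ SI K M n n, IsIntegral (Algebra.adjoin K (Set.range f)) g := by
  classical
  have hex : ∃ N : ℕ, ∃ f : Fin N → MvPolynomial (Sig M n) K, (∀ i, f i ∈ SI K M n n) ∧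
      ∀ g ∈ SI K M n n, IsIntegral (Algebra.adjoin K (Set.range f)) g := by
    have hle : SI K M n n ≤ homogeneousSubmodule (Sig M n) K (n * n) := fun f hf => SI_homog hf
    have : Module.Finite K (homogeneousSubmodule (Sig M n) K (n * n)) :=
      Module.Finite.iff_fg.mpr (homogeneousSubmodule_fg _ _ _)
    have hfin : Module.Finite K (SI K M n n) := Submodule.finiteDimensional_of_le hle
    obtain ⟨N, s, hs⟩ := (Submodule.fg_iff_exists_fin_generating_family).mp (Module.Finite.iff_fg.mp hfin)
    refine ⟨N, s, fun i => hs ▸ Submodule.subset_span ⟨i, rfl⟩, fun g hg => ?_⟩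
    rw [← hs] at hg
    have : g ∈ Algebra.adjoin K (Set.range s) := Algebra.span_le_adjoin _ _ hg
    exact isIntegral_algebraMap (x := (⟨g, this⟩ : Algebra.adjoin K (Set.range s)))
  obtain ⟨f, hf, hint⟩ := Nat.find_spec hex
  refine ⟨_, f, hf, ?_, hint⟩
  by_contra hc
  have hm := fun m => Nat.find_min hex (m := m)
  revert f
  revert hm
  generalize Nat.find hex = N
  intro hm f hf hint hc
  obtain ⟨F, D, hF, hF0, hr⟩ := homog_rel f (n * n) (by positivity) (fun i => SI_homog (hf i)) hc
  cases N with
  | zero =>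
    apply hc
    rw [algebraicIndependent_empty_type_iff]
    exact (algebraMap K _).injective
  | succ N =>
    obtain ⟨c, hc⟩ := noeth_step f F D hF hF0 hr
    refine hm N (Nat.lt_succ_self N) ⟨fun i : Fin N => f i.succ - c i • f 0, fun i => ?_, fun g hg => ?_⟩
    · exact Submodule.sub_mem _ (hf _) (Submodule.smul_mem _ _ (hf _))
    · refine int_trans _ _ (Set.range f) rfl ?_ g (hint g hg)
      rintro _ ⟨i, rfl⟩; exact hc i
lemma integralElem_of {K S : Type} [Field K] [CommRing S] [Algebra K S] {r : ℕ} (f : Fin r → S) (y : S)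
    (hy : IsIntegral (Algebra.adjoin K (Set.range f)) y) :
    (aeval f : MvPolynomial (Fin r) K →ₐ[K] S).toRingHom.IsIntegralElem y := by
  obtain ⟨p, hp, hp0⟩ := hy
  let φ : MvPolynomial (Fin r) K →ₐ[K] Algebra.adjoin K (Set.range f) :=
    (aeval f : MvPolynomial (Fin r) K →ₐ[K] S).codRestrict _ (fun x => by
      rw [Algebra.adjoin_range_eq_range_aeval]; exact ⟨x, rfl⟩)
  have hφ : Function.Surjective φ := by
    rintro ⟨y, hy⟩
    have hy' := hy
    rw [Algebra.adjoin_range_eq_range_aeval] at hy'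
    obtain ⟨x, hx⟩ := hy'
    exact ⟨x, Subtype.ext hx⟩
  obtain ⟨q, hq, _, hqm⟩ := Polynomial.lifts_and_natDegree_eq_and_monic (f := φ.toRingHom)
    (by rw [Polynomial.lifts_iff_coeff_lifts]; intro k; exact hφ _) hp
  refine ⟨q, hqm, ?_⟩
  rw [← hq, Polynomial.eval₂_map] at hp0
  exact hp0
theorem T1 {K : Type} [Field K] [Infinite K] {M n : ℕ} (hn : 0 < n) :
    ∃ (r : ℕ) (f : Fin r → MvPolynomial (Sig M n) K), r ≤ M * n ^ 2 ∧ (∀ i, f i ∈ SI K M n n) ∧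
      ∀ e, ∀ h ∈ SI K M n e, IntEq K f h := by
  obtain ⟨r, f, hf, hai, hint⟩ := noeth (K := K) (M := M) hn
  refine ⟨r, f, ?_, hf, fun e h hh => ?_⟩
  · have h1 := hai.cardinalMk_le_trdeg
    rw [MvPolynomial.trdeg_of_isDomain, Cardinal.lift_id, Cardinal.mk_fin, Cardinal.mk_fintype] at h1
    have h2 : r ≤ Fintype.card (Sig M n) := by exact_mod_cast h1
    simp only [Sig, Fintype.card_prod, Fintype.card_fin] at h2
    rw [pow_two]; exact h2
  · obtain ⟨p, hp, hp0⟩ := D2 hn f hai (fun g hg => integralElem_of f g (hint g hg)) h hh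
    refine ⟨p.natDegree, fun j => - p.coeff j, ?_⟩
    rw [Polynomial.eval₂_eq_sum_range, Finset.sum_range_succ, hp.coeff_natDegree, map_one, one_mul] at hp0
    rw [eq_neg_of_add_eq_zero_right hp0, ← Finset.sum_neg_distrib]
    refine Finset.sum_congr rfl fun j _ => ?_
    rw [map_neg, neg_mul]; rfl
section
variable {K : Type} [Field K] {n m : ℕ}
theorem gen [IsAlgClosed K] {M : ℕ} (hn : 0 < n) (hM : 0 < M) (b : ℕ) : ∀ h ∈ SI K M n b,
    h ∈ Algebra.adjoin K {g : MvPolynomial (Sig M n) K | ∃ e ≤ M * n ^ 3, g ∈ SI K M n e} := by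
  haveI : Infinite K := IsAlgClosed.instInfinite
  obtain ⟨r, f, hr, hf, hint⟩ := T1 (K := K) (M := M) hn
  induction b using Nat.strong_induction_on with
  | _ b ih =>
    intro h hh
    by_cases hb : b ≤ M * n ^ 3
    · exact Algebra.subset_adjoin ⟨b, hb, hh⟩
    · push Not at hb
      have h1 : r * n < b := by
        refine lt_of_le_of_lt (Nat.mul_le_mul_right n hr) ?_
        rw [mul_assoc, ← pow_succ]; exact hb
      obtain ⟨s, hs, rfl⟩ := T2 hn hM f h n b hn hf hh (hint b h hh) h1
      refine Subalgebra.sum_mem _ fun i _ => Subalgebra.mul_mem _ ?_ ?_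
      · rw [pow_one]
        refine Algebra.subset_adjoin ⟨n, ?_, hf i⟩
        calc n = 1 * n ^ 1 := by simp
          _ ≤ M * n ^ 3 := Nat.mul_le_mul hM (Nat.pow_le_pow_right hn (by norm_num))
      · refine ih (b - n) ?_ _ (hs i)
        have : 0 < M * n ^ 3 := by positivity
        omega
lemma mem_inv {f : MvPolynomial (Sig m n) K} : f ∈ matrixInvariants K n m ↔
    ∀ (A : GeneralLinearGroup (Fin n) K) (X : Fin m → Matrix (Fin n) (Fin n) K),
      ev (fun i => A.val * X i * (A⁻¹).val) f = ev X f := by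
  simp only [matrixInvariants, Algebra.mem_iInf]
  rfl
lemma ev_ext [Infinite K] {M : ℕ} {f g : MvPolynomial (Sig M n) K} (h : ∀ X : Fin M → Matrix (Fin n) (Fin n) K, ev X f = ev X g) :
    f = g := by
  apply MvPolynomial.funext
  intro x
  have := h fun l => Matrix.of fun i j => x (l, i, j)
  have e : ∀ f : MvPolynomial (Sig M n) K, ev (fun l => Matrix.of fun i j => x (l, i, j)) f = eval x f := by
    intro f
    rw [← MvPolynomial.coe_aeval_eq_eval]; rfl
  rwa [e, e] at this
lemma gm_map {M : ℕ} {L : Type} [CommRing L] [Algebra K L] (X : Fin M → Matrix (Fin n) (Fin n) L) (l : Fin M) :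
    (gm K M n l).map (ev X) = X l := by
  ext i j
  simp [gm, ev_X]
lemma map_matmap {M : ℕ} {L : Type} [CommRing L] [Algebra K L] (φ : MvPolynomial (Sig M n) K →ₐ[K] L) (A : Matrix (Fin n) (Fin n) K) :
    (A.map (C : K →+* MvPolynomial (Sig M n) K)).map φ = A.map (algebraMap K L) := by
  ext i j
  simp
noncomputable def cj (A : GeneralLinearGroup (Fin n) K) : Fin m → Matrix (Fin n) (Fin n) (MvPolynomial (Sig m n) K) :=
  fun l => (A.val.map (C : K →+* MvPolynomial (Sig m n) K)) * gm K m n l * ((A⁻¹).val.map (C : K →+* MvPolynomial (Sig m n) K))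
lemma ev_cj (A : GeneralLinearGroup (Fin n) K) (X : Fin m → Matrix (Fin n) (Fin n) K) (f : MvPolynomial (Sig m n) K) :
    ev X (ev (cj A) f) = ev (fun i => A.val * X i * (A⁻¹).val) f := by
  rw [map_ev]
  congr 2
  funext l
  simp only [cj]
  rw [Matrix.map_mul, Matrix.map_mul, gm_map, map_matmap, map_matmap]
  rfl
lemma mem_inv' [Infinite K] {f : MvPolynomial (Sig m n) K} : f ∈ matrixInvariants K n m ↔
    ∀ (A : GeneralLinearGroup (Fin n) K), ev (cj A) f = f := by
  rw [mem_inv]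
  refine forall_congr' fun A => ⟨fun h => ev_ext fun X => by rw [ev_cj, h], fun h X => by rw [← ev_cj, h]⟩
lemma cj_homog (A : GeneralLinearGroup (Fin n) K) (l : Fin m) (i j : Fin n) : (cj A l i j).IsHomogeneous 1 := by
  simp only [cj, Matrix.mul_apply]
  refine IsHomogeneous.sum _ _ _ fun k _ => ?_
  refine IsHomogeneous.mul (m := 1) (n := 0) ?_ (isHomogeneous_C _ _)
  refine IsHomogeneous.sum _ _ _ fun k _ => ?_
  exact IsHomogeneous.mul (m := 0) (n := 1) (isHomogeneous_C _ _) (isHomogeneous_X _ _)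
lemma inv_comp [Infinite K] {f : MvPolynomial (Sig m n) K} (hf : f ∈ matrixInvariants K n m) (k : ℕ) :
    homogeneousComponent k f ∈ matrixInvariants K n m := by
  rw [mem_inv'] at hf ⊢
  intro A
  have := comp_subst (fun p : Sig m n => cj A p.1 p.2.1 p.2.2) 1 one_pos (fun p => cj_homog A _ _ _) f k
  rw [one_mul] at this
  change homogeneousComponent k (ev (cj A) f) = ev (cj A) (homogeneousComponent k f) at this
  rw [← this, hf]
lemma ev_smul {M δ : ℕ} {f : MvPolynomial (Sig M n) K} (hf : f.IsHomogeneous δ) (c : K) (X : Fin M → Matrix (Fin n) (Fin n) K) :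
    ev (fun l => c • X l) f = c ^ δ * ev X f := by
  simp only [ev, aeval_def, eval₂_eq, Finset.mul_sum]
  refine Finset.sum_congr rfl fun d hd => ?_
  have h1 : δ = ∑ i ∈ d.support, d i := hf.degree_eq_sum_deg_support hd
  simp only [Matrix.smul_apply, smul_eq_mul, mul_pow, Finset.prod_mul_distrib]
  rw [h1, Finset.prod_pow_eq_pow_sum]
  ring
noncomputable def psi (K : Type) [Field K] (m n : ℕ) : MvPolynomial (Sig (m+1) n) K →ₐ[K] MvPolynomial (Sig m n) K :=
  ev (Fin.cons (α := fun _ => Matrix (Fin n) (Fin n) (MvPolynomial (Sig m n) K)) 1 (gm K m n))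
lemma ev_psi (X : Fin m → Matrix (Fin n) (Fin n) K) (g : MvPolynomial (Sig (m+1) n) K) :
    ev X (psi K m n g) = ev (Fin.cons (α := fun _ => Matrix (Fin n) (Fin n) K) 1 X) g := by
  rw [psi, map_ev]
  congr 2
  funext l
  refine Fin.cases ?_ (fun i => ?_) l
  · simp only [Fin.cons_zero]
    exact Matrix.map_one _ (map_zero _) (map_one _)
  · simp only [Fin.cons_succ]; exact gm_map X i
lemma psi_inv {e : ℕ} {g : MvPolynomial (Sig (m+1) n) K} (hg : g ∈ SI K (m+1) n e) : psi K m n g ∈ matrixInvariants K n m := by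
  rw [mem_inv]
  intro A X
  rw [ev_psi, ev_psi]
  have h1 : A.val.det * (A⁻¹).val.det = 1 := by
    rw [← det_mul, ← Units.val_mul, mul_inv_cancel]; simp
  have hA : A.val.det ≠ 0 := left_ne_zero_of_mul_eq_one h1
  have hA' : (A⁻¹).val.det ≠ 0 := right_ne_zero_of_mul_eq_one h1
  have := hg A.val (A⁻¹).val hA hA' (Fin.cons (α := fun _ => Matrix (Fin n) (Fin n) K) 1 X)
  rw [h1, one_pow, one_mul] at this
  rw [← this]
  congr 2
  funext l
  refine Fin.cases ?_ (fun i => ?_) l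
  · simp only [Fin.cons_zero, mul_one]
    rw [← Units.val_mul, mul_inv_cancel]; rfl
  · simp only [Fin.cons_succ]
lemma totalDegree_subst {σ τ : Type} (u : σ → MvPolynomial τ K) (hu : ∀ i, (u i).totalDegree ≤ 1) (g : MvPolynomial σ K) (D : ℕ)
    (hg : g.IsHomogeneous D) : (aeval u g).totalDegree ≤ D := by
  rw [aeval_def, eval₂_eq]
  refine totalDegree_finsetSum_le fun d hd => ?_
  have h1 : D = ∑ i ∈ d.support, d i := hg.degree_eq_sum_deg_support hd
  refine (totalDegree_mul _ _).trans ?_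
  rw [MvPolynomial.algebraMap_eq, totalDegree_C, zero_add, h1]
  refine (totalDegree_finsetProd _ _).trans (Finset.sum_le_sum fun i _ => ?_)
  refine (totalDegree_pow _ _).trans ?_
  simpa using Nat.mul_le_mul_left (d i) (hu i)
lemma psi_deg [Infinite K] {e : ℕ} {g : MvPolynomial (Sig (m+1) n) K} (hg : g ∈ SI K (m+1) n e) : (psi K m n g).totalDegree ≤ n * e := by
  refine totalDegree_subst _ ?_ g _ (SI_homog hg)
  rintro ⟨l, i, j⟩
  refine Fin.cases ?_ (fun k => ?_) l
  · simp only [Fin.cons_zero, Matrix.one_apply]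
    split_ifs <;> simp
  · simp only [Fin.cons_succ, gm, Matrix.of_apply]
    rw [totalDegree_X]
noncomputable def hgz (f : MvPolynomial (Sig m n) K) : MvPolynomial (Sig (m+1) n) K :=
  ev (fun i : Fin m => adjugate (gm K (m+1) n 0) * gm K (m+1) n i.succ) f
lemma ev_hgz (f : MvPolynomial (Sig m n) K) {L : Type} [CommRing L] [Algebra K L] (X : Fin (m+1) → Matrix (Fin n) (Fin n) L) :
    ev X (hgz f) = ev (fun i : Fin m => adjugate (X 0) * X i.succ) f := by
  rw [hgz, map_ev]
  congr 2
  funext l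
  rw [Matrix.map_mul, gm_map]
  congr 1
  have := (ev (K := K) X).map_adjugate (gm K (m+1) n 0)
  rw [AlgHom.mapMatrix_apply, AlgHom.mapMatrix_apply, gm_map] at this
  exact this
lemma hgz_SI {δ : ℕ} {f : MvPolynomial (Sig m n) K} (hf : f ∈ matrixInvariants K n m) (hδ : f.IsHomogeneous δ) :
    hgz f ∈ SI K (m+1) n δ := by
  rw [mem_inv] at hf
  intro P Q hP hQ X
  rw [ev_hgz, ev_hgz]
  let A : GeneralLinearGroup (Fin n) K := (GeneralLinearGroup.mkOfDetNeZero Q hQ)⁻¹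
  rw [← hf A (fun i : Fin m => adjugate (X 0) * X i.succ), ← ev_smul hδ]
  congr 2
  funext i
  have hA : ((A⁻¹).val : Matrix (Fin n) (Fin n) K) = Q := by simp only [A, inv_inv]; rfl
  have hAQ : A.val * Q = 1 := by
    rw [← hA, ← Units.val_mul, mul_inv_cancel]; rfl
  have hadj : adjugate Q = Q.det • A.val := by
    calc adjugate Q = A.val * Q * adjugate Q := by rw [hAQ, one_mul]
      _ = Q.det • A.val := by rw [Matrix.mul_assoc, mul_adjugate, Matrix.mul_smul, mul_one]
  rw [hA, adjugate_mul_distrib, adjugate_mul_distrib, hadj]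
  calc Q.det • A.val * (adjugate (X 0) * adjugate P) * (P * X i.succ * Q)
      = Q.det • A.val * adjugate (X 0) * (adjugate P * P) * X i.succ * Q := by simp only [Matrix.mul_assoc]
    _ = _ := by
      rw [adjugate_mul]
      simp only [Matrix.mul_smul, Matrix.smul_mul, mul_one, smul_smul, Matrix.mul_assoc]
lemma psi_hgz (f : MvPolynomial (Sig m n) K) : psi K m n (hgz f) = f := by
  rw [psi, ev_hgz]
  conv_rhs => rw [← ev_gm f]
  congr 2
  funext i
  simp only [Fin.cons_zero, Fin.cons_succ, adjugate_one, one_mul]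
end
end MI
/-- Over an algebraically closed field of arbitrary characteristic, the ring of
matrix invariants `S(n,m)` is generated by its homogeneous elements of degree `≤ (m+1) * n^4`. -/
theorem stmt_2 (K : Type) [Field K] [IsAlgClosed K] (n m : ℕ) (hn : 0 < n) (hm : 0 < m) :
    Algebra.adjoin K
        {f | f ∈ matrixInvariants K n m ∧ ∃ d ≤ (m + 1) * n ^ 4, f.IsHomogeneous d}
      = matrixInvariants K n m := by
  haveI : Infinite K := IsAlgClosed.instInfinite
  apply le_antisymm
  · exact Algebra.adjoin_le fun f hf => hf.1
  · intro f hf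
    rw [← sum_homogeneousComponent f]
    refine Subalgebra.sum_mem _ fun δ _ => ?_
    have h1 := MI.gen hn (Nat.succ_pos m) δ _
      (MI.hgz_SI (MI.inv_comp hf δ) (homogeneousComponent_isHomogeneous δ f))
    rw [← MI.psi_hgz (homogeneousComponent δ f)]
    have h2 : Algebra.adjoin K {g : MvPolynomial (MI.Sig (m+1) n) K | ∃ e ≤ (m+1) * n ^ 3, g ∈ MI.SI K (m+1) n e} ≤
        (Algebra.adjoin K {f | f ∈ matrixInvariants K n m ∧ ∃ d ≤ (m + 1) * n ^ 4, f.IsHomogeneous d}).comap (MI.psi K m n) := by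
      refine Algebra.adjoin_le ?_
      rintro g ⟨e, he, hg⟩
      rw [SetLike.mem_coe, Subalgebra.mem_comap]
      rw [← sum_homogeneousComponent (MI.psi K m n g)]
      refine Subalgebra.sum_mem _ fun k hk => Algebra.subset_adjoin ?_
      refine ⟨MI.inv_comp (MI.psi_inv hg) k, k, ?_, homogeneousComponent_isHomogeneous k _⟩
      have h3 := MI.psi_deg hg
      rw [Finset.mem_range] at hk
      calc k ≤ n * e := by omega
        _ ≤ n * ((m+1) * n ^ 3) := Nat.mul_le_mul_left n he
        _ = (m + 1) * n ^ 4 := by ring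
    exact h2 h1
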